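/- arXiv:2207.03979 — 3 statements merged into one kernel-verified Lean document; each statement's English description precedes it below -/
import Mathlib

section
/- Let k be a complete nontrivially normed field that is algebraically closed, let U be an open neighborhood of 0 in k^m, and let f, g_1, …, g_n : U → k be analytic functions such that for all a ∈ U, g_1(a) = ⋯ = g_n(a) = 0 implies f(a) = 0. Then there exist an open neighborhood V ⊆ U of 0, analytic functions h_1, …, h_n : V → k, and an integer k' ≥ 1 such that f^{k'} = g_1 h_1 + ⋯ + g_n h_n on V. -/
open Filter Topology

section Substitution

variable {𝕜 E A : Type*} [NontriviallyNormedField 𝕜] [NormedAddCommGroup E] [NormedSpace 𝕜 E]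
  [NormedRing A] [NormedAlgebra 𝕜 A]

/-- The power series of `(x, w) ↦ f (x, w • S)`, where the second variable of the scalar series `p`
of `f` is replaced by an element `S` of a normed algebra. -/
noncomputable def FormalMultilinearSeries.substSnd (p : FormalMultilinearSeries 𝕜 (E × 𝕜) 𝕜)
    (S : A) : FormalMultilinearSeries 𝕜 (E × 𝕜) A := fun n =>
  ∑ s : Finset (Fin n), ((p n).compContinuousLinearMap fun i =>
    if i ∈ s then (ContinuousLinearMap.inr 𝕜 E 𝕜).comp (ContinuousLinearMap.snd 𝕜 E 𝕜)
    else (ContinuousLinearMap.inl 𝕜 E 𝕜).comp (ContinuousLinearMap.fst 𝕜 E 𝕜)).smulRight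
      (S ^ s.card)

namespace FormalMultilinearSeries

theorem substSnd_apply (p : FormalMultilinearSeries 𝕜 (E × 𝕜) 𝕜) (S : A) (n : ℕ) (v : E × 𝕜) :
    (p.substSnd S n fun _ => v) = ∑ s : Finset (Fin n),
      p n (s.piecewise (fun _ => (0, v.2)) fun _ => (v.1, 0)) • S ^ s.card := by
  simp only [substSnd, _root_.sum_apply, ContinuousMultilinearMap.smulRight_apply,
    ContinuousMultilinearMap.compContinuousLinearMap_apply]
  refine Finset.sum_congr rfl fun s _ => ?_
  congr 2
  ext1 i
  by_cases hi : i ∈ s <;> simp [hi]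

theorem norm_substSnd_le [NormOneClass A] (p : FormalMultilinearSeries 𝕜 (E × 𝕜) 𝕜) {S : A}
    (hS : ‖S‖ ≤ 1) (n : ℕ) : ‖p.substSnd S n‖ ≤ 2 ^ n * ‖p n‖ := by
  refine (norm_sum_le _ _).trans ?_
  have : ∀ s ∈ (Finset.univ : Finset (Finset (Fin n))),
      ‖((p n).compContinuousLinearMap fun i =>
    if i ∈ s then (ContinuousLinearMap.inr 𝕜 E 𝕜).comp (ContinuousLinearMap.snd 𝕜 E 𝕜)
    else (ContinuousLinearMap.inl 𝕜 E 𝕜).comp (ContinuousLinearMap.fst 𝕜 E 𝕜)).smulRight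
      (S ^ s.card)‖ ≤ ‖p n‖ := by
    intro s _
    rw [ContinuousMultilinearMap.norm_smulRight]
    have h1 : ‖S ^ s.card‖ ≤ 1 := (norm_pow_le _ _).trans (pow_le_one₀ (norm_nonneg _) hS)
    refine (mul_le_of_le_one_right (norm_nonneg _) h1).trans ?_
    refine (ContinuousMultilinearMap.norm_compContinuousLinearMap_le _ _).trans ?_
    refine mul_le_of_le_one_right (norm_nonneg _) (Finset.prod_le_one (fun _ _ => norm_nonneg _) ?_)
    intro i _
    split_ifs
    · refine ContinuousLinearMap.opNorm_le_bound _ zero_le_one fun v => ?_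
      simp [Prod.norm_def]
    · refine ContinuousLinearMap.opNorm_le_bound _ zero_le_one fun v => ?_
      simp [Prod.norm_def]
  refine (Finset.sum_le_sum this).trans ?_
  simp

theorem substSnd_radius_pos [NormOneClass A] {p : FormalMultilinearSeries 𝕜 (E × 𝕜) 𝕜} {S : A}
    (hS : ‖S‖ ≤ 1) (hp : 0 < p.radius) : 0 < (p.substSnd S).radius := by
  obtain ⟨r, hr0, hr⟩ := ENNReal.lt_iff_exists_nnreal_btwn.1 hp
  obtain ⟨C, -, hC⟩ := p.norm_mul_pow_le_of_lt_radius hr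
  have hr0' : 0 < r := by exact_mod_cast hr0
  refine lt_of_lt_of_le ?_ ((p.substSnd S).le_radius_of_bound (r := r / 2) C fun n => ?_)
  · exact_mod_cast half_pos hr0'
  · calc ‖p.substSnd S n‖ * ((r / 2 : NNReal) : ℝ) ^ n
        ≤ (2 ^ n * ‖p n‖) * ((r / 2 : NNReal) : ℝ) ^ n := by
          gcongr
          exact p.norm_substSnd_le hS n
      _ = ‖p n‖ * (r : ℝ) ^ n := by
          push_cast
          rw [div_pow]
          field_simp
      _ ≤ C := hC n

theorem map_substSnd_apply (p : FormalMultilinearSeries 𝕜 (E × 𝕜) 𝕜) {S : A} (L : A →L[𝕜] 𝕜)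
    {z c : 𝕜} (hL : ∀ j, L (S ^ j) = z ^ j * c) (n : ℕ) (v : E × 𝕜) :
    L (p.substSnd S n fun _ => v) = (p n fun _ => (v.1, z * v.2)) * c := by
  classical
  have h := (p n).map_add_univ (fun _ => (0, z * v.2)) (fun _ => (v.1, 0))
  have h2 : ((fun _ => (0, z * v.2)) + fun _ => (v.1, 0) : Fin n → E × 𝕜) =
      fun _ => (v.1, z * v.2) := by ext <;> simp
  rw [h2] at h
  rw [h, substSnd_apply, map_sum, Finset.sum_mul]
  refine Finset.sum_congr rfl fun s _ => ?_
  have h3 := (p n).map_piecewise_smul (fun _ => z)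
    (s.piecewise (fun _ => ((0 : E), v.2)) fun _ => (v.1, 0)) s
  have h4 : (s.piecewise (fun i => z • (s.piecewise (fun _ => ((0 : E), v.2))
      fun _ => (v.1, (0 : 𝕜)) : Fin n → E × 𝕜) i)
      (s.piecewise (fun _ => ((0 : E), v.2)) fun _ => (v.1, 0)) : Fin n → E × 𝕜) =
      s.piecewise (fun _ => (0, z * v.2)) fun _ => (v.1, 0) := by
    ext1 i
    by_cases hi : i ∈ s <;> simp [hi]
  rw [h4] at h3
  simp only [Finset.prod_const] at h3
  rw [h3, map_smul, hL, smul_eq_mul, smul_eq_mul]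
  ring

theorem substSnd_apply_inr (p : FormalMultilinearSeries 𝕜 (E × 𝕜) 𝕜) (S : A) (n : ℕ) (w : 𝕜) :
    (p.substSnd S n fun _ => (0, w)) = (w ^ n * p n fun _ => (0, 1)) • S ^ n := by
  classical
  rw [substSnd_apply, Finset.sum_eq_single Finset.univ]
  · have := (p n).map_smul_univ (fun _ => w) (fun _ => ((0 : E), (1 : 𝕜)))
    simp only [Prod.smul_mk, smul_zero, smul_eq_mul, mul_one, Finset.prod_const, Finset.card_univ,
      Fintype.card_fin] at this
    simp [this]
  · intro s _ hs
    obtain ⟨i, hi⟩ : ∃ i, i ∉ s := by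
      by_contra! h
      exact hs (Finset.eq_univ_of_forall h)
    rw [(p n).map_coord_zero i (by simp [hi]), zero_smul]
  · simp

end FormalMultilinearSeries

/-- Substituting an element `S` of norm at most `1` of a Banach algebra for the second variable of
an analytic function. -/
theorem HasFPowerSeriesAt.exists_substSnd [CompleteSpace A] [NormOneClass A] {f : E × 𝕜 → 𝕜}
    {p : FormalMultilinearSeries 𝕜 (E × 𝕜) 𝕜} (hf : HasFPowerSeriesAt f p 0) {S : A}
    (hS : ‖S‖ ≤ 1) :
    ∃ Φ : E × 𝕜 → A, HasFPowerSeriesAt Φ (p.substSnd S) 0 ∧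
      ∃ ε > 0, ∀ v : E × 𝕜, ‖v‖ < ε → AnalyticAt 𝕜 Φ v ∧
      HasSum (fun n => p.substSnd S n fun _ => v) (Φ v) ∧
      ∀ (L : A →L[𝕜] 𝕜) (z c : 𝕜), ‖z‖ ≤ 1 → (∀ j, L (S ^ j) = z ^ j * c) →
        L (Φ v) = f (v.1, z * v.2) * c := by
  obtain ⟨r, hr⟩ := hf
  have hpos := FormalMultilinearSeries.substSnd_radius_pos hS (hr.r_pos.trans_le hr.r_le)
  have hP := (p.substSnd S).hasFPowerSeriesOnBall hpos
  obtain ⟨ε, hε0, hε⟩ := ENNReal.lt_iff_exists_nnreal_btwn.1 (lt_min hr.r_pos hpos)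
  refine ⟨(p.substSnd S).sum, hP.hasFPowerSeriesAt, ε, by exact_mod_cast hε0, fun v hv => ?_⟩
  have hv' : ‖v‖ₑ < ε := by
    rw [← enorm_norm, ← ofReal_norm, ENNReal.ofReal_lt_iff_lt_toReal] <;> simp [hv]
  have hb : v ∈ Metric.eball (0 : E × 𝕜) (p.substSnd S).radius := by
    simpa using hv'.trans (hε.trans_le (min_le_right _ _))
  have hsum := hP.hasSum hb
  rw [zero_add] at hsum
  refine ⟨hP.analyticAt_of_mem hb, hsum, fun L z c hz hL => ?_⟩
  have hb' : (v.1, z * v.2) ∈ Metric.eball (0 : E × 𝕜) r := by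
    have h1 : ‖((v.1, z * v.2) : E × 𝕜)‖ ≤ ‖v‖ := by
      rw [Prod.norm_def, Prod.norm_def, norm_mul]
      exact max_le_max le_rfl (mul_le_of_le_one_left (norm_nonneg _) hz)
    have h2 : ‖((v.1, z * v.2) : E × 𝕜)‖ₑ ≤ ‖v‖ₑ := by
      rw [← ofReal_norm, ← ofReal_norm]
      exact ENNReal.ofReal_le_ofReal h1
    simpa using (h2.trans_lt hv').trans (hε.trans_le (min_le_left _ _))
  have h1 := (hr.hasSum hb').mul_right c
  rw [zero_add] at h1
  have h2 := L.hasSum hsum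
  simp only [p.map_substSnd_apply L hL] at h2
  exact h2.unique h1

end Substitution

section ShiftOperators

variable {𝕜 : Type*} [NontriviallyNormedField 𝕜]

open scoped BoundedContinuousFunction

variable (𝕜) in
/-- The left shift on bounded sequences. -/
noncomputable def leftShift : (ℕ →ᵇ 𝕜) →L[𝕜] (ℕ →ᵇ 𝕜) :=
  LinearMap.mkContinuous
    { toFun := fun y => y.compContinuous ⟨Nat.succ, continuous_of_discreteTopology⟩
      map_add' := fun _ _ => rfl
      map_smul' := fun _ _ => rfl } 1 fun y => by
    rw [one_mul]
    exact (BoundedContinuousFunction.norm_le (norm_nonneg _)).2 fun n => y.norm_coe_le_norm _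

theorem leftShift_pow_apply (d : ℕ) (y : ℕ →ᵇ 𝕜) (n : ℕ) : (leftShift 𝕜 ^ d) y n = y (n + d) := by
  induction d generalizing y with
  | zero => rfl
  | succ d ih => rw [pow_succ, mul_apply_eq_comp, ih]; rfl

theorem norm_leftShift_pow_le (d : ℕ) : ‖leftShift 𝕜 ^ d‖ ≤ 1 :=
  ContinuousLinearMap.opNorm_le_bound _ zero_le_one fun y => by
    rw [one_mul]
    refine (BoundedContinuousFunction.norm_le (norm_nonneg _)).2 fun n => ?_
    rw [leftShift_pow_apply]
    exact y.norm_coe_le_norm _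

variable (𝕜) in
/-- The right shift on bounded sequences, i.e. multiplication by the variable when the sequence is
viewed as a power series. -/
noncomputable def rightShift : (ℕ →ᵇ 𝕜) →L[𝕜] (ℕ →ᵇ 𝕜) :=
  LinearMap.mkContinuous
    { toFun := fun y => BoundedContinuousFunction.ofNormedAddCommGroupDiscrete
        (fun n => Nat.casesOn n 0 fun k => y k) ‖y‖ fun n => by
          cases n with
          | zero => simp
          | succ n => exact y.norm_coe_le_norm n
      map_add' := fun x y => by
        ext n
        cases n with
        | zero => simp
        | succ n => simp
      map_smul' := fun c y => by
        ext n
        cases n with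
        | zero => simp
        | succ n => simp } 1 fun y => by
    rw [one_mul]
    refine (BoundedContinuousFunction.norm_le (norm_nonneg _)).2 fun n => ?_
    cases n with
    | zero => simp
    | succ n => exact y.norm_coe_le_norm n

theorem rightShift_apply_zero (y : ℕ →ᵇ 𝕜) : rightShift 𝕜 y 0 = 0 := rfl

theorem rightShift_apply_succ (y : ℕ →ᵇ 𝕜) (n : ℕ) : rightShift 𝕜 y (n + 1) = y n := rfl

theorem norm_rightShift_le : ‖rightShift 𝕜‖ ≤ 1 := LinearMap.mkContinuous_norm_le _ zero_le_one _

theorem rightShift_pow_apply_add (d : ℕ) (y : ℕ →ᵇ 𝕜) (n : ℕ) :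
    (rightShift 𝕜 ^ d) y (n + d) = y n := by
  induction d with
  | zero => rfl
  | succ d ih => rw [pow_succ', mul_apply_eq_comp, ← add_assoc, rightShift_apply_succ, ih]

theorem rightShift_pow_apply_of_lt {d n : ℕ} (h : n < d) (y : ℕ →ᵇ 𝕜) :
    (rightShift 𝕜 ^ d) y n = 0 := by
  induction d generalizing n with
  | zero => omega
  | succ d ih =>
    rw [pow_succ', mul_apply_eq_comp]
    cases n with
    | zero => exact rightShift_apply_zero _
    | succ n => rw [rightShift_apply_succ, ih (by omega)]

/-- A power series in one variable with coefficients in the unit ball of a Banach space sums to an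
analytic function. -/
theorem exists_analyticAt_hasSum_pow_smul {F : Type*} [NormedAddCommGroup F] [NormedSpace 𝕜 F]
    [CompleteSpace F] (c : ℕ → F) (hc : ∀ n, ‖c n‖ ≤ 1) :
    ∃ G : 𝕜 → F, AnalyticAt 𝕜 G 0 ∧ ∀ z : 𝕜, ‖z‖ < 1 → HasSum (fun n => z ^ n • c n) (G z) := by
  let p : FormalMultilinearSeries 𝕜 𝕜 F := fun n => ContinuousMultilinearMap.mkPiRing 𝕜 _ (c n)
  have hp : 1 ≤ p.radius := by
    rw [← ENNReal.coe_one]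
    refine p.le_radius_of_bound 1 fun n => ?_
    simpa [p, ContinuousMultilinearMap.norm_mkPiRing] using hc n
  have h := p.hasFPowerSeriesOnBall (zero_lt_one.trans_le hp)
  refine ⟨p.sum, h.analyticAt, fun z hz => ?_⟩
  have hz' : z ∈ Metric.eball (0 : 𝕜) p.radius := by
    have : ‖z‖ₑ < 1 := by
      rw [← ofReal_norm, ENNReal.ofReal_lt_one]; exact hz
    simpa using this.trans_le hp
  simpa [p] using h.hasSum hz'

theorem norm_evalCLM_le_one (n : ℕ) :
    ‖(BoundedContinuousFunction.evalCLM 𝕜 n : (ℕ →ᵇ 𝕜) →L[𝕜] 𝕜)‖ ≤ 1 :=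
  ContinuousLinearMap.opNorm_le_bound _ zero_le_one fun y => by
    rw [one_mul]
    exact y.norm_coe_le_norm n

variable [CompleteSpace 𝕜]

theorem exists_analyticAt_genEval :
    ∃ ev : 𝕜 → (ℕ →ᵇ 𝕜) →L[𝕜] 𝕜, AnalyticAt 𝕜 ev 0 ∧
      ∀ z : 𝕜, ‖z‖ < 1 → ∀ y : ℕ →ᵇ 𝕜, HasSum (fun n => z ^ n * y n) (ev z y) := by
  obtain ⟨G, hG, h⟩ := exists_analyticAt_hasSum_pow_smul (𝕜 := 𝕜)
    (F := (ℕ →ᵇ 𝕜) →L[𝕜] 𝕜) (fun n => BoundedContinuousFunction.evalCLM 𝕜 n) norm_evalCLM_le_one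
  refine ⟨G, hG, fun z hz y => ?_⟩
  have := (ContinuousLinearMap.apply 𝕜 𝕜 y).hasSum (h z hz)
  simpa using this

/-- Evaluation of a bounded sequence, viewed as a power series, at a point of the open unit
disc. -/
noncomputable def genEval : 𝕜 → (ℕ →ᵇ 𝕜) →L[𝕜] 𝕜 := exists_analyticAt_genEval.choose

theorem analyticAt_genEval_zero : AnalyticAt 𝕜 (genEval (𝕜 := 𝕜)) 0 :=
  exists_analyticAt_genEval.choose_spec.1

theorem hasSum_genEval {z : 𝕜} (hz : ‖z‖ < 1) (y : ℕ →ᵇ 𝕜) :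
    HasSum (fun n => z ^ n * y n) (genEval z y) :=
  exists_analyticAt_genEval.choose_spec.2 z hz y

theorem genEval_rightShift_pow {z : 𝕜} (hz : ‖z‖ < 1) (d : ℕ) (y : ℕ →ᵇ 𝕜) :
    genEval z ((rightShift 𝕜 ^ d) y) = z ^ d * genEval z y := by
  have h1 := hasSum_genEval hz ((rightShift 𝕜 ^ d) y)
  have h2 := (hasSum_genEval hz y).mul_left (z ^ d)
  rw [← hasSum_nat_add_iff' d] at h1
  rw [Finset.sum_eq_zero fun i hi => by
    rw [rightShift_pow_apply_of_lt (Finset.mem_range.1 hi), mul_zero], sub_zero] at h1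
  refine h1.unique (h2.congr_fun fun n => ?_)
  rw [rightShift_pow_apply_add]; ring

theorem genEval_eq_add_leftShift {z : 𝕜} (hz : ‖z‖ < 1) (d : ℕ) (y : ℕ →ᵇ 𝕜) :
    genEval z y = ∑ i ∈ Finset.range d, z ^ i * y i + z ^ d * genEval z ((leftShift 𝕜 ^ d) y) := by
  have h1 := hasSum_genEval hz y
  have h2 := (hasSum_genEval hz ((leftShift 𝕜 ^ d) y)).mul_left (z ^ d)
  rw [← hasSum_nat_add_iff' d] at h1
  rw [eq_comm, ← eq_sub_iff_add_eq', eq_comm]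
  refine h1.unique (h2.congr_fun fun n => ?_)
  rw [leftShift_pow_apply]; ring

end ShiftOperators

section WeierstrassDivision

variable {𝕜 E : Type*} [NontriviallyNormedField 𝕜] [NormedAddCommGroup E] [NormedSpace 𝕜 E]

open scoped BoundedContinuousFunction

theorem AnalyticAt.continuousLinearMap_apply {F G : Type*} [NormedAddCommGroup F] [NormedSpace 𝕜 F]
    [NormedAddCommGroup G] [NormedSpace 𝕜 G] {φ : E → F →L[𝕜] G} {u : E → F} {x : E}
    (hφ : AnalyticAt 𝕜 φ x) (hu : AnalyticAt 𝕜 u x) : AnalyticAt 𝕜 (fun y => φ y (u y)) x :=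
  ((ContinuousLinearMap.id 𝕜 (F →L[𝕜] G)).analyticAt_bilinear (φ x, u x)).comp₂ hφ hu

theorem exists_analyticAt_rightInverse {A : Type*} [NormedRing A] [NormedAlgebra 𝕜 A]
    [CompleteSpace A] {Γ : E → A} (hΓ : AnalyticAt 𝕜 Γ 0) {S L : A} (hS : ‖Γ 0 - S‖ < 1)
    (hL : ‖L‖ ≤ 1) :
    ∃ N : E → A, AnalyticAt 𝕜 N 0 ∧ ∀ᶠ x in 𝓝 0, (1 + (Γ x - S) * L) * N x = 1 := by
  have hM : AnalyticAt 𝕜 (fun x => 1 + (Γ x - S) * L) 0 :=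
    analyticAt_const.fun_add ((hΓ.fun_sub analyticAt_const).fun_mul analyticAt_const)
  have hM0 : IsUnit (1 + (Γ 0 - S) * L) := by
    have h1 : ‖-((Γ 0 - S) * L)‖ < 1 := by
      rw [norm_neg]
      exact (norm_mul_le _ _).trans_lt
        ((mul_le_of_le_one_right (norm_nonneg _) hL).trans_lt hS)
    have := isUnit_one_sub_of_norm_lt_one h1
    rwa [sub_neg_eq_add] at this
  refine ⟨fun x => Ring.inverse (1 + (Γ x - S) * L), ?_, ?_⟩
  · obtain ⟨u, hu⟩ := hM0
    have := analyticAt_inverse (𝕜 := 𝕜) u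
    rw [hu] at this
    exact AnalyticAt.fun_comp (f := fun x => 1 + (Γ x - S) * L) this hM
  · filter_upwards [hM.continuousAt.eventually_mem (Units.isOpen.mem_nhds hM0)] with x hx
    exact Ring.mul_inverse_cancel _ hx

/-- If the restriction of a power series to the second axis has order `d`, substituting `w • S` for
the second variable gives, up to a scalar factor, an element close to `S ^ d` for small `w`. -/
theorem eventually_norm_substSnd_sub_lt {A : Type*} [NormedRing A] [NormedAlgebra 𝕜 A]
    {p : FormalMultilinearSeries 𝕜 (E × 𝕜) 𝕜} {S : A} {Φ : E × 𝕜 → A}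
    (hΦ : HasFPowerSeriesAt Φ (p.substSnd S) 0) {d : ℕ} (hd : (p d fun _ => (0, 1)) ≠ 0)
    (hlt : ∀ i < d, (p i fun _ => (0, 1)) = 0) :
    ∀ᶠ w in 𝓝[≠] (0 : 𝕜), ‖((p d fun _ => (0, 1)) * w ^ d)⁻¹ • Φ (0, w) - S ^ d‖ < 1 := by
  set b := p d fun _ => (0, 1) with hb
  have h1 : Tendsto (fun w : 𝕜 => ((0 : E), w)) (𝓝 0) (𝓝 0) :=
    Continuous.tendsto' (by fun_prop) _ _ rfl
  obtain ⟨C, hC⟩ := ((hΦ.isBigO_sub_partialSum_pow (d + 1)).comp_tendsto h1).bound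
  have h2 : Tendsto (fun w : 𝕜 => C * ‖w‖ / ‖b‖) (𝓝 0) (𝓝 0) :=
    Continuous.tendsto' (by fun_prop) _ _ (by simp)
  filter_upwards [hC.filter_mono nhdsWithin_le_nhds,
    (h2.eventually (gt_mem_nhds zero_lt_one)).filter_mono nhdsWithin_le_nhds,
    self_mem_nhdsWithin] with w hw hw1 hw0
  have hw0 : w ≠ 0 := hw0
  have h3 : (p.substSnd S).partialSum (d + 1) ((0 : E), w) = (b * w ^ d) • S ^ d := by
    rw [FormalMultilinearSeries.partialSum, Finset.sum_range_succ, Finset.sum_eq_zero, zero_add,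
      p.substSnd_apply_inr, mul_comm]
    intro i hi
    rw [p.substSnd_apply_inr, hlt i (Finset.mem_range.1 hi), mul_zero, zero_smul]
  have h4 : ‖((0 : E), w)‖ = ‖w‖ := by simp [Prod.norm_def]
  simp only [Function.comp_apply, zero_add, h3, h4, norm_pow, norm_norm] at hw
  have hbw : b * w ^ d ≠ 0 := mul_ne_zero hd (pow_ne_zero _ hw0)
  have h5 : (b * w ^ d)⁻¹ • Φ (0, w) - S ^ d =
      (b * w ^ d)⁻¹ • (Φ (0, w) - (b * w ^ d) • S ^ d) := by
    rw [smul_sub, inv_smul_smul₀ hbw]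
  rw [h5, norm_smul, norm_inv, norm_mul, norm_pow]
  refine lt_of_le_of_lt ?_ hw1
  have hw' : 0 < ‖w‖ := norm_pos_iff.2 hw0
  have hb' : 0 < ‖b‖ := norm_pos_iff.2 hd
  calc (‖b‖ * ‖w‖ ^ d)⁻¹ * _ ≤ (‖b‖ * ‖w‖ ^ d)⁻¹ * (C * ‖w‖ ^ (d + 1)) := by gcongr
    _ = C * ‖w‖ / ‖b‖ := by field_simp; ring

variable [CompleteSpace 𝕜]

theorem exists_analyticAt_mul_leftShift_add_eq {d : ℕ} {Γ : E → (ℕ →ᵇ 𝕜) →L[𝕜] (ℕ →ᵇ 𝕜)}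
    (hΓ : AnalyticAt 𝕜 Γ 0) (hd : ‖Γ 0 - rightShift 𝕜 ^ d‖ < 1) {F : E → ℕ →ᵇ 𝕜}
    (hF : AnalyticAt 𝕜 F 0) :
    ∃ Y : E → ℕ →ᵇ 𝕜, AnalyticAt 𝕜 Y 0 ∧ ∀ᶠ x in 𝓝 0,
      Γ x ((leftShift 𝕜 ^ d) (Y x)) + (Y x - (rightShift 𝕜 ^ d) ((leftShift 𝕜 ^ d) (Y x))) =
        F x := by
  obtain ⟨N, hN, h⟩ := exists_analyticAt_rightInverse (A := (ℕ →ᵇ 𝕜) →L[𝕜] (ℕ →ᵇ 𝕜)) hΓ hd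
    (norm_leftShift_pow_le d)
  refine ⟨fun x => N x (F x), hN.continuousLinearMap_apply hF, ?_⟩
  filter_upwards [h] with x hx
  have h2 := congr_arg (fun T : (ℕ →ᵇ 𝕜) →L[𝕜] (ℕ →ᵇ 𝕜) => T (F x)) hx
  simp only [_root_.add_apply, mul_apply_eq_comp, _root_.sub_apply, one_apply_eq_self] at h2
  refine Eq.trans ?_ h2
  abel

theorem exists_div_of_genEval {f g : E × 𝕜 → 𝕜} {t c : 𝕜} (ht : t ≠ 0) {d : ℕ}
    {Γ : E → (ℕ →ᵇ 𝕜) →L[𝕜] (ℕ →ᵇ 𝕜)} (hΓ : AnalyticAt 𝕜 Γ 0)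
    (hd : ‖Γ 0 - rightShift 𝕜 ^ d‖ < 1)
    (hg : ∀ᶠ x in 𝓝 0, ∀ z y, ‖z‖ < 1 → genEval z (Γ x y) = c * g (x, z * t) * genEval z y)
    {F : E → ℕ →ᵇ 𝕜} (hF : AnalyticAt 𝕜 F 0)
    (hf : ∀ᶠ x in 𝓝 0, ∀ z, ‖z‖ < 1 → genEval z (F x) = f (x, z * t)) :
    ∃ (q : E × 𝕜 → 𝕜) (r : ℕ → E → 𝕜), AnalyticAt 𝕜 q 0 ∧ (∀ i, AnalyticAt 𝕜 (r i) 0) ∧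
      (∀ᶠ v in 𝓝 0, f v = q v * g v + ∑ i ∈ Finset.range d, r i v.1 * v.2 ^ i) ∧
      ∀ i < d, (∀ y, Γ 0 y i = 0) → F 0 i = 0 → r i 0 = 0 := by
  obtain ⟨Y, hY, h⟩ := exists_analyticAt_mul_leftShift_add_eq hΓ hd hF
  have hfst : AnalyticAt 𝕜 (fun v : E × 𝕜 => Y v.1) 0 :=
    AnalyticAt.comp (g := Y) (f := Prod.fst) (x := (0 : E × 𝕜)) hY analyticAt_fst
  have hsnd : AnalyticAt 𝕜 (fun v : E × 𝕜 => genEval (v.2 * t⁻¹)) 0 :=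
    AnalyticAt.fun_comp (g := genEval (𝕜 := 𝕜)) (f := fun v : E × 𝕜 => v.2 * t⁻¹) (x := (0 : E × 𝕜))
      (by simpa using analyticAt_genEval_zero) (analyticAt_snd.mul analyticAt_const)
  refine ⟨fun v => c * genEval (v.2 * t⁻¹) ((leftShift 𝕜 ^ d) (Y v.1)),
    fun i x => Y x i * (t⁻¹) ^ i, ?_, fun i => ?_, ?_, fun i hi h1 h2 => ?_⟩
  · exact analyticAt_const.mul (hsnd.continuousLinearMap_apply
      (((leftShift 𝕜 ^ d).analyticAt _).fun_comp hfst))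
  · exact (((BoundedContinuousFunction.evalCLM 𝕜 i).analyticAt _).fun_comp hY).mul analyticAt_const
  · have h1 : Tendsto (fun v : E × 𝕜 => v.1) (𝓝 0) (𝓝 0) := continuous_fst.tendsto' _ _ rfl
    have h2 : Tendsto (fun v : E × 𝕜 => ‖v.2 * t⁻¹‖) (𝓝 0) (𝓝 0) :=
      Continuous.tendsto' (by fun_prop) _ _ (by simp)
    filter_upwards [h1.eventually hg, h1.eventually hf, h1.eventually h,
      h2.eventually (gt_mem_nhds zero_lt_one)] with v hg hf h hz
    have hv : v.2 * t⁻¹ * t = v.2 := by field_simp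
    have h3 := congr_arg (genEval (v.2 * t⁻¹)) h
    rw [hf _ hz, map_add, map_sub, hg _ _ hz, genEval_rightShift_pow hz,
      genEval_eq_add_leftShift hz d (Y v.1), hv, add_sub_cancel_right] at h3
    rw [← Prod.mk.eta (p := v), ← h3]
    simp only [mul_pow]
    congr 1
    · ring
    · exact Finset.sum_congr rfl fun i _ => by ring
  · have h3 := congr_arg (fun y : ℕ →ᵇ 𝕜 => y i) h.self_of_nhds
    simp only [BoundedContinuousFunction.coe_add, BoundedContinuousFunction.coe_sub, Pi.add_apply,
      Pi.sub_apply, h1, h2, rightShift_pow_apply_of_lt hi, zero_add, sub_zero] at h3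
    simp [h3]

theorem exists_unit_genEval :
    ∃ e : ℕ →ᵇ 𝕜, ∀ z : 𝕜, ‖z‖ < 1 → genEval z e = 1 := by
  refine ⟨BoundedContinuousFunction.const ℕ 1 - rightShift 𝕜 (BoundedContinuousFunction.const ℕ 1),
    fun z hz => ?_⟩
  rw [genEval_eq_add_leftShift hz 1]
  have h : (leftShift 𝕜 ^ 1) (BoundedContinuousFunction.const ℕ (1 : 𝕜) -
      rightShift 𝕜 (BoundedContinuousFunction.const ℕ 1)) = 0 := by
    ext n
    rw [leftShift_pow_apply]
    simp [rightShift_apply_succ]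
  rw [h]
  simp [rightShift_apply_zero]

/-- **Weierstrass division and preparation** for analytic functions of `(x, z)`, at a function which
does not vanish identically on the line `x = 0`. -/
theorem exists_weierstrass_division {g : E × 𝕜 → 𝕜} (hg : AnalyticAt 𝕜 g 0)
    (hg0 : ¬ ∀ᶠ z in 𝓝 (0 : 𝕜), g (0, z) = 0) :
    ∃ d : ℕ, (∀ f : E × 𝕜 → 𝕜, AnalyticAt 𝕜 f 0 → ∃ (q : E × 𝕜 → 𝕜) (r : ℕ → E → 𝕜),
      AnalyticAt 𝕜 q 0 ∧ (∀ i, AnalyticAt 𝕜 (r i) 0) ∧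
      ∀ᶠ v in 𝓝 0, f v = q v * g v + ∑ i ∈ Finset.range d, r i v.1 * v.2 ^ i) ∧
    ∃ (q : E × 𝕜 → 𝕜) (r : ℕ → E → 𝕜), AnalyticAt 𝕜 q 0 ∧ (∀ i, AnalyticAt 𝕜 (r i) 0) ∧
      (∀ᶠ v in 𝓝 0, v.2 ^ d = q v * g v + ∑ i ∈ Finset.range d, r i v.1 * v.2 ^ i) ∧
      ∀ i < d, r i 0 = 0 := by
  classical
  have : Nontrivial (ℕ →ᵇ 𝕜) := ⟨BoundedContinuousFunction.const ℕ 1, 0, fun h => by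
    simpa using congr_arg (fun y : ℕ →ᵇ 𝕜 => y 0) h⟩
  obtain ⟨p, hp⟩ := hg
  have hex : ∃ n, (p n fun _ => ((0 : E), (1 : 𝕜))) ≠ 0 := by
    by_contra! h
    refine hg0 ?_
    have h1 : Tendsto (fun w : 𝕜 => ((0 : E), w)) (𝓝 0) (𝓝 0) :=
      Continuous.tendsto' (by fun_prop) _ _ rfl
    filter_upwards [h1.eventually hp.eventually_hasSum] with w hw
    have h2 : ∀ n, (p n fun _ => ((0 : E), w)) = 0 := fun n => by
      have := (p n).map_smul_univ (fun _ => w) (fun _ => ((0 : E), (1 : 𝕜)))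
      simpa [h] using this
    simp only [h2, zero_add] at hw
    exact hw.unique hasSum_zero
  set d := Nat.find hex with hd
  have hb : (p d fun _ => ((0 : E), (1 : 𝕜))) ≠ 0 := Nat.find_spec hex
  have hlt : ∀ i < d, (p i fun _ => ((0 : E), (1 : 𝕜))) = 0 := fun i hi => by
    simpa using Nat.find_min hex hi
  set b := p d fun _ => ((0 : E), (1 : 𝕜))
  obtain ⟨Φ, hΦ, ε, hε, h⟩ := hp.exists_substSnd (S := rightShift 𝕜) norm_rightShift_le
  have hnear := eventually_norm_substSnd_sub_lt hΦ hb hlt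
  obtain ⟨e, he⟩ := exists_unit_genEval (𝕜 := 𝕜)
  have hnorm : ∀ {t : 𝕜} {δ : ℝ}, ‖t‖ < δ → ∀ᶠ x in 𝓝 (0 : E), ‖(x, t)‖ < δ := fun {t δ} ht => by
    have h1 : Tendsto (fun x : E => ‖(x, t)‖) (𝓝 0) (𝓝 ‖((0 : E), t)‖) :=
      Continuous.tendsto (by fun_prop) _
    exact h1.eventually (gt_mem_nhds (by simpa [Prod.norm_def] using ht))
  have hsmall : ∀ {δ : ℝ}, 0 < δ → ∀ᶠ t in 𝓝[≠] (0 : 𝕜), ‖t‖ < δ := fun {δ} hδ => by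
    have : Tendsto (fun t : 𝕜 => ‖t‖) (𝓝 0) (𝓝 0) := Continuous.tendsto' (by fun_prop) _ _ (by simp)
    exact (this.eventually (gt_mem_nhds hδ)).filter_mono nhdsWithin_le_nhds
  have hslice : ∀ {G : Type _} [NormedAddCommGroup G] [NormedSpace 𝕜 G] {Ψ : E × 𝕜 → G} {t : 𝕜},
      AnalyticAt 𝕜 Ψ (0, t) → AnalyticAt 𝕜 (fun x : E => Ψ (x, t)) 0 := fun {G _ _ Ψ t} hΨ =>
    AnalyticAt.fun_comp (g := Ψ) (f := fun x : E => (x, t)) hΨ (analyticAt_id.prod analyticAt_const)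
  have hΓ : ∀ {t : 𝕜}, ‖t‖ < ε → AnalyticAt 𝕜 (fun x : E => (b * t ^ d)⁻¹ • Φ (x, t)) 0 :=
    fun {t} ht => (analyticAt_const (v := (b * t ^ d)⁻¹)).fun_smul
      (hslice (h (0, t) (hnorm ht).self_of_nhds).1)
  have hgen : ∀ {t : 𝕜}, ‖t‖ < ε → ∀ᶠ x in 𝓝 (0 : E), ∀ z y, ‖z‖ < 1 →
      genEval z (((b * t ^ d)⁻¹ • Φ (x, t)) y) =
        (b * t ^ d)⁻¹ * g (x, z * t) * genEval z y := fun {t} ht => by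
    filter_upwards [hnorm ht] with x hx z y hz
    have := (h (x, t) hx).2.2 ((genEval z).comp (ContinuousLinearMap.apply 𝕜 _ y)) z (genEval z y)
      hz.le fun j => by simpa using genEval_rightShift_pow hz j y
    rw [ContinuousLinearMap.comp_apply, ContinuousLinearMap.apply_apply] at this
    rw [_root_.smul_apply, map_smul, this, smul_eq_mul, mul_assoc]
  refine ⟨d, fun f hf => ?_, ?_⟩
  · obtain ⟨pf, hpf⟩ := hf
    obtain ⟨Φf, -, εf, hεf, hh⟩ := hpf.exists_substSnd (S := rightShift 𝕜) norm_rightShift_le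
    obtain ⟨t, h1, h2, h3, h4⟩ := (hnear.and ((hsmall hε).and ((hsmall hεf).and
      (self_mem_nhdsWithin (a := (0 : 𝕜)) (s := {0}ᶜ))))).exists
    obtain ⟨q, r, hq, hr, hv, -⟩ := exists_div_of_genEval (f := f) (g := g) h4 (hΓ h2) h1 (hgen h2)
      (F := fun x => Φf (x, t) e)
      ((hslice (hh (0, t) (hnorm h3).self_of_nhds).1).continuousLinearMap_apply
        analyticAt_const) (by
        filter_upwards [hnorm h3] with x hx z hz
        have := (hh (x, t) hx).2.2 ((genEval z).comp (ContinuousLinearMap.apply 𝕜 _ e)) z 1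
          hz.le fun j => by simpa [he z hz] using genEval_rightShift_pow hz j e
        simpa using this)
    exact ⟨q, r, hq, hr, hv⟩
  · obtain ⟨t, h1, h2, h4⟩ := (hnear.and ((hsmall hε).and
      (self_mem_nhdsWithin (a := (0 : 𝕜)) (s := {0}ᶜ)))).exists
    obtain ⟨q, r, hq, hr, hv, h0⟩ := exists_div_of_genEval (f := fun v => v.2 ^ d) (g := g) h4
      (hΓ h2) h1 (hgen h2) (F := fun x => t ^ d • (rightShift 𝕜 ^ d) e) analyticAt_const
      (.of_forall fun x z hz => by
        rw [map_smul, genEval_rightShift_pow hz, he z hz, smul_eq_mul]; ring)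
    refine ⟨q, r, hq, hr, hv, fun i hi => h0 i hi (fun y => ?_) ?_⟩
    · have hs := (h (0, t) (hnorm h2).self_of_nhds).2.1
      have := ((BoundedContinuousFunction.evalCLM 𝕜 i).comp
        (ContinuousLinearMap.apply 𝕜 (ℕ →ᵇ 𝕜) y)).hasSum hs
      have h0 : ∀ n, ((BoundedContinuousFunction.evalCLM 𝕜 i).comp
          (ContinuousLinearMap.apply 𝕜 (ℕ →ᵇ 𝕜) y)) (p.substSnd (rightShift 𝕜) n
            fun _ => ((0 : E), t)) = 0 := fun n => by
        rw [p.substSnd_apply_inr]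
        rcases lt_or_ge n d with hn | hn
        · simp [hlt n hn]
        · rw [ContinuousLinearMap.comp_apply, ContinuousLinearMap.apply_apply, _root_.smul_apply,
            map_smul, BoundedContinuousFunction.evalCLM_apply,
            rightShift_pow_apply_of_lt (hi.trans_le hn), smul_zero]
      simp only [h0] at this
      have h5 : Φ (0, t) y i = 0 := this.unique hasSum_zero
      simp [h5]
    · rw [BoundedContinuousFunction.smul_apply, rightShift_pow_apply_of_lt hi, smul_zero]

end WeierstrassDivision

section Elimination

open Polynomial

/-- If `S` is generated by one integral element `z` modulo the prime ideal `P`, every element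
outside `P` has, modulo `P`, a multiple in `R` which lies outside `P`. -/
theorem Ideal.IsPrime.exists_notMem_of_forall_eval₂ {R S : Type*} [CommRing R] [CommRing S]
    {P : Ideal S} [P.IsPrime] (φ : R →+* S) {z : S} {W : R[X]} (hW : W.Monic)
    (hWz : W.eval₂ φ z ∈ P) (hz : ∀ s : S, ∃ G : R[X], s - G.eval₂ φ z ∈ P) {s : S} (hs : s ∉ P) :
    ∃ c : R, φ c ∉ P ∧ ∃ b, φ c - b * s ∈ P := by
  let _ : Algebra R (S ⧸ P) := ((Ideal.Quotient.mk P).comp φ).toAlgebra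
  have hev : ∀ G : R[X], Ideal.Quotient.mk P (G.eval₂ φ z) = aeval (Ideal.Quotient.mk P z) G :=
    fun G => by
      rw [hom_eval₂]; rfl
  have hzint : IsIntegral R (Ideal.Quotient.mk P z) :=
    ⟨W, hW, by
      rw [← aeval_def, ← hev]
      exact Ideal.Quotient.eq_zero_iff_mem.2 hWz⟩
  obtain ⟨G, hG⟩ := hz s
  have hsint : IsIntegral R (Ideal.Quotient.mk P s) := by
    rw [Ideal.Quotient.eq.2 hG, hev]
    exact .of_mem_of_fg _ hzint.fg_adjoin_singleton _ (aeval_mem_adjoin_singleton R _)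
  obtain ⟨p, hp, hps⟩ := hsint
  have hps' : p.eval₂ φ s ∈ P := by
    rw [← Ideal.Quotient.eq_zero_iff_mem, hom_eval₂]
    exact hps
  have := Ideal.comap_ne_top φ (Ideal.IsPrime.ne_top ‹P.IsPrime›)
  have : Nontrivial (R ⧸ P.comap φ) := Ideal.Quotient.nontrivial_iff.2 this
  obtain ⟨i, h1, h2⟩ := Ideal.exists_coeff_mem_comap_sdiff_comap_of_root_mem_sdiff (f := φ)
    (le_sup_left : P ≤ P ⊔ Ideal.span {s})
    ⟨Ideal.mem_sup_right (Ideal.mem_span_singleton_self s), hs⟩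
    (hp.map (Ideal.Quotient.mk (P.comap φ))).ne_zero hps'
  refine ⟨p.coeff i, h2, ?_⟩
  obtain ⟨y, hy, x, hx, h⟩ := Submodule.mem_sup.1 (show φ (p.coeff i) ∈ _ from h1)
  obtain ⟨b, rfl⟩ := Ideal.mem_span_singleton'.1 hx
  exact ⟨b, by rwa [← h, add_sub_cancel_right]⟩

theorem Polynomial.eval₂_sum_C_X_pow_mul_map_C {R L : Type*} [CommRing R] [CommRing L]
    (ev : R →+* L) (a : L) {ι : Type*} (s : Finset ι) (idx : ι → ℕ) (G : ι → R[X]) :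
    (∑ j ∈ s, C (X ^ idx j) * (G j).map C : R[X][X]).eval₂ (mapRingHom ev) (C a) =
      ∑ j ∈ s, X ^ idx j * C ((G j).eval₂ ev a) := by
  simp only [eval₂_finsetSum, eval₂_mul, eval₂_C, eval₂_map, hom_eval₂]
  refine Finset.sum_congr rfl fun j _ => ?_
  congr 2
  · simp
  · ext; simp

/-- Elimination of one variable: if `ζ` is a common root of polynomials `G j` and of the monic
polynomial `W`, there is a finite system of elements killed by `ρ` (the coefficients of `D`) whose
vanishing under any specialization to an algebraically closed field ensures the existence of a
common root. -/
theorem Polynomial.Monic.exists_eliminant {R B : Type*} [CommRing R] [CommRing B]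
    (K : Type*) [Field K] [IsAlgClosed K] (ρ : R →+* B) {ζ : B} {W : R[X]} (hW : W.Monic)
    (hWζ : W.eval₂ ρ ζ = 0) {ι : Type*} (s : Finset ι) (G : ι → R[X])
    (hG : ∀ j ∈ s, (G j).eval₂ ρ ζ = 0) :
    ∃ D : R[X], (∀ i, ρ (D.coeff i) = 0) ∧ ∀ ev : R →+* K, D.map ev = 0 →
      ∃ α : K, W.eval₂ ev α = 0 ∧ ∀ j ∈ s, (G j).eval₂ ev α = 0 := by
  classical
  let idx : ι → ℕ := fun j => if h : j ∈ s then s.equivFin ⟨j, h⟩ else 0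
  have hidx : Set.InjOn idx s := fun i hi j hj h => by
    have hi' : i ∈ s := hi
    have hj' : j ∈ s := hj
    simp only [idx, hi', hj', dif_pos] at h
    simpa using s.equivFin.injective (Fin.ext h)
  let Γ : R[X][X] := ∑ j ∈ s, C (X ^ idx j) * (G j).map C
  let n := Γ.natDegree + 1
  let D := resultant (W.map C) Γ W.natDegree n
  refine ⟨D, fun i => ?_, fun ev hD => ?_⟩
  · obtain ⟨p, q, -, -, h⟩ := exists_mul_add_mul_eq_C_resultant (m := W.natDegree) (n := n)
      (W.map C) Γ natDegree_map_le (Nat.le_succ _) (.inr (Nat.succ_ne_zero _))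
    have h2 := congr_arg (eval₂ (mapRingHom ρ) (C ζ)) h
    have h3 : (W.map C).eval₂ (mapRingHom ρ) (C ζ) = 0 := by
      rw [eval₂_map, ← C_0, ← hWζ, hom_eval₂]
      congr 1
      ext; simp
    rw [eval₂_add, eval₂_mul, eval₂_mul, h3, eval₂_sum_C_X_pow_mul_map_C, eval₂_C,
      Finset.sum_eq_zero fun j hj => by rw [hG j hj, C_0, mul_zero]] at h2
    have h4 := congr_arg (fun f : B[X] => f.coeff i) h2
    simpa [D] using h4.symm
  · have hW' : (W.map C).map (mapRingHom ev) = (W.map ev).map C := by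
      rw [Polynomial.map_map, Polynomial.map_map]
      congr 1
      ext; simp
    have hdeg : ((W.map ev).map (C : K →+* K[X])).natDegree = W.natDegree := by
      rw [(hW.map ev).natDegree_map, hW.natDegree_map]
    have hsplit : (W.map ev).Splits := IsAlgClosed.splits _
    have h1 : D.map ev = resultant ((W.map ev).map C) (Γ.map (mapRingHom ev))
        ((W.map ev).map (C : K →+* K[X])).natDegree n := by
      rw [hdeg, ← hW', resultant_map_map]; rfl
    rw [hD, resultant_eq_prod_eval _ _ _ (natDegree_map_le.trans (Nat.le_succ _))
      (hsplit.map _), ((hW.map ev).map C).leadingCoeff, one_pow, one_mul, eq_comm,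
      Multiset.prod_eq_zero_iff, hsplit.roots_map, Multiset.map_map, Multiset.mem_map] at h1
    obtain ⟨α, hα, h2⟩ := h1
    refine ⟨α, ?_, fun j hj => ?_⟩
    · rw [← eval_map]
      exact (mem_roots'.1 hα).2
    · rw [Function.comp_apply, eval_map, eval₂_sum_C_X_pow_mul_map_C] at h2
      have h3 := congr_arg (fun f : K[X] => f.coeff (idx j)) h2
      simp only [finsetSum_coeff, X_pow_mul_C, coeff_C_mul_X_pow, coeff_zero] at h3
      rw [Finset.sum_eq_single j] at h3
      · simpa using h3
      · intro i hi hij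
        rw [if_neg fun h => hij (hidx hi hj h.symm)]
      · exact fun h => (h hj).elim

end Elimination

/-- Roots of a monic polynomial whose lower coefficients tend to zero tend to zero. -/
theorem eventually_forall_root_norm_lt {𝕜 E : Type*} [NontriviallyNormedField 𝕜]
    [NormedAddCommGroup E] {d : ℕ} {r : ℕ → E → 𝕜}
    (hr : ∀ i < d, Tendsto (r i) (𝓝 0) (𝓝 0)) {ε : ℝ} (hε : 0 < ε) :
    ∀ᶠ x in 𝓝 0, ∀ α : 𝕜, α ^ d = ∑ i ∈ Finset.range d, r i x * α ^ i → ‖α‖ < ε := by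
  have h : Tendsto (fun x => ∑ i ∈ Finset.range d, ‖r i x‖ * ε⁻¹ ^ (d - i)) (𝓝 0) (𝓝 0) := by
    have h0 : (0 : ℝ) = ∑ i ∈ Finset.range d, 0 := by simp
    conv_rhs => rw [h0]
    refine tendsto_finsetSum (M := ℝ) _ fun i hi => ?_
    simpa using (hr i (Finset.mem_range.1 hi)).norm.mul_const (ε⁻¹ ^ (d - i))
  filter_upwards [h.eventually (gt_mem_nhds zero_lt_one)] with x hx α hα
  by_contra! hle
  have hpos : 0 < ‖α‖ := hε.trans_le hle
  have h1 : ‖α‖ ^ d ≤ ‖α‖ ^ d * ∑ i ∈ Finset.range d, ‖r i x‖ * ε⁻¹ ^ (d - i) := by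
    rw [Finset.mul_sum]
    calc ‖α‖ ^ d = ‖∑ i ∈ Finset.range d, r i x * α ^ i‖ := by rw [← hα, norm_pow]
      _ ≤ ∑ i ∈ Finset.range d, ‖r i x * α ^ i‖ := norm_sum_le _ _
      _ ≤ _ := Finset.sum_le_sum fun i hi => by
        have h2 : 1 ≤ ‖α‖ * ε⁻¹ := by rwa [← div_eq_mul_inv, one_le_div hε]
        have h3 : ‖α‖ ^ d = ‖α‖ ^ i * ‖α‖ ^ (d - i) := by
          rw [← pow_add, Nat.add_sub_cancel' (Finset.mem_range.1 hi).le]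
        rw [norm_mul, norm_pow, h3]
        calc ‖r i x‖ * ‖α‖ ^ i = ‖r i x‖ * ‖α‖ ^ i * 1 := (mul_one _).symm
          _ ≤ ‖r i x‖ * ‖α‖ ^ i * (‖α‖ * ε⁻¹) ^ (d - i) := by
            gcongr
            exact one_le_pow₀ h2
          _ = _ := by ring
  have h2 := mul_lt_mul_of_pos_left hx (pow_pos hpos d)
  linarith

section AnalyticRing

variable {𝕜 E F : Type*} [NontriviallyNormedField 𝕜] [NormedAddCommGroup E] [NormedSpace 𝕜 E]
  [NormedAddCommGroup F] [NormedSpace 𝕜 F]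

variable (𝕜 E) in
/-- The ring of functions which are analytic at the origin. -/
def analyticSubring : Subring (E → 𝕜) where
  carrier := {f | AnalyticAt 𝕜 f 0}
  mul_mem' := fun hf hg => AnalyticAt.mul hf hg
  one_mem' := analyticAt_const
  add_mem' := fun hf hg => AnalyticAt.add hf hg
  zero_mem' := analyticAt_const
  neg_mem' := fun hf => AnalyticAt.neg hf

/-- Composition with an analytic map fixing the origin. -/
def analyticSubring.comp (u : E → F) (hu : AnalyticAt 𝕜 u 0) (hu0 : u 0 = 0) :
    analyticSubring 𝕜 F →+* analyticSubring 𝕜 E where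
  toFun f := ⟨fun x => (f : F → 𝕜) (u x),
    AnalyticAt.fun_comp (g := (f : F → 𝕜)) (hu0 ▸ f.2) hu⟩
  map_one' := rfl
  map_mul' _ _ := rfl
  map_zero' := rfl
  map_add' _ _ := rfl

variable (𝕜) in
/-- Evaluation of functions at a point. -/
def analyticSubring.eval (a : E) : analyticSubring 𝕜 E →+* 𝕜 :=
  (Pi.evalRingHom (fun _ => 𝕜) a).comp (analyticSubring 𝕜 E).subtype

theorem analyticSubring.eval_apply (a : E) (f : analyticSubring 𝕜 E) :
    analyticSubring.eval 𝕜 a f = (f : E → 𝕜) a := rfl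

theorem analyticSubring.mem_of_eventually_eq {P : Ideal (analyticSubring 𝕜 E)}
    (hP : ∀ f : analyticSubring 𝕜 E, (∀ᶠ x in 𝓝 0, (f : E → 𝕜) x = 0) → f ∈ P)
    {f g : analyticSubring 𝕜 E} (hf : f ∈ P)
    (h : ∀ᶠ x in 𝓝 0, (g : E → 𝕜) x = (f : E → 𝕜) x) : g ∈ P := by
  rw [← sub_add_cancel g f]
  refine P.add_mem (hP _ ?_) hf
  filter_upwards [h] with x hx
  exact sub_eq_zero.2 hx

variable (𝕜 E) in
/-- The zeros near the origin of finitely many elements of a prime ideal of germs are dense enough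
to detect that an element is not in the ideal. -/
def HasPrimeZeros : Prop :=
  ∀ P : Ideal (analyticSubring 𝕜 E), P.IsPrime →
    (∀ f : analyticSubring 𝕜 E, (∀ᶠ x in 𝓝 0, (f : E → 𝕜) x = 0) → f ∈ P) →
    ∀ f ∉ P, ∀ s : Finset (analyticSubring 𝕜 E), (∀ g ∈ s, g ∈ P) →
      ∃ᶠ x in 𝓝 0, (f : E → 𝕜) x ≠ 0 ∧ ∀ g ∈ s, (g : E → 𝕜) x = 0

variable [CompleteSpace 𝕜]

/-- Weierstrass preparation in the ring of functions analytic at the origin, together with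
division by the Weierstrass polynomial. -/
theorem exists_weierstrass_polynomial {g : E × 𝕜 → 𝕜} (hg : AnalyticAt 𝕜 g 0)
    (hg0 : ¬ ∀ᶠ z in 𝓝 (0 : 𝕜), g (0, z) = 0) :
    ∃ (d : ℕ) (r : ℕ → E → 𝕜), (∀ i, AnalyticAt 𝕜 (r i) 0) ∧ (∀ i < d, r i 0 = 0) ∧
      (∃ q : E × 𝕜 → 𝕜, AnalyticAt 𝕜 q 0 ∧
        ∀ᶠ v in 𝓝 0, v.2 ^ d - ∑ i ∈ Finset.range d, r i v.1 * v.2 ^ i = q v * g v) ∧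
      ∀ f : E × 𝕜 → 𝕜, AnalyticAt 𝕜 f 0 → ∃ (q : E × 𝕜 → 𝕜) (d' : ℕ) (r' : ℕ → E → 𝕜),
        AnalyticAt 𝕜 q 0 ∧ (∀ i, AnalyticAt 𝕜 (r' i) 0) ∧
        ∀ᶠ v in 𝓝 0, f v = q v * (v.2 ^ d - ∑ i ∈ Finset.range d, r i v.1 * v.2 ^ i) +
          ∑ i ∈ Finset.range d', r' i v.1 * v.2 ^ i := by
  obtain ⟨d, -, q, r, hq, hr, h, h0⟩ := exists_weierstrass_division hg hg0
  have hw : AnalyticAt 𝕜 (fun v : E × 𝕜 =>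
      v.2 ^ d - ∑ i ∈ Finset.range d, r i v.1 * v.2 ^ i) 0 := by
    refine (analyticAt_snd.fun_pow d).fun_sub (Finset.analyticAt_fun_sum _ fun i _ => ?_)
    exact (AnalyticAt.fun_comp (g := r i) (f := Prod.fst) (x := (0 : E × 𝕜)) (hr i)
      analyticAt_fst).fun_mul (analyticAt_snd.fun_pow i)
  have hw0 : ¬ ∀ᶠ z in 𝓝 (0 : 𝕜), (z ^ d - ∑ i ∈ Finset.range d, r i 0 * z ^ i) = 0 := fun h => by
    have h1 : ∀ᶠ z in 𝓝[≠] (0 : 𝕜), False := by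
      filter_upwards [h.filter_mono nhdsWithin_le_nhds, self_mem_nhdsWithin] with z hz hz0
      rw [Finset.sum_eq_zero fun i hi => by rw [h0 i (Finset.mem_range.1 hi), zero_mul],
        sub_zero] at hz
      exact hz0 (eq_zero_of_pow_eq_zero hz)
    exact h1.exists.elim fun _ h => h
  obtain ⟨d', hdiv, -⟩ := exists_weierstrass_division hw hw0
  refine ⟨d, r, hr, h0, ⟨q, hq, h.mono fun v hv => by rw [hv]; ring⟩, fun f hf => ?_⟩
  obtain ⟨q', r', h⟩ := hdiv f hf
  exact ⟨q', d', r', h⟩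

end AnalyticRing

section PrimeZeros

open Polynomial

variable {𝕜 E : Type*} [NontriviallyNormedField 𝕜] [NormedAddCommGroup E] [NormedSpace 𝕜 E]

variable (𝕜 E) in
/-- Functions of the first variable, as functions of both variables. -/
noncomputable def analyticSubring.compFst :
    analyticSubring 𝕜 E →+* analyticSubring 𝕜 (E × 𝕜) :=
  analyticSubring.comp Prod.fst analyticAt_fst rfl

variable (𝕜 E) in
/-- The second coordinate. -/
def analyticSubring.sndCoord : analyticSubring 𝕜 (E × 𝕜) := ⟨Prod.snd, analyticAt_snd⟩

theorem analyticSubring.eval₂_compFst_apply (G : (analyticSubring 𝕜 E)[X]) (v : E × 𝕜) :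
    ((G.eval₂ (compFst 𝕜 E) (sndCoord 𝕜 E) : analyticSubring 𝕜 (E × 𝕜)) : E × 𝕜 → 𝕜) v =
      G.eval₂ (eval 𝕜 v.1) v.2 := by
  rw [← eval_apply v, hom_eval₂]
  rfl

theorem analyticSubring.eval₂_sum_C_mul_X_pow (r : ℕ → analyticSubring 𝕜 E) (d : ℕ) (a : E)
    (α : 𝕜) : (∑ i ∈ Finset.range d, C (r i) * X ^ i).eval₂ (eval 𝕜 a) α =
      ∑ i ∈ Finset.range d, (r i : E → 𝕜) a * α ^ i := by
  simp [eval₂_finsetSum, eval_apply]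

variable [CompleteSpace 𝕜]

theorem exists_monic_weierstrass {g : analyticSubring 𝕜 (E × 𝕜)}
    (hg0 : ¬ ∀ᶠ z in 𝓝 (0 : 𝕜), (g : E × 𝕜 → 𝕜) (0, z) = 0) :
    ∃ W : (analyticSubring 𝕜 E)[X], W.Monic ∧
      (∀ ε > 0, ∀ᶠ x in 𝓝 0, ∀ α : 𝕜, W.eval₂ (analyticSubring.eval 𝕜 x) α = 0 → ‖α‖ < ε) ∧
      (∃ q : analyticSubring 𝕜 (E × 𝕜), ∀ᶠ v in 𝓝 0,
        W.eval₂ (analyticSubring.eval 𝕜 v.1) v.2 = (q : E × 𝕜 → 𝕜) v * (g : E × 𝕜 → 𝕜) v) ∧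
      ∀ f : analyticSubring 𝕜 (E × 𝕜), ∃ (q : analyticSubring 𝕜 (E × 𝕜))
        (G : (analyticSubring 𝕜 E)[X]), ∀ᶠ v in 𝓝 0, (f : E × 𝕜 → 𝕜) v =
          (q : E × 𝕜 → 𝕜) v * W.eval₂ (analyticSubring.eval 𝕜 v.1) v.2 +
            G.eval₂ (analyticSubring.eval 𝕜 v.1) v.2 := by
  obtain ⟨d, r, hr, h0, ⟨q, hq, hqg⟩, hdiv⟩ := exists_weierstrass_polynomial g.2 hg0
  let r₁ : ℕ → analyticSubring 𝕜 E := fun i => ⟨r i, hr i⟩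
  let W : (analyticSubring 𝕜 E)[X] := X ^ d - ∑ i ∈ Finset.range d, C (r₁ i) * X ^ i
  have hWev : ∀ (x : E) (α : 𝕜), W.eval₂ (analyticSubring.eval 𝕜 x) α =
      α ^ d - ∑ i ∈ Finset.range d, r i x * α ^ i := fun x α => by
    rw [eval₂_sub, analyticSubring.eval₂_sum_C_mul_X_pow, eval₂_X_pow]
  refine ⟨W, ?_, fun ε hε => ?_, ⟨⟨q, hq⟩, ?_⟩, fun f => ?_⟩
  · refine monic_X_pow_sub ?_
    rw [← mem_degreeLT]
    refine sum_mem fun i hi => ?_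
    rw [mem_degreeLT]
    exact (degree_C_mul_X_pow_le _ _).trans_lt (by exact_mod_cast Finset.mem_range.1 hi)
  · filter_upwards [eventually_forall_root_norm_lt (d := d) (r := r)
      (fun i hi => by simpa [h0 i hi] using (hr i).continuousAt.tendsto) hε] with x hx α hα
    rw [hWev, sub_eq_zero] at hα
    exact hx α hα
  · simpa only [hWev] using hqg
  · obtain ⟨q', d', r', hq', hr', h⟩ := hdiv f f.2
    refine ⟨⟨q', hq'⟩, ∑ i ∈ Finset.range d', C ⟨r' i, hr' i⟩ * X ^ i, ?_⟩
    simpa only [hWev, analyticSubring.eval₂_sum_C_mul_X_pow] using h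

variable [IsAlgClosed 𝕜]

/-- The inductive step: existence of zeros for a prime ideal containing a function which does not
vanish identically on the last axis. -/
theorem HasPrimeZeros.frequently_of_regular (hE : HasPrimeZeros 𝕜 E)
    {P : Ideal (analyticSubring 𝕜 (E × 𝕜))} [P.IsPrime]
    (hP : ∀ f : analyticSubring 𝕜 (E × 𝕜), (∀ᶠ x in 𝓝 0, (f : E × 𝕜 → 𝕜) x = 0) → f ∈ P)
    {g : analyticSubring 𝕜 (E × 𝕜)} (hg : g ∈ P)
    (hg0 : ¬ ∀ᶠ z in 𝓝 (0 : 𝕜), (g : E × 𝕜 → 𝕜) (0, z) = 0)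
    {f : analyticSubring 𝕜 (E × 𝕜)} (hf : f ∉ P) (s : Finset (analyticSubring 𝕜 (E × 𝕜)))
    (hs : ∀ g ∈ s, g ∈ P) :
    ∃ᶠ v in 𝓝 0, (f : E × 𝕜 → 𝕜) v ≠ 0 ∧ ∀ g ∈ s, (g : E × 𝕜 → 𝕜) v = 0 := by
  classical
  obtain ⟨W, hW, hsmall, ⟨q₀, hq₀⟩, hdiv⟩ := exists_monic_weierstrass hg0
  choose q G hG using hdiv
  set ι := analyticSubring.compFst 𝕜 E
  set z := analyticSubring.sndCoord 𝕜 E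
  have hWP : W.eval₂ ι z ∈ P := by
    refine analyticSubring.mem_of_eventually_eq hP (P.mul_mem_left q₀ hg) ?_
    filter_upwards [hq₀] with v hv
    rw [analyticSubring.eval₂_compFst_apply, hv]
    rfl
  have hGP : ∀ h, h - (G h).eval₂ ι z ∈ P := fun h => by
    refine analyticSubring.mem_of_eventually_eq hP (P.mul_mem_left (q h) hWP) ?_
    filter_upwards [hG h] with v hv
    have h1 := analyticSubring.eval₂_compFst_apply W v
    have h2 := analyticSubring.eval₂_compFst_apply (G h) v
    change (h : E × 𝕜 → 𝕜) v - (((G h).eval₂ ι z : analyticSubring 𝕜 (E × 𝕜)) : E × 𝕜 → 𝕜) v =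
      (q h : E × 𝕜 → 𝕜) v * ((W.eval₂ ι z : analyticSubring 𝕜 (E × 𝕜)) : E × 𝕜 → 𝕜) v
    rw [h1, h2, hv, add_sub_cancel_right]
  obtain ⟨c, hc, b, hb⟩ :=
    Ideal.IsPrime.exists_notMem_of_forall_eval₂ ι hW hWP (fun h => ⟨G h, hGP h⟩) hf
  set p := ι c - b * f
  have hs' : ∀ h ∈ insert p s, h ∈ P := fun h hh => by
    rcases Finset.mem_insert.1 hh with rfl | hh
    · exact hb
    · exact hs h hh
  obtain ⟨D, hD, hroot⟩ := hW.exists_eliminant 𝕜 ((Ideal.Quotient.mk P).comp ι)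
    (ζ := Ideal.Quotient.mk P z)
    (by rw [← hom_eval₂]; exact Ideal.Quotient.eq_zero_iff_mem.2 hWP) (insert p s) G
    fun h hh => by
      rw [← hom_eval₂, ← Ideal.Quotient.eq.2 (hGP h)]
      exact Ideal.Quotient.eq_zero_iff_mem.2 (hs' h hh)
  have hfreq := hE (P.comap ι) inferInstance (fun r hr => hP _ (by
    have : Tendsto (Prod.fst : E × 𝕜 → E) (𝓝 0) (𝓝 0) := continuous_fst.tendsto' _ _ rfl
    exact this.eventually hr)) c hc (D.support.image D.coeff) (fun r hr => by
      obtain ⟨i, -, rfl⟩ := Finset.mem_image.1 hr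
      exact Ideal.mem_comap.2 (Ideal.Quotient.eq_zero_iff_mem.1 (hD i)))
  intro hcon
  have hdivs : ∀ᶠ v in 𝓝 (0 : E × 𝕜), ∀ h ∈ insert p s, (h : E × 𝕜 → 𝕜) v =
      (q h : E × 𝕜 → 𝕜) v * W.eval₂ (analyticSubring.eval 𝕜 v.1) v.2 +
        (G h).eval₂ (analyticSubring.eval 𝕜 v.1) v.2 :=
    (Filter.eventually_all_finset _).2 fun h _ => hG h
  obtain ⟨ε, hε, hball⟩ := Metric.eventually_nhds_iff.1 (hcon.and hdivs)
  obtain ⟨x, ⟨hcx, hDx⟩, hαx, hx⟩ :=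
    (hfreq.and_eventually ((hsmall ε hε).and (Metric.ball_mem_nhds (0 : E) hε))).exists
  have hDev : D.map (analyticSubring.eval 𝕜 x) = 0 := by
    ext i
    rw [coeff_map, coeff_zero]
    by_cases hi : i ∈ D.support
    · exact hDx _ (Finset.mem_image_of_mem _ hi)
    · rw [notMem_support_iff.1 hi, map_zero]
  obtain ⟨α, hα, hGα⟩ := hroot _ hDev
  have hdist : dist (x, α) (0 : E × 𝕜) < ε := by
    rw [dist_zero_right, Prod.norm_def]
    exact max_lt (by simpa using hx) (hαx α hα)
  obtain ⟨h1, h2⟩ := hball hdist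
  have hzero : ∀ h ∈ insert p s, (h : E × 𝕜 → 𝕜) (x, α) = 0 := fun h hh => by
    rw [h2 h hh, hα, hGα h hh, mul_zero, add_zero]
  refine h1 ⟨fun hfx => hcx ?_, fun h hh => hzero h (Finset.mem_insert_of_mem hh)⟩
  have hpx : (c : E → 𝕜) x - (b : E × 𝕜 → 𝕜) (x, α) * (f : E × 𝕜 → 𝕜) (x, α) = 0 :=
    hzero p (Finset.mem_insert_self _ _)
  rwa [hfx, mul_zero, sub_zero] at hpx

end PrimeZeros

section Nullstellensatz

universe u

variable {𝕜 : Type*} [NontriviallyNormedField 𝕜]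

/-- A function which is analytic at the origin and not identically zero near it is not identically
zero on some line through the origin. -/
theorem AnalyticAt.exists_line_not_eventually_eq_zero {E : Type*} [NormedAddCommGroup E]
    [NormedSpace 𝕜 E] {g : E → 𝕜} (hg : AnalyticAt 𝕜 g 0) (h : ¬ ∀ᶠ x in 𝓝 0, g x = 0) :
    ∃ x : E, ¬ ∀ᶠ t in 𝓝 (0 : 𝕜), g (t • x) = 0 := by
  obtain ⟨p, r, hp⟩ := hg
  by_contra! hline
  refine h ?_
  filter_upwards [Metric.eball_mem_nhds (0 : E) hp.r_pos] with x hx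
  let L : 𝕜 →L[𝕜] E := ContinuousLinearMap.toSpanSingleton 𝕜 x
  have hL : HasFPowerSeriesAt (g ∘ L) (p.compContinuousLinearMap L) 0 :=
    HasFPowerSeriesAt.compContinuousLinearMap (by rw [map_zero]; exact ⟨r, hp⟩)
  have h0 : HasFPowerSeriesAt (0 : 𝕜 → 𝕜) (p.compContinuousLinearMap L) 0 :=
    hL.congr (by filter_upwards [hline x] with t ht using ht)
  have hn : ∀ n, (p n fun _ => x) = 0 := fun n => by
    have := h0.apply_eq_zero n 1
    rw [FormalMultilinearSeries.compContinuousLinearMap_apply] at this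
    convert this using 2
    ext i
    exact (one_smul 𝕜 x).symm
  have hsum := hp.hasSum hx
  simp only [hn, zero_add] at hsum
  exact hsum.unique hasSum_zero

variable [CompleteSpace 𝕜]

theorem exists_equiv_prod_apply_eq {E : Type*} [NormedAddCommGroup E] [NormedSpace 𝕜 E]
    [FiniteDimensional 𝕜 E] {x : E} (hx : x ≠ 0) :
    ∃ (K : Submodule 𝕜 E) (e : E ≃L[𝕜] K × 𝕜), e x = (0, 1) ∧
      Module.finrank 𝕜 K < Module.finrank 𝕜 E := by
  obtain ⟨l, hl⟩ := (LinearMap.toSpanSingleton 𝕜 E x).exists_leftInverse_of_injective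
    (LinearMap.ker_toSpanSingleton 𝕜 hx)
  have hlx : l x = 1 := by simpa using LinearMap.congr_fun hl 1
  let φ : E →L[𝕜] 𝕜 := LinearMap.toContinuousLinearMap l
  let e₁ := ContinuousLinearEquiv.equivOfRightInverse φ
    (ContinuousLinearMap.toSpanSingleton 𝕜 x) fun t => by simp [φ, hlx]
  let e := e₁.trans (ContinuousLinearEquiv.prodComm 𝕜 𝕜 φ.ker)
  refine ⟨φ.ker, e, ?_, ?_⟩
  · refine Prod.ext (Subtype.ext ?_) hlx
    change x - l x • x = 0
    rw [hlx, one_smul, sub_self]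
  · have := e.toLinearEquiv.finrank_eq
    rw [Module.finrank_prod, Module.finrank_self] at this
    omega

variable [IsAlgClosed 𝕜]

theorem hasPrimeZeros (n : ℕ) : ∀ (E : Type u) [NormedAddCommGroup E] [NormedSpace 𝕜 E]
    [FiniteDimensional 𝕜 E], Module.finrank 𝕜 E = n → HasPrimeZeros 𝕜 E := by
  classical
  induction n using Nat.strong_induction_on with
  | _ n ih =>
    intro E _ _ _ hn P hprime hP f hf s hs
    by_cases hzero : ∀ g ∈ P, ∀ᶠ x in 𝓝 0, (g : E → 𝕜) x = 0
    · exact Filter.Frequently.and_eventually (fun h => hf (hP f (by simpa using h)))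
        ((Filter.eventually_all_finset s).2 fun g hg => hzero g (hs g hg))
    push Not at hzero
    obtain ⟨g, hg, hgne⟩ := hzero
    obtain ⟨x, hx⟩ := g.2.exists_line_not_eventually_eq_zero
      (by simpa [Filter.not_eventually] using hgne)
    have hg0 : (g : E → 𝕜) 0 = 0 := by
      by_contra hne
      refine hprime.ne_top (P.eq_top_iff_one.2 ?_)
      refine analyticSubring.mem_of_eventually_eq hP
        (P.mul_mem_left ⟨fun x => ((g : E → 𝕜) x)⁻¹, g.2.fun_inv hne⟩ hg) ?_
      filter_upwards [g.2.continuousAt.eventually_ne hne] with y hy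
      exact (inv_mul_cancel₀ hy).symm
    have hx0 : x ≠ 0 := fun h => hx (by simp [h, hg0])
    obtain ⟨K, e, hex, hK⟩ := exists_equiv_prod_apply_eq (𝕜 := 𝕜) hx0
    have hKz : HasPrimeZeros 𝕜 K := ih _ (hn ▸ hK) K rfl
    let φ : analyticSubring 𝕜 (K × 𝕜) →+* analyticSubring 𝕜 E :=
      analyticSubring.comp e (e.toContinuousLinearMap.analyticAt 0) (map_zero e)
    let ψ : analyticSubring 𝕜 E →+* analyticSubring 𝕜 (K × 𝕜) :=
      analyticSubring.comp e.symm (e.symm.toContinuousLinearMap.analyticAt 0) (map_zero e.symm)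
    have hφψ : ∀ h, φ (ψ h) = h := fun h => by
      ext y
      exact congr_arg (h : E → 𝕜) (e.symm_apply_apply y)
    have htend : Tendsto e (𝓝 0) (𝓝 0) := e.continuous.tendsto' _ _ (map_zero e)
    have htend' : Tendsto e.symm (𝓝 0) (𝓝 0) :=
      e.symm.continuous.tendsto' _ _ (map_zero e.symm)
    have hmem : ∀ h, ψ h ∈ P.comap φ ↔ h ∈ P := fun h => by rw [Ideal.mem_comap, hφψ]
    have hfreq := hKz.frequently_of_regular (P := P.comap φ)
      (fun h hh => hP _ (htend.eventually hh)) ((hmem g).2 hg) (fun h => hx (by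
        filter_upwards [h] with t ht
        have h1 : e.symm (0, t) = t • x := by
          rw [e.symm_apply_eq, map_smul, hex]; simp
        rw [← h1]
        exact ht))
      (fun h => hf ((hmem f).1 h)) (s.image ψ) (fun h hh => by
        obtain ⟨h', hh', rfl⟩ := Finset.mem_image.1 hh
        exact (hmem h').2 (hs h' hh'))
    refine htend'.frequently (hfreq.mono fun v hv => ⟨hv.1, fun h hh => ?_⟩)
    exact hv.2 (ψ h) (Finset.mem_image_of_mem ψ hh)

/-- **Rückert's Nullstellensatz**, for functions analytic at the origin of a finite-dimensional
space. -/
theorem exists_pow_eventually_eq_sum {E : Type*} [NormedAddCommGroup E] [NormedSpace 𝕜 E]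
    [FiniteDimensional 𝕜 E] {ι : Type*} [Fintype ι] {f : E → 𝕜} {g : ι → E → 𝕜}
    (hf : AnalyticAt 𝕜 f 0) (hg : ∀ j, AnalyticAt 𝕜 (g j) 0)
    (H : ∀ᶠ x in 𝓝 0, (∀ j, g j x = 0) → f x = 0) :
    ∃ (h : ι → E → 𝕜) (k : ℕ), 1 ≤ k ∧ (∀ j, AnalyticAt 𝕜 (h j) 0) ∧
      ∀ᶠ x in 𝓝 0, f x ^ k = ∑ j, g j x * h j x := by
  classical
  let f₁ : analyticSubring 𝕜 E := ⟨f, hf⟩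
  let g₁ : ι → analyticSubring 𝕜 E := fun j => ⟨g j, hg j⟩
  let N : Ideal (analyticSubring 𝕜 E) :=
    { carrier := {f | ∀ᶠ x in 𝓝 0, (f : E → 𝕜) x = 0}
      add_mem' := fun {a b} ha hb => by
        filter_upwards [ha, hb] with x hx hy
        change (a : E → 𝕜) x + (b : E → 𝕜) x = 0
        rw [hx, hy, add_zero]
      zero_mem' := .of_forall fun _ => rfl
      smul_mem' := fun c a ha => by
        filter_upwards [ha] with x hx
        change (c : E → 𝕜) x * (a : E → 𝕜) x = 0
        rw [hx, mul_zero] }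
  have hrad : f₁ ∈ (Ideal.span (Set.range g₁) ⊔ N).radical := by
    rw [Ideal.radical_eq_sInf, Ideal.mem_sInf]
    rintro P ⟨hle, hprime⟩
    by_contra hfP
    have hfreq := hasPrimeZeros _ E rfl P hprime
      (fun r hr => hle (Ideal.mem_sup_right (show r ∈ N from hr))) f₁ hfP (Finset.univ.image g₁)
      (fun r hr => by
        obtain ⟨j, -, rfl⟩ := Finset.mem_image.1 hr
        exact hle (Ideal.mem_sup_left (Ideal.subset_span ⟨j, rfl⟩)))
    obtain ⟨x, ⟨hfx, hgx⟩, hx⟩ := (hfreq.and_eventually H).exists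
    exact hfx (hx fun j => hgx (g₁ j) (Finset.mem_image_of_mem g₁ (Finset.mem_univ j)))
  obtain ⟨k, hk⟩ := hrad
  obtain ⟨y, hy, r, hr, hyr⟩ := Submodule.mem_sup.1
    ((Ideal.span (Set.range g₁) ⊔ N).mul_mem_left f₁ hk)
  obtain ⟨c, hc⟩ := (Submodule.mem_span_range_iff_exists_fun _).1 hy
  refine ⟨fun j => c j, k + 1, Nat.succ_pos k, fun j => (c j).2, ?_⟩
  filter_upwards [show ∀ᶠ x in 𝓝 0, (r : E → 𝕜) x = 0 from hr] with x hx
  have h1 := congr_arg (analyticSubring.eval 𝕜 x) hyr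
  rw [← hc, map_add, map_sum, map_mul, map_pow, analyticSubring.eval_apply x r, hx,
    add_zero] at h1
  rw [pow_succ']
  refine h1.symm.trans (Finset.sum_congr rfl fun j _ => ?_)
  rw [smul_eq_mul, map_mul, mul_comm]
  rfl

end Nullstellensatz

/-- **Rückert's Nullstellensatz for germs of analytic functions.**
Let `𝕜` be a complete nontrivially normed field which is algebraically closed, `U` an open
neighborhood of `0` in `𝕜^m`, and `f, g₁, …, gₙ : U → 𝕜` analytic functions such that for all
`a ∈ U`, `g₁(a) = ⋯ = gₙ(a) = 0` implies `f(a) = 0`. Then there are an open neighborhood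
`V ⊆ U` of `0`, analytic functions `h₁, …, hₙ : V → 𝕜`, and `k ≥ 1` with
`f^k = g₁h₁ + ⋯ + gₙhₙ` on `V`. -/
theorem stmt_7 {𝕜 : Type*} [NontriviallyNormedField 𝕜] [CompleteSpace 𝕜] [IsAlgClosed 𝕜]
    {m n : ℕ} {U : Set (Fin m → 𝕜)} (hU : IsOpen U) (hU0 : (0 : Fin m → 𝕜) ∈ U)
    (f : (Fin m → 𝕜) → 𝕜) (g : Fin n → (Fin m → 𝕜) → 𝕜)
    (hf : ∀ x ∈ U, AnalyticAt 𝕜 f x) (hg : ∀ j, ∀ x ∈ U, AnalyticAt 𝕜 (g j) x)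
    (H : ∀ a ∈ U, (∀ j, g j a = 0) → f a = 0) :
    ∃ V : Set (Fin m → 𝕜), IsOpen V ∧ (0 : Fin m → 𝕜) ∈ V ∧ V ⊆ U ∧
      ∃ (h : Fin n → (Fin m → 𝕜) → 𝕜) (k : ℕ), 1 ≤ k ∧
        (∀ j, ∀ x ∈ V, AnalyticAt 𝕜 (h j) x) ∧
        ∀ a ∈ V, f a ^ k = ∑ j, g j a * h j a := by
  obtain ⟨h, k, hk, hh, heq⟩ := exists_pow_eventually_eq_sum (hf 0 hU0) (fun j => hg j 0 hU0)
    (Filter.mem_of_superset (hU.mem_nhds hU0) H)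
  obtain ⟨V, hV, hVo, hV0⟩ := eventually_nhds_iff.1 ((hU.eventually_mem hU0).and
    ((Filter.eventually_all.2 fun j => (hh j).eventually_analyticAt).and heq))
  exact ⟨V, hVo, hV0, fun x hx => (hV x hx).1, h, k, hk, fun j x hx => (hV x hx).2.1 j,
    fun x hx => (hV x hx).2.2⟩
end

section
/- Let U be an open neighborhood of 0 in ℝ^m and let f, g_1, …, g_n : U → ℝ be real analytic functions such that for all a ∈ U, g_1(a) = ⋯ = g_n(a) = 0 implies f(a) = 0. Then there exist an open neighborhood V ⊆ U of 0, real analytic functions b_1,…,b_l, h_1,…,h_n : V → ℝ, and an integer k ≥ 1 such that f^{2k} + b_1² + ⋯ + b_l² = g_1 h_1 + ⋯ + g_n h_n on V. -/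
namespace Risler

open Polynomial Filter Topology
open scoped BoundedContinuousFunction

/-- Polynomials that change sign have a root in between. -/
def PolynomialIVT (R : Type*) [Field R] [LinearOrder R] : Prop :=
  ∀ (p : R[X]) (a b : R), a < b → p.eval a * p.eval b < 0 → ∃ c, a < c ∧ c < b ∧ p.eval c = 0

section SumSq

lemma isSumSq_map {A B : Type*} [Semiring A] [Semiring B] (f : A →+* B) {s : A}
    (hs : IsSumSq s) : IsSumSq (f s) := by
  induction hs with
  | zero => simp
  | sq_add a hs ih => simpa using IsSumSq.sq_add (f a) ih

variable {L : Type*} [Field L]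

lemma exists_isSumSq_natDegree_le {q : L[X]} (hq : q.natDegree ≠ 0) {s : L[X]} (hs : IsSumSq s) :
    ∃ t, IsSumSq t ∧ q ∣ s - t ∧ t.natDegree ≤ 2 * (q.natDegree - 1) := by
  induction hs with
  | zero => exact ⟨0, .zero, by simp, by simp⟩
  | @sq_add a s hs ih =>
    obtain ⟨t, ht, hd, hn⟩ := ih
    refine ⟨a % q * (a % q) + t, .sq_add _ ht, ?_, ?_⟩
    · have h1 : q ∣ a - a % q := ⟨a / q, by
        have := EuclideanDomain.div_add_mod a q
        linear_combination -this⟩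
      have : a * a + s - (a % q * (a % q) + t) = (a - a % q) * (a + a % q) + (s - t) := by ring
      rw [this]
      exact dvd_add (h1.mul_right _) hd
    · refine (natDegree_add_le _ _).trans (max_le ?_ hn)
      have h2 : (a % q).natDegree < q.natDegree := natDegree_mod_lt a hq
      refine natDegree_mul_le.trans ?_
      omega

lemma not_sign_change_of_dvd_one_add [LinearOrder L] [IsStrictOrderedRing L] (q : L[X]) {s : L[X]}
    (hs : IsSumSq s) (hq : q ∣ 1 + s) (a b : L) : ¬ q.eval a * q.eval b < 0 := by
  induction hn : q.natDegree using Nat.strong_induction_on generalizing q s with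
  | _ n ih =>
  intro hlt
  have hq0 : q.natDegree ≠ 0 := by
    intro h0
    rw [natDegree_eq_zero] at h0
    obtain ⟨c, rfl⟩ := h0
    simp only [eval_C] at hlt
    exact absurd hlt (not_lt.2 (mul_self_nonneg c))
  obtain ⟨t, ht, hd, hdeg⟩ := exists_isSumSq_natDegree_le hq0 hs
  obtain ⟨r, hr⟩ : q ∣ 1 + t := by
    have : 1 + t = (1 + s) - (s - t) := by ring
    rw [this]; exact dvd_sub hq hd
  have hpos : ∀ x, 0 < q.eval x * r.eval x := by
    intro x
    rw [← eval_mul, ← hr, eval_add, eval_one]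
    have : 0 ≤ t.eval x := (isSumSq_map (evalRingHom x) ht).nonneg
    linarith
  have hne : q * r ≠ 0 := by
    intro h
    have := hpos a
    rw [← eval_mul, h] at this
    simp at this
  have hrn : r.natDegree < n := by
    have h1 := natDegree_mul (left_ne_zero_of_mul hne) (right_ne_zero_of_mul hne)
    have h2 : (q * r).natDegree ≤ 2 * (q.natDegree - 1) := by
      rw [← hr]
      exact (natDegree_add_le _ _).trans (by simpa using hdeg)
    omega
  refine ih _ hrn r ht ⟨q, by rw [hr, mul_comm]⟩ rfl ?_
  have h3 := mul_pos (hpos a) (hpos b)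
  by_contra h4
  have := mul_nonneg_of_nonpos_of_nonpos hlt.le (neg_nonpos.2 (not_lt.1 h4))
  have h5 : (eval a q * eval b q) * (eval a r * eval b r) > 0 := by
    calc _ = _ := by ring
      _ > 0 := h3
  nlinarith

lemma exists_neg_isSumSq_of_not_isSquare
    (hmax : ∀ q : L[X], Irreducible q → q.natDegree ≠ 1 → ∃ s, IsSumSq s ∧ q ∣ 1 + s)
    {a : L} (ha : ¬ IsSquare a) : ∃ x y, IsSumSq x ∧ IsSumSq y ∧ 1 + x + a * y = 0 := by
  have hdeg : (X ^ 2 - C a : L[X]).natDegree = 2 := natDegree_X_pow_sub_C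
  have hirr : Irreducible (X ^ 2 - C a : L[X]) := by
    rw [irreducible_iff_roots_eq_zero_of_degree_le_three (by omega) (by omega)]
    rw [Multiset.eq_zero_iff_forall_notMem]
    intro x hx
    have := (mem_roots'.1 hx).2
    simp only [IsRoot, eval_sub, eval_pow, eval_X, eval_C] at this
    exact ha ⟨x, by linear_combination -this⟩
  obtain ⟨s, hs, hd⟩ := hmax _ hirr (by omega)
  have key : ∀ s : L[X], IsSumSq s → ∃ x y c, IsSumSq x ∧ IsSumSq y ∧
      X ^ 2 - C a ∣ s - (C x + C a * C y + C c * X) := by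
    intro s hs
    induction hs with
    | zero => exact ⟨0, 0, 0, .zero, .zero, by simp⟩
    | sq_add h hs ih =>
      obtain ⟨x, y, c, hx, hy, e, he⟩ := ih
      have hm : (h % (X ^ 2 - C a)).natDegree ≤ 1 := by
        have := natDegree_mod_lt h (q := X ^ 2 - C a) (by omega)
        omega
      obtain ⟨v, u, huv⟩ := exists_eq_X_add_C_of_natDegree_le_one hm
      refine ⟨u * u + x, v * v + y, 2 * u * v + c, .sq_add _ hx, .sq_add _ hy, ?_⟩
      have h1 := EuclideanDomain.div_add_mod h (X ^ 2 - C a)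
      rw [huv] at h1
      set d := h / (X ^ 2 - C a)
      refine ⟨d * (h + C v * X + C u) + C v * C v + e, ?_⟩
      simp only [C_add, C_mul, C_ofNat]
      linear_combination he - (h + C v * X + C u) * h1
  obtain ⟨x, y, c, hx, hy, hd'⟩ := key s hs
  refine ⟨x, y, hx, hy, ?_⟩
  have h3 : X ^ 2 - C a ∣ C c * X + C (1 + x + a * y) := by
    have := dvd_sub hd hd'
    convert this using 1
    simp only [C_add, C_mul, C_1]; ring
  have h4 := eq_zero_of_dvd_of_natDegree_lt h3 (by
    rw [hdeg]; exact lt_of_le_of_lt natDegree_linear_le one_lt_two)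
  simpa using congrArg (coeff · 0) h4

lemma exists_order_of_maximal (hL : ¬ IsSumSq (-1 : L))
    (hmax : ∀ q : L[X], Irreducible q → q.natDegree ≠ 1 → ∃ s, IsSumSq s ∧ q ∣ 1 + s) :
    ∃ (_ : LinearOrder L) (_ : IsStrictOrderedRing L), PolynomialIVT L := by
  classical
  have inv_sq : ∀ y : L, IsSumSq y → IsSumSq y⁻¹ := by
    intro y hy
    have : y⁻¹ = y * (y⁻¹ * y⁻¹) := by
      rcases eq_or_ne y 0 with rfl | h
      · simp
      · field_simp
    rw [this]; exact hy.mul (.mul_self _)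
  have anti : ∀ x : L, IsSumSq x → IsSumSq (-x) → x = 0 := by
    intro x h1 h2
    by_contra h
    refine hL ?_
    have : (-1 : L) = -x * x⁻¹ := by field_simp
    rw [this]; exact h2.mul (inv_sq _ h1)
  have total : ∀ x : L, IsSumSq x ∨ IsSumSq (-x) := by
    intro a
    by_cases ha : IsSquare a
    · exact .inl ha.isSumSq
    · right
      obtain ⟨x, y, hx, hy, h⟩ := exists_neg_isSumSq_of_not_isSquare hmax ha
      have hy0 : y ≠ 0 := by
        rintro rfl
        refine hL ?_
        have : -1 = x := by linear_combination -h
        rwa [this]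
      have : -a = (1 + x) * y⁻¹ := by field_simp; linear_combination -h
      rw [this]; exact (IsSumSq.one.add hx).mul (inv_sq _ hy)
  let C : RingCone L :=
    { Subsemiring.sumSq L with
      eq_zero_of_mem_of_neg_mem' := fun {x} h1 h2 =>
        anti x (by simpa using h1) (by simpa using h2) }
  have hC : ∀ x, x ∈ C ↔ IsSumSq x := fun x => Subsemiring.mem_sumSq
  have : HasMemOrNegMem C := ⟨fun x => by simpa only [hC] using total x⟩
  let _ : LinearOrder L := LinearOrder.mkOfAddGroupCone C
  have : IsOrderedRing L := IsOrderedRing.mkOfCone C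
  have : IsStrictOrderedRing L := IsOrderedRing.toIsStrictOrderedRing L
  refine ⟨inferInstance, inferInstance, fun p a b hab hp => ?_⟩
  have hp0 : p ≠ 0 := by rintro rfl; simp at hp
  induction p using UniqueFactorizationMonoid.induction_on_prime with
  | h₁ => exact absurd rfl hp0
  | h₂ x hx =>
    obtain ⟨c, hc, rfl⟩ := Polynomial.isUnit_iff.1 hx
    simp only [eval_C] at hp
    exact absurd hp (not_lt.2 (mul_self_nonneg c))
  | h₃ r q hr hq ih =>
    have hq1 : q.eval a * q.eval b < 0 → ∃ c, a < c ∧ c < b ∧ (q * r).eval c = 0 := by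
      intro h
      by_cases h1 : q.natDegree = 1
      · obtain ⟨v, u, huv⟩ := exists_eq_X_add_C_of_natDegree_le_one h1.le
        have hv : v ≠ 0 := by
          rintro rfl
          rw [huv] at h1; simp at h1
        rw [huv] at h ⊢
        simp only [eval_add, eval_mul, eval_C, eval_X] at h ⊢
        obtain ⟨c, rfl⟩ : ∃ c, u = -(v * c) := ⟨-u / v, by field_simp⟩
        have h2 : v ^ 2 * ((a - c) * (b - c)) < 0 := by
          convert h using 1; ring
        have h3 : (a - c) * (b - c) < 0 := by
          by_contra h4
          exact absurd h2 (not_lt.2 (mul_nonneg (sq_nonneg v) (not_lt.1 h4)))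
        rcases mul_neg_iff.1 h3 with h4 | h4
        · exact absurd hab (not_lt.2 (by linarith))
        · exact ⟨c, by linarith, by linarith, by simp⟩
      · obtain ⟨s, hs, hd⟩ := hmax q hq.irreducible h1
        exact absurd h (not_sign_change_of_dvd_one_add q hs hd a b)
    by_cases h : q.eval a * q.eval b < 0
    · exact hq1 h
    · have : r.eval a * r.eval b < 0 := by
        by_contra h'
        have := mul_nonneg (not_lt.1 h) (not_lt.1 h')
        simp only [eval_mul] at hp
        have h6 : eval a q * eval a r * (eval b q * eval b r)
          = eval a q * eval b q * (eval a r * eval b r) := by ring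
        linarith
      obtain ⟨c, h1, h2, h3⟩ := ih this (right_ne_zero_of_mul hp0)
      exact ⟨c, h1, h2, by simp [h3]⟩

end SumSq

lemma exists_isSumSq_map_eq {A B : Type*} [CommRing A] [CommRing B] (f : A →+* B)
    (hf : Function.Surjective f) {s : B} (hs : IsSumSq s) : ∃ t, IsSumSq t ∧ f t = s := by
  induction hs with
  | zero => exact ⟨0, .zero, map_zero f⟩
  | sq_add a hs ih =>
    obtain ⟨t, ht, rfl⟩ := ih
    obtain ⟨c, rfl⟩ := hf a
    exact ⟨c * c + t, .sq_add _ ht, by simp⟩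

theorem exists_real_closure (K : Type) [Field K] (hK : ¬ IsSumSq (-1 : K)) :
    ∃ (R : Type) (_ : Field R) (_ : LinearOrder R) (_ : IsStrictOrderedRing R) (_ : K →+* R),
      PolynomialIVT R := by
  let Ω := AlgebraicClosure K
  let P : Set (Subfield Ω) := {S | ¬ IsSumSq (-1 : S)}
  have h0 : (algebraMap K Ω).fieldRange ∈ P := by
    intro h
    obtain ⟨t, ht, h1⟩ := exists_isSumSq_map_eq (algebraMap K Ω).rangeRestrictField
      (RingHom.rangeRestrictField_bijective _).2 h
    have : t = -1 := (RingHom.rangeRestrictField_bijective (algebraMap K Ω)).1 (by simpa using h1)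
    exact hK (this ▸ ht)
  obtain ⟨L, hKL, hmaxL⟩ := zorn_le_nonempty₀ P (fun c hcP hc S hS => by
    have hne : c.Nonempty := ⟨S, hS⟩
    have hdir : DirectedOn (· ≤ ·) c := hc.directedOn
    refine ⟨sSup c, ?_, fun z hz => le_sSup hz⟩
    have key : ∀ x : (sSup c : Subfield Ω), IsSumSq x →
        ∃ S ∈ c, ∃ y : S, IsSumSq y ∧ (y : Ω) = x := by
      intro x hx
      induction hx with
      | zero => exact ⟨S, hS, 0, .zero, rfl⟩
      | sq_add a hs ih =>
        obtain ⟨S₁, hS₁, y, hy, h1⟩ := ih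
        obtain ⟨S₂, hS₂, h2⟩ := (Subfield.mem_sSup_of_directedOn hne hdir).1 a.2
        obtain ⟨T, hT, h3, h4⟩ := hdir S₁ hS₁ S₂ hS₂
        refine ⟨T, hT, ⟨a, h4 h2⟩ * ⟨a, h4 h2⟩ + Subfield.inclusion h3 y,
          .sq_add _ (isSumSq_map (Subfield.inclusion h3) hy), ?_⟩
        rw [Subfield.coe_add, Subfield.coe_mul, Subfield.coe_add, Subfield.coe_mul, ← h1]
        rfl
    intro h
    obtain ⟨T, hT, y, hy, h1⟩ := key _ h
    refine hcP hT ?_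
    have : y = -1 := Subtype.ext (by simpa using h1)
    exact this ▸ hy) _ h0
  have hL : ¬ IsSumSq (-1 : L) := hmaxL.1
  have hmax : ∀ q : L[X], Irreducible q → q.natDegree ≠ 1 → ∃ s, IsSumSq s ∧ q ∣ 1 + s := by
    intro q hq hq1
    have hqd : (q.map (algebraMap L Ω)).degree ≠ 0 := by
      rw [degree_map]; exact (degree_pos_of_irreducible hq).ne'
    obtain ⟨θ, hθ⟩ := IsAlgClosed.exists_root _ hqd
    have hθ' : aeval θ q = 0 := by simpa [IsRoot, eval_map_algebraMap] using hθ
    have hθi : IsIntegral L θ := IsAlgebraic.isIntegral ⟨q, hq.ne_zero, hθ'⟩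
    let M := IntermediateField.adjoin L {θ}
    have hLM : L ≤ M.toSubfield := fun x hx => M.algebraMap_mem ⟨x, hx⟩
    have hM : IsSumSq (-1 : M.toSubfield) := by
      by_contra hcon
      have hle : M.toSubfield ≤ L := hmaxL.2 hcon hLM
      have hθL : θ ∈ L := hle (IntermediateField.mem_adjoin_simple_self L θ)
      have hdvd : X - C (⟨θ, hθL⟩ : L) ∣ q := by
        rw [dvd_iff_isRoot]
        refine (algebraMap L Ω).injective ?_
        rw [map_zero, ← hθ', ← aeval_algebraMap_apply_eq_algebraMap_eval]
        rfl
      have hass := (irreducible_X_sub_C (⟨θ, hθL⟩ : L)).associated_of_dvd hq hdvd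
      have := natDegree_eq_of_degree_eq (degree_eq_degree_of_associated hass)
      rw [natDegree_X_sub_C] at this
      exact hq1 this.symm
    have hM' : ∃ s : L[X], IsSumSq s ∧ aeval θ s = -1 := by
      have key : ∀ x : M.toSubfield, IsSumSq x → ∃ s : L[X], IsSumSq s ∧ aeval θ s = (x : Ω) := by
        intro x hx
        induction hx with
        | zero => exact ⟨0, .zero, by simp⟩
        | sq_add a hs ih =>
          obtain ⟨s, hs, h1⟩ := ih
          have ha : (a : Ω) ∈ M.toSubalgebra := a.2
          rw [IntermediateField.adjoin_simple_toSubalgebra_of_isAlgebraic hθi.isAlgebraic,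
            Algebra.adjoin_singleton_eq_range_aeval] at ha
          obtain ⟨h, hh⟩ := ha
          have hh' : aeval θ h = (a : Ω) := hh
          exact ⟨h * h + s, .sq_add _ hs, by simp [h1, hh']⟩
      simpa using key _ hM
    obtain ⟨s, hs, h1⟩ := hM'
    refine ⟨s, hs, ?_⟩
    have h2 : minpoly L θ ∣ 1 + s := minpoly.dvd L θ (by simp [h1])
    have h3 : minpoly L θ ∣ q := minpoly.dvd L θ hθ'
    exact (((minpoly.irreducible hθi).associated_of_dvd hq h3).symm.dvd).trans h2
  obtain ⟨i1, i2, h⟩ := exists_order_of_maximal hL hmax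
  have hmem : ∀ x, algebraMap K Ω x ∈ L := fun x => hKL ⟨x, rfl⟩
  exact ⟨L, inferInstance, i1, i2, (algebraMap K Ω).codRestrict L hmem, h⟩

section Signs

variable {R : Type*} [Field R] [LinearOrder R] [IsStrictOrderedRing R]

lemma sign_eval_eq_of_no_root (hR : PolynomialIVT R) {p : R[X]} {a b : R} (hab : a ≤ b)
    (h : ∀ c, a < c → c < b → p.eval c ≠ 0) (ha : p.eval a ≠ 0) (hb : p.eval b ≠ 0) :
    SignType.sign (p.eval a) = SignType.sign (p.eval b) := by
  rcases hab.eq_or_lt with rfl | hab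
  · rfl
  have h1 : ¬ p.eval a * p.eval b < 0 := fun hlt => by
    obtain ⟨c, h1, h2, h3⟩ := hR p a b hab hlt
    exact h c h1 h2 h3
  rcases lt_or_gt_of_ne ha with h2 | h2 <;> rcases lt_or_gt_of_ne hb with h3 | h3
  · rw [sign_neg h2, sign_neg h3]
  · exact absurd (mul_neg_of_neg_of_pos h2 h3) h1
  · exact absurd (mul_neg_of_pos_of_neg h2 h3) h1
  · rw [sign_pos h2, sign_pos h3]

lemma rolle_of_no_root (hR : PolynomialIVT R) {p : R[X]} {a b : R} (hp : p ≠ 0) (hab : a < b)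
    (ha : p.eval a = 0) (hb : p.eval b = 0) (h : ∀ c, a < c → c < b → p.eval c ≠ 0) :
    ∃ c, a < c ∧ c < b ∧ (derivative p).eval c = 0 := by
  obtain ⟨g, hg, hga⟩ := exists_eq_pow_rootMultiplicity_mul_and_not_dvd p hp a
  have hm := (rootMultiplicity_pos hp).2 ha
  have hg0 : g ≠ 0 := by rintro rfl; simp at hga
  rw [dvd_iff_isRoot] at hga
  have hgb : g.eval b = 0 := by
    rw [hg, eval_mul] at hb
    refine (mul_eq_zero.1 hb).resolve_left ?_
    simp [sub_eq_zero, hab.ne']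
  obtain ⟨e, he, heb⟩ := exists_eq_pow_rootMultiplicity_mul_and_not_dvd g hg0 b
  have hn := (rootMultiplicity_pos hg0).2 hgb
  rw [dvd_iff_isRoot] at heb
  have hea : e.eval a ≠ 0 := by
    intro h0
    apply hga
    rw [IsRoot, he, eval_mul, h0, mul_zero]
  obtain ⟨m, hm'⟩ : ∃ m, p.rootMultiplicity a = m + 1 := ⟨_, (Nat.succ_pred_eq_of_pos hm).symm⟩
  obtain ⟨n, hn'⟩ : ∃ n, g.rootMultiplicity b = n + 1 := ⟨_, (Nat.succ_pred_eq_of_pos hn).symm⟩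
  rw [hm'] at hg
  rw [hn'] at he
  have hpe : p = (X - C a) ^ (m + 1) * ((X - C b) ^ (n + 1) * e) := by rw [← he, ← hg]
  have hsign : 0 < e.eval a * e.eval b := by
    by_contra hcon
    obtain ⟨c, h1, h2, h3⟩ := hR e a b hab
      (lt_of_le_of_ne (not_lt.1 hcon) (mul_ne_zero hea heb))
    apply h c h1 h2
    rw [hpe, eval_mul, eval_mul, h3]; ring
  let f : R[X] := (m + 1 : R[X]) * (X - C b) * e + (n + 1 : R[X]) * (X - C a) * e
    + (X - C a) * (X - C b) * derivative e
  have hf : derivative p = (X - C a) ^ m * (X - C b) ^ n * f := by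
    rw [hpe]
    simp only [derivative_mul, derivative_pow, derivative_X_sub_C, f]
    simp only [Nat.cast_add, Nat.cast_one, Nat.add_sub_cancel, C_add, C_1, map_natCast]
    ring
  have hfa : f.eval a = (m + 1) * (a - b) * e.eval a := by simp [f]
  have hfb : f.eval b = (n + 1) * (b - a) * e.eval b := by simp [f]
  obtain ⟨c, h1, h2, h3⟩ := hR f a b hab (by
    rw [hfa, hfb]
    have h4 : (0 : R) < (m + 1) * (n + 1) * (b - a) ^ 2 * (e.eval a * e.eval b) := by
      have : 0 < b - a := sub_pos.2 hab
      positivity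
    nlinarith)
  exact ⟨c, h1, h2, by rw [hf, eval_mul, h3, mul_zero]⟩

lemma rolle (hR : PolynomialIVT R) {p : R[X]} {a b : R} (hab : a < b)
    (ha : p.eval a = 0) (hb : p.eval b = 0) :
    ∃ c, a < c ∧ c < b ∧ (derivative p).eval c = 0 := by
  rcases eq_or_ne p 0 with rfl | hp
  · exact ⟨(a + b) / 2, by linarith, by linarith, by simp⟩
  let s := p.roots.toFinset.filter (fun x => a < x)
  have hs : ∀ x, x ∈ s ↔ p.eval x = 0 ∧ a < x := by simp [s, hp]
  have hne : s.Nonempty := ⟨b, by simp [hs, hb, hab]⟩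
  have hmin := (hs _).1 (s.min'_mem hne)
  obtain ⟨c, h1, h2, h3⟩ := rolle_of_no_root hR hp hmin.2 ha hmin.1 (fun c h1 h2 h3 =>
    absurd h2 (not_lt.2 (s.min'_le c ((hs c).2 ⟨h3, h1⟩))))
  exact ⟨c, h1, h2.trans_le (s.min'_le b ((hs b).2 ⟨hb, hab⟩)), h3⟩

lemma exists_eval_sub_eq (hR : PolynomialIVT R) (p : R[X]) {a b : R} (hab : a < b) :
    ∃ c, a < c ∧ c < b ∧ p.eval b - p.eval a = (derivative p).eval c * (b - a) := by
  have hne : b - a ≠ 0 := (sub_pos.2 hab).ne'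
  obtain ⟨c, h1, h2, h3⟩ := rolle hR (p := p - C (p.eval a)
    - C ((p.eval b - p.eval a) / (b - a)) * (X - C a)) hab (by simp) (by
      simp only [eval_sub, eval_mul, eval_C, eval_X]; field_simp; ring)
  refine ⟨c, h1, h2, ?_⟩
  simp only [derivative_sub, derivative_mul, derivative_C, derivative_X, eval_sub, eval_mul,
    eval_C, eval_zero, eval_add, eval_one] at h3
  field_simp at h3
  linear_combination -h3

lemma eval_le_or_ge (hR : PolynomialIVT R) {p : R[X]} {z w : R} (s : SignType)
    (h : ∀ x, z ≤ x → x ≤ w → SignType.sign ((derivative p).eval x) = s) :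
    (0 ≤ s → ∀ x y, z ≤ x → x ≤ y → y ≤ w → p.eval x ≤ p.eval y) ∧
    (s ≤ 0 → ∀ x y, z ≤ x → x ≤ y → y ≤ w → p.eval y ≤ p.eval x) := by
  constructor <;> intro hs x y h1 h2 h3 <;> rcases h2.eq_or_lt with rfl | h2
  · exact le_rfl
  · obtain ⟨c, h4, h5, h6⟩ := exists_eval_sub_eq hR p h2
    have h7 := h c (h1.trans h4.le) (h5.le.trans h3)
    rw [← h7, sign_nonneg_iff] at hs
    have := mul_nonneg hs (sub_pos.2 h2).le
    linarith
  · exact le_rfl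
  · obtain ⟨c, h4, h5, h6⟩ := exists_eval_sub_eq hR p h2
    have h7 := h c (h1.trans h4.le) (h5.le.trans h3)
    rw [← h7, sign_nonpos_iff] at hs
    have := mul_nonneg (neg_nonneg.2 hs) (sub_pos.2 h2).le
    linarith

/-- If all derivatives of `p` have the same sign at `z ≤ w`, the sign of `p` is constant on the
interval between them. -/
lemma sign_eval_eq_of_derivatives (hR : PolynomialIVT R) (p : R[X]) {z w : R}
    (h : ∀ k, SignType.sign ((derivative^[k] p).eval z) = SignType.sign ((derivative^[k] p).eval w))
    {x : R} (hx : z ≤ x) (hx' : x ≤ w) :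
    SignType.sign (p.eval x) = SignType.sign (p.eval z) := by
  induction hn : p.natDegree using Nat.strong_induction_on generalizing p x with
  | _ n ih =>
  by_cases h0 : p.natDegree = 0
  · obtain ⟨c, rfl⟩ := natDegree_eq_zero.1 h0
    simp
  have h1 : ∀ x, z ≤ x → x ≤ w → SignType.sign ((derivative p).eval x)
      = SignType.sign ((derivative p).eval z) := fun x h1 h2 =>
    ih _ (hn ▸ natDegree_derivative_lt h0) (derivative p) (fun k => h (k + 1)) h1 h2 rfl
  have h2 := eval_le_or_ge hR _ h1
  have h3 := h 0
  simp only [Function.iterate_zero, id] at h3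
  rcases le_total 0 (SignType.sign ((derivative p).eval z)) with h4 | h4
  · have h5 := SignType.sign.monotone (h2.1 h4 z x le_rfl hx hx')
    have h6 := SignType.sign.monotone (h2.1 h4 x w hx hx' le_rfl)
    exact le_antisymm (h3 ▸ h6) h5
  · have h5 := SignType.sign.monotone (h2.2 h4 z x le_rfl hx hx')
    have h6 := SignType.sign.monotone (h2.2 h4 x w hx hx' le_rfl)
    exact le_antisymm h5 (h3 ▸ h6)

/-- **Thom's lemma**: a root of `p` is determined by the signs of the derivatives of `p`. -/
lemma eq_of_sign_derivatives_eq (hR : PolynomialIVT R) {p : R[X]} (hp : p ≠ 0) {z w : R}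
    (h : ∀ k, SignType.sign ((derivative^[k] p).eval z) = SignType.sign ((derivative^[k] p).eval w))
    (hz : p.eval z = 0) (hzw : z ≤ w) : z = w := by
  by_contra hne
  refine hp (eq_zero_of_infinite_isRoot p ((Set.Icc_infinite (lt_of_le_of_ne hzw hne)).mono ?_))
  intro x hx
  have := sign_eval_eq_of_derivatives hR p h hx.1 hx.2
  rw [hz, sign_zero, sign_eq_zero_iff] at this
  exact this

lemma sign_eval_eq_ite (hR : PolynomialIVT R) {p : R[X]} {a b r : R} (har : a < r) (hrb : r < b)
    (h0 : ∀ x, a < x → x < b → p.eval x ≠ 0)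
    (h1 : ∀ x, a < x → x < b → (derivative p).eval x ≠ 0) :
    SignType.sign (p.eval r) = if p.eval a = 0 then SignType.sign ((derivative p).eval r)
      else SignType.sign (p.eval a) := by
  split_ifs with ha
  · obtain ⟨c, h2, h3, h4⟩ := exists_eval_sub_eq hR p har
    have h5 : SignType.sign ((derivative p).eval c) = SignType.sign ((derivative p).eval r) :=
      sign_eval_eq_of_no_root hR h3.le (fun x h5 h6 => h1 x (h2.trans h5) (h6.trans hrb))
        (h1 c h2 (h3.trans hrb)) (h1 r har hrb)
    rw [ha, sub_zero] at h4
    rw [h4, sign_mul, sign_pos (sub_pos.2 har), mul_one, h5]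
  · exact (sign_eval_eq_of_no_root hR har.le (fun x h5 h6 => h0 x h5 (h6.trans hrb)) ha
      (h0 r har hrb)).symm

end Signs

section Transfer

variable {K : Type*} [Field K]
variable {R : Type*} [Field R] [LinearOrder R] {R' : Type*} [Field R'] [LinearOrder R']

/-- The points `r` and `r'` satisfy the same polynomial sign conditions over `K`. -/
def SameSigns (i : K →+* R) (j : K →+* R') (r : R) (r' : R') : Prop :=
  ∀ q : K[X], SignType.sign ((q.map i).eval r) = SignType.sign ((q.map j).eval r')

lemma SameSigns.symm {i : K →+* R} {j : K →+* R'} {r : R} {r' : R'} (h : SameSigns i j r r') :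
    SameSigns j i r' r := fun q => (h q).symm

lemma SameSigns.eval_eq_zero_iff {i : K →+* R} {j : K →+* R'} {r : R} {r' : R'}
    (h : SameSigns i j r r') (q : K[X]) : (q.map i).eval r = 0 ↔ (q.map j).eval r' = 0 := by
  rw [← sign_eq_zero_iff, h q, sign_eq_zero_iff]

/-- Every point of `R` that is algebraic of degree at most `d` over `K` has a counterpart in `R'`
satisfying the same sign conditions. -/
def Transfer (i : K →+* R) (j : K →+* R') (d : ℕ) : Prop :=
  ∀ p : K[X], p ≠ 0 → p.natDegree ≤ d → ∀ r, (p.map i).eval r = 0 → ∃ r', SameSigns i j r r'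

variable [IsStrictOrderedRing R]

lemma transfer_one {i : K →+* R} {j : K →+* R'}
    (hij : ∀ c, SignType.sign (i c) = SignType.sign (j c)) : Transfer i j 1 := by
  intro p hp hpd r hr
  obtain ⟨v, u, rfl⟩ := exists_eq_X_add_C_of_natDegree_le_one hpd
  have hv : v ≠ 0 := by
    rintro rfl
    apply hp
    simp at hr
    simp [hr]
  simp only [Polynomial.map_add, Polynomial.map_mul, map_C, map_X, eval_add, eval_mul, eval_C,
    eval_X] at hr
  have hiv : i v ≠ 0 := by simpa using hv
  have hrc : r = i (-u / v) := by
    rw [map_div₀, map_neg]; field_simp; linear_combination hr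
  refine ⟨j (-u / v), fun q => ?_⟩
  rw [hrc, eval_map_apply, eval_map_apply, hij]

variable [IsStrictOrderedRing R']

lemma sign_derivatives_eq (hR : PolynomialIVT R) (hR' : PolynomialIVT R')
    {i : K →+* R} {j : K →+* R'} {z w : R} {z' w' : R'} (hz : SameSigns i j z z')
    (hw : SameSigns i j w w') (hzw : z ≤ w) (hwz : w' ≤ z') (q : K[X]) (k : ℕ) :
    SignType.sign ((derivative^[k] (q.map i)).eval z)
      = SignType.sign ((derivative^[k] (q.map i)).eval w) := by
  induction hn : q.natDegree using Nat.strong_induction_on generalizing q k with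
  | _ n ih =>
  by_cases h0 : q.natDegree = 0
  · obtain ⟨c, rfl⟩ := natDegree_eq_zero.1 h0
    cases k with
    | zero => simp
    | succ k => simp
  have h1 : ∀ k, SignType.sign ((derivative^[k] ((derivative q).map i)).eval z)
      = SignType.sign ((derivative^[k] ((derivative q).map i)).eval w) := fun k =>
    ih _ (hn ▸ natDegree_derivative_lt h0) (derivative q) k rfl
  cases k with
  | succ k =>
    rw [Function.iterate_succ_apply, derivative_map]
    exact h1 k
  | zero =>
    have h1' : ∀ k, SignType.sign ((derivative^[k] ((derivative q).map j)).eval w')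
        = SignType.sign ((derivative^[k] ((derivative q).map j)).eval z') := fun k => by
      have := h1 k
      rw [iterate_derivative_map, hz, hw] at this
      rw [iterate_derivative_map, this]
    have h2 := fun x hx hx' => sign_eval_eq_of_derivatives hR _ h1 (x := x) hx hx'
    have h2' := fun x hx hx' => sign_eval_eq_of_derivatives hR' _ h1' (x := x) hx hx'
    rw [← hw] at h2'
    have h1w := h1 0
    simp only [Function.iterate_zero, id] at h1w
    rw [← h1w] at h2'
    simp only [← derivative_map] at h2 h2'
    have h3 := eval_le_or_ge hR _ h2
    have h3' := eval_le_or_ge hR' _ h2'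
    simp only [Function.iterate_zero, id]
    rcases le_total 0 (SignType.sign ((derivative (q.map i)).eval z)) with h4 | h4
    · have h5 := SignType.sign.monotone (h3.1 h4 z w le_rfl hzw le_rfl)
      have h6 := SignType.sign.monotone (h3'.1 h4 w' z' le_rfl hwz le_rfl)
      rw [← hz, ← hw] at h6
      exact le_antisymm h5 h6
    · have h5 := SignType.sign.monotone (h3.2 h4 z w le_rfl hzw le_rfl)
      have h6 := SignType.sign.monotone (h3'.2 h4 w' z' le_rfl hwz le_rfl)
      rw [← hz, ← hw] at h6
      exact le_antisymm h6 h5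

lemma SameSigns.lt (hR : PolynomialIVT R) (hR' : PolynomialIVT R')
    {i : K →+* R} {j : K →+* R'} {z w : R} {z' w' : R'} (hz : SameSigns i j z z')
    (hw : SameSigns i j w w') (hzw : z < w) {q : K[X]} (hq : q ≠ 0) (hqz : (q.map i).eval z = 0) :
    z' < w' := by
  by_contra h
  exact hzw.ne (eq_of_sign_derivatives_eq hR ((Polynomial.map_ne_zero_iff i.injective).2 hq)
    (sign_derivatives_eq hR hR' hz hw hzw.le (not_lt.1 h) q) hqz hzw.le)

lemma exists_interval (hR : PolynomialIVT R) (hR' : PolynomialIVT R')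
    {i : K →+* R} {j : K →+* R'} (hij : ∀ c, SignType.sign (i c) = SignType.sign (j c)) {d : ℕ}
    (hT : Transfer i j d) (hT' : Transfer j i d) (S : Finset K[X])
    (hS : ∀ q ∈ S, q ≠ 0 ∧ q.natDegree ≤ d) (hSd : ∀ q ∈ S, q.natDegree ≠ 0 → derivative q ∈ S)
    {r : R} (hr : ∀ q ∈ S, (q.map i).eval r ≠ 0) {c₁ c₂ : K} (hc₁ : i c₁ < r) (hc₂ : r < i c₂)
    (hS₁ : X - C c₁ ∈ S) (hS₂ : X - C c₂ ∈ S) :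
    ∃ a b a' b', a < r ∧ r < b ∧ a' < b' ∧ SameSigns i j a a' ∧ SameSigns i j b b' ∧
      (∀ q ∈ S, ∀ x, a < x → x < b → (q.map i).eval x ≠ 0) ∧
      ∀ r', a' < r' → r' < b' → ∀ q ∈ S,
        SignType.sign ((q.map i).eval r) = SignType.sign ((q.map j).eval r') := by
  classical
  let Z : Finset R := S.biUnion fun q => (q.map i).roots.toFinset
  have hZ : ∀ x, x ∈ Z ↔ ∃ q ∈ S, (q.map i).eval x = 0 := by
    intro x
    simp only [Z, Finset.mem_biUnion, Multiset.mem_toFinset]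
    refine exists_congr fun q => and_congr_right fun hq => ?_
    rw [mem_roots ((Polynomial.map_ne_zero_iff i.injective).2 (hS q hq).1), IsRoot]
  have hA : (Z.filter (· < r)).Nonempty := ⟨i c₁, by simp [hZ, hc₁]; exact ⟨_, hS₁, by simp⟩⟩
  have hB : (Z.filter (r < ·)).Nonempty := ⟨i c₂, by simp [hZ, hc₂]; exact ⟨_, hS₂, by simp⟩⟩
  set a := (Z.filter (· < r)).max' hA with ha_def
  set b := (Z.filter (r < ·)).min' hB with hb_def
  have ha := Finset.mem_filter.1 ((Z.filter (· < r)).max'_mem hA)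
  have hb := Finset.mem_filter.1 ((Z.filter (r < ·)).min'_mem hB)
  rw [← ha_def, hZ] at ha
  rw [← hb_def, hZ] at hb
  obtain ⟨⟨qa, hqa, hqa0⟩, har⟩ := ha
  obtain ⟨⟨qb, hqb, hqb0⟩, hrb⟩ := hb
  have hnr : ∀ q ∈ S, ∀ x, a < x → x < b → (q.map i).eval x ≠ 0 := by
    intro q hq x hax hxb h0
    have hx : x ∈ Z := (hZ x).2 ⟨q, hq, h0⟩
    rcases lt_trichotomy x r with h | rfl | h
    · exact absurd hax (not_lt.2 (Finset.le_max' _ _ (Finset.mem_filter.2 ⟨hx, h⟩)))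
    · exact hr q hq h0
    · exact absurd hxb (not_lt.2 (Finset.min'_le _ _ (Finset.mem_filter.2 ⟨hx, h⟩)))
  obtain ⟨a', haa⟩ := hT qa (hS _ hqa).1 (hS _ hqa).2 a hqa0
  obtain ⟨b', hbb⟩ := hT qb (hS _ hqb).1 (hS _ hqb).2 b hqb0
  have hab' : a' < b' := haa.lt hR hR' hbb (har.trans hrb) (hS _ hqa).1 hqa0
  have hnr' : ∀ q ∈ S, ∀ x, a' < x → x < b' → (q.map j).eval x ≠ 0 := by
    intro q hq x hax hxb h0
    obtain ⟨y, hy⟩ := hT' q (hS _ hq).1 (hS _ hq).2 x h0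
    exact hnr q hq y
      (haa.symm.lt hR' hR hy hax (hS _ hqa).1 ((haa.eval_eq_zero_iff qa).1 hqa0))
      (hy.lt hR' hR hbb.symm hxb (hS _ hq).1 h0) ((hy.eval_eq_zero_iff q).1 h0)
  refine ⟨a, b, a', b', har, hrb, hab', haa, hbb, hnr, fun r' har' hrb' q hq => ?_⟩
  induction hn : q.natDegree using Nat.strong_induction_on generalizing q with
  | _ n ih =>
  by_cases h0 : q.natDegree = 0
  · obtain ⟨c, rfl⟩ := natDegree_eq_zero.1 h0
    simp [hij]
  have hq' := hSd q hq h0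
  have h1 := hnr _ hq'
  have h1' := hnr' _ hq'
  have h2 := ih _ (hn ▸ natDegree_derivative_lt h0) _ hq' rfl
  rw [← derivative_map] at h1 h1' h2
  rw [← derivative_map] at h2
  rw [sign_eval_eq_ite hR har hrb (hnr q hq) h1, sign_eval_eq_ite hR' har' hrb' (hnr' q hq) h1',
    h2, haa q]
  simp only [haa.eval_eq_zero_iff q]

lemma exists_bound (i : K →+* R) {p : K[X]} (hp : p ≠ 0) {r : R} (hr : (p.map i).eval r = 0) :
    ∃ c : K, i (-c) < r ∧ r < i c := by
  set d := p.natDegree with hd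
  let b : ℕ → K := fun k => p.coeff k / p.leadingCoeff
  have hu : i p.leadingCoeff ≠ 0 := by simpa using hp
  have h1 : r ^ d = -∑ k ∈ Finset.range d, i (b k) * r ^ k := by
    rw [eval_map, eval₂_eq_sum_range, Finset.sum_range_succ, ← hd] at hr
    have h2 : i p.leadingCoeff * ∑ k ∈ Finset.range d, i (b k) * r ^ k
        = ∑ k ∈ Finset.range d, i (p.coeff k) * r ^ k := by
      rw [Finset.mul_sum]
      refine Finset.sum_congr rfl fun k _ => ?_
      simp only [b, map_div₀]; field_simp
    refine mul_left_cancel₀ hu ?_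
    rw [mul_neg, h2]
    have h3 : p.coeff d = p.leadingCoeff := rfl
    rw [h3] at hr
    linear_combination hr
  refine ⟨2 + ∑ k ∈ Finset.range d, (1 + b k ^ 2), ?_⟩
  have h2 : |r| < i (2 + ∑ k ∈ Finset.range d, (1 + b k ^ 2)) := by
    simp only [map_add, map_sum, map_pow, map_one, map_ofNat]
    have hnn : 0 ≤ ∑ k ∈ Finset.range d, (1 + i (b k) ^ 2) :=
      Finset.sum_nonneg fun k _ => by positivity
    by_cases hr1 : |r| ≤ 1
    · linarith
    rw [not_le] at hr1
    have hd0 : d ≠ 0 := by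
      intro h0
      rw [h0] at h1
      simp at h1
    obtain ⟨e, he⟩ := Nat.exists_eq_succ_of_ne_zero hd0
    have h3 : |r| ^ d ≤ (∑ k ∈ Finset.range d, (1 + i (b k) ^ 2)) * |r| ^ e := by
      rw [← abs_pow, h1, abs_neg, Finset.sum_mul]
      refine (Finset.abs_sum_le_sum_abs _ _).trans (Finset.sum_le_sum fun k hk => ?_)
      rw [abs_mul, abs_pow]
      have hke : k ≤ e := by have := Finset.mem_range.1 hk; omega
      have h4 : |i (b k)| ≤ 1 + i (b k) ^ 2 := by
        rw [← sq_abs]; nlinarith [sq_nonneg (|i (b k)| - 1), abs_nonneg (i (b k))]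
      exact mul_le_mul h4 (pow_le_pow_right₀ hr1.le hke) (by positivity) (by positivity)
    rw [he, pow_succ, mul_comm] at h3
    have := le_of_mul_le_mul_right h3 (by positivity)
    rw [← he] at this
    linarith
  rw [map_neg]
  exact abs_lt.1 h2

/-- The nonzero iterated derivatives of the polynomials in a finite set. -/
noncomputable def derivClosure [DecidableEq K[X]] (S : Finset K[X]) (d : ℕ) : Finset K[X] :=
  (S.biUnion fun q => (Finset.range (d + 1)).image fun k => derivative^[k] q).filter (· ≠ 0)

lemma natDegree_iterate_derivative_le' (q : K[X]) (k : ℕ) :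
    (derivative^[k] q).natDegree ≤ q.natDegree :=
  (natDegree_iterate_derivative q k).trans (Nat.sub_le _ _)

lemma subset_derivClosure [DecidableEq K[X]] {S : Finset K[X]} {d : ℕ} {q : K[X]} (hq : q ∈ S)
    (hq0 : q ≠ 0) : q ∈ derivClosure S d := by
  simp only [derivClosure, Finset.mem_filter, Finset.mem_biUnion, Finset.mem_image,
    Finset.mem_range]
  exact ⟨⟨q, hq, 0, by omega, rfl⟩, hq0⟩

lemma natDegree_le_of_mem_derivClosure [DecidableEq K[X]] {S : Finset K[X]} {d : ℕ}
    (hS : ∀ q ∈ S, q.natDegree ≤ d) {q : K[X]} (hq : q ∈ derivClosure S d) :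
    q ≠ 0 ∧ q.natDegree ≤ d := by
  simp only [derivClosure, Finset.mem_filter, Finset.mem_biUnion, Finset.mem_image] at hq
  obtain ⟨⟨p, hp, k, -, rfl⟩, h0⟩ := hq
  exact ⟨h0, (natDegree_iterate_derivative_le' p k).trans (hS p hp)⟩

lemma derivative_mem_derivClosure [CharZero K] [DecidableEq K[X]] {S : Finset K[X]} {d : ℕ}
    (hS : ∀ q ∈ S, q.natDegree ≤ d) {q : K[X]} (hq : q ∈ derivClosure S d)
    (h0 : q.natDegree ≠ 0) : derivative q ∈ derivClosure S d := by
  have hne : derivative q ≠ 0 := fun h => h0 (derivative_eq_zero.1 h)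
  simp only [derivClosure, Finset.mem_filter, Finset.mem_biUnion, Finset.mem_image,
    Finset.mem_range] at hq ⊢
  obtain ⟨⟨p, hp, k, hk, rfl⟩, -⟩ := hq
  refine ⟨⟨p, hp, k + 1, ?_, Function.iterate_succ_apply' _ _ _⟩, hne⟩
  have h1 := natDegree_iterate_derivative p k
  have h2 := hS p hp
  omega

lemma exists_root_sameSigns_finset (hR : PolynomialIVT R) (hR' : PolynomialIVT R')
    {i : K →+* R} {j : K →+* R'} (hij : ∀ c, SignType.sign (i c) = SignType.sign (j c)) {d : ℕ}
    (hd : 1 ≤ d) (hT : Transfer i j d) (hT' : Transfer j i d) {p : K[X]}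
    (hpd : p.natDegree = d + 1) {r : R} (hr : (p.map i).eval r = 0)
    (hmin : ∀ q : K[X], q ≠ 0 → q.natDegree ≤ d → (q.map i).eval r ≠ 0)
    (S : Finset K[X]) (hS : ∀ q ∈ S, q ≠ 0 ∧ q.natDegree ≤ d) :
    ∃ r', (p.map j).eval r' = 0 ∧ ∀ q ∈ S,
        SignType.sign ((q.map i).eval r) = SignType.sign ((q.map j).eval r') := by
  classical
  have : CharZero K := i.charZero
  have hp : p ≠ 0 := by rintro rfl; simp at hpd
  obtain ⟨c, hc₁, hc₂⟩ := exists_bound i hp hr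
  have hp' : derivative p ≠ 0 := fun h => by
    have := derivative_eq_zero.1 h
    omega
  have hp'd : (derivative p).natDegree ≤ d := by
    have := natDegree_derivative_lt (p := p) (by omega)
    omega
  let S₀ : Finset K[X] := insert (X - C (-c)) (insert (X - C c) (insert (derivative p) S))
  have hS₀ : ∀ q ∈ S₀, q.natDegree ≤ d := by
    intro q hq
    simp only [S₀, Finset.mem_insert] at hq
    rcases hq with rfl | rfl | rfl | hq
    · rwa [natDegree_X_sub_C]
    · rwa [natDegree_X_sub_C]
    · exact hp'd
    · exact (hS q hq).2
  have hmem := fun q (hq : q ∈ derivClosure S₀ d) => natDegree_le_of_mem_derivClosure hS₀ hq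
  obtain ⟨a, b, a', b', har, hrb, hab', haa, hbb, hnr, hsign⟩ :=
    exists_interval hR hR' hij hT hT' (derivClosure S₀ d) hmem
      (fun q hq h0 => derivative_mem_derivClosure hS₀ hq h0)
      (fun q hq => hmin q (hmem q hq).1 (hmem q hq).2) hc₁ hc₂
      (subset_derivClosure (by simp [S₀]) (X_sub_C_ne_zero _))
      (subset_derivClosure (by simp [S₀]) (X_sub_C_ne_zero _))
  have hp'S : derivative p ∈ derivClosure S₀ d := subset_derivClosure (by simp [S₀]) hp'
  have hnp := hnr _ hp'S
  rw [← derivative_map] at hnp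
  have hneg : (p.map i).eval a * (p.map i).eval b < 0 := by
    obtain ⟨x, h1, h2, h3⟩ := exists_eval_sub_eq hR (p.map i) har
    obtain ⟨y, h4, h5, h6⟩ := exists_eval_sub_eq hR (p.map i) hrb
    have h7 := sign_eval_eq_of_no_root hR (h2.trans h4).le
      (fun z hz hz' => hnp z (h1.trans hz) (hz'.trans h5)) (hnp x h1 (h2.trans hrb))
      (hnp y (har.trans h4) h5)
    have h8 : 0 < (derivative (p.map i)).eval x * (derivative (p.map i)).eval y := by
      rw [← sign_eq_one_iff, sign_mul, h7, ← sign_mul, sign_eq_one_iff]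
      exact mul_self_pos.2 (hnp y (har.trans h4) h5)
    rw [hr] at h3 h6
    have h9 := mul_pos h8 (mul_pos (sub_pos.2 har) (sub_pos.2 hrb))
    have h10 : (p.map i).eval a * (p.map i).eval b = -((derivative (p.map i)).eval x *
        (derivative (p.map i)).eval y * ((r - a) * (b - r))) := by
      linear_combination -(p.map i).eval b * h3 - (derivative (p.map i)).eval x * (r - a) * h6
    linarith
  have hneg' : (p.map j).eval a' * (p.map j).eval b' < 0 := by
    rw [← sign_eq_neg_one_iff, sign_mul, ← haa, ← hbb, ← sign_mul, sign_eq_neg_one_iff]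
    exact hneg
  obtain ⟨r', h1, h2, h3⟩ := hR' _ a' b' hab' hneg'
  exact ⟨r', h3, fun q hq => hsign r' h1 h2 q
    (subset_derivClosure (by simp [S₀, hq]) (hS q hq).1)⟩

lemma Transfer.succ (hR : PolynomialIVT R) (hR' : PolynomialIVT R')
    {i : K →+* R} {j : K →+* R'} (hij : ∀ c, SignType.sign (i c) = SignType.sign (j c)) {d : ℕ}
    (hd : 1 ≤ d) (hT : Transfer i j d) (hT' : Transfer j i d) : Transfer i j (d + 1) := by
  classical
  intro p hp hpd r hr
  by_cases hmin : ∀ q : K[X], q ≠ 0 → q.natDegree ≤ d → (q.map i).eval r ≠ 0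
  swap
  · push Not at hmin
    obtain ⟨q, hq, hqd, h0⟩ := hmin
    exact hT q hq hqd r h0
  have hpd' : p.natDegree = d + 1 := by
    by_contra h
    exact hmin p hp (by omega) hr
  have key : ∃ r', (p.map j).eval r' = 0 ∧ ∀ q : K[X], q ≠ 0 → q.natDegree ≤ d →
      SignType.sign ((q.map i).eval r) = SignType.sign ((q.map j).eval r') := by
    by_contra hcon
    push Not at hcon
    choose! Q hQ0 hQd hQ using hcon
    obtain ⟨r', h1, h2⟩ := exists_root_sameSigns_finset hR hR' hij hd hT hT' hpd' hr hmin
      ((p.map j).roots.toFinset.image Q) (by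
        intro q hq
        simp only [Finset.mem_image, Multiset.mem_toFinset] at hq
        obtain ⟨x, hx, rfl⟩ := hq
        have hx := (mem_roots'.1 hx).2
        exact ⟨hQ0 x hx, hQd x hx⟩)
    refine hQ r' h1 (h2 _ (Finset.mem_image_of_mem _ ?_))
    rw [Multiset.mem_toFinset, mem_roots ((Polynomial.map_ne_zero_iff j.injective).2 hp)]
    exact h1
  obtain ⟨r', h1, h2⟩ := key
  refine ⟨r', fun q => ?_⟩
  have hq := EuclideanDomain.div_add_mod q p
  have e1 : (q.map i).eval r = ((q % p).map i).eval r := by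
    conv_lhs => rw [← hq]
    simp [hr]
  have e2 : (q.map j).eval r' = ((q % p).map j).eval r' := by
    conv_lhs => rw [← hq]
    simp [h1]
  rw [e1, e2]
  by_cases h0 : q % p = 0
  · simp [h0]
  · refine h2 _ h0 ?_
    have := natDegree_mod_lt q (q := p) (by omega)
    omega

lemma transfer (hR : PolynomialIVT R) (hR' : PolynomialIVT R')
    {i : K →+* R} {j : K →+* R'} (hij : ∀ c, SignType.sign (i c) = SignType.sign (j c)) (d : ℕ)
    (hd : 1 ≤ d) : Transfer i j d ∧ Transfer j i d := by
  induction d, hd using Nat.le_induction with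
  | base => exact ⟨transfer_one hij, transfer_one fun c => (hij c).symm⟩
  | succ d hd ih =>
    exact ⟨ih.1.succ hR hR' hij hd ih.2, ih.2.succ hR' hR (fun c => (hij c).symm) hd ih.1⟩

/-- Transfer of finitely many sign conditions in one variable between two ordered fields in which
polynomials satisfy the intermediate value property. -/
theorem exists_sameSigns_of_bounded (hR : PolynomialIVT R) (hR' : PolynomialIVT R')
    {i : K →+* R} {j : K →+* R'} (hij : ∀ c, SignType.sign (i c) = SignType.sign (j c))
    {r : R} {c₁ c₂ : K} (hc₁ : i c₁ < r) (hc₂ : r < i c₂) (S : Finset K[X]) :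
    ∃ r', ∀ q ∈ S, SignType.sign ((q.map i).eval r) = SignType.sign ((q.map j).eval r') := by
  classical
  have : CharZero K := i.charZero
  by_cases halg : ∃ p : K[X], p ≠ 0 ∧ (p.map i).eval r = 0
  · obtain ⟨p, hp, hr⟩ := halg
    obtain ⟨r', h⟩ := (transfer hR hR' hij (p.natDegree + 1) (by omega)).1 p hp (by omega) r hr
    exact ⟨r', fun q _ => h q⟩
  push Not at halg
  let S₀ : Finset K[X] := insert (X - C c₁) (insert (X - C c₂) S)
  let d := S₀.sup natDegree + 1
  have hS₀ : ∀ q ∈ S₀, q.natDegree ≤ d := fun q hq =>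
    (Finset.le_sup (f := natDegree) hq).trans (Nat.le_succ _)
  have hmem := fun q (hq : q ∈ derivClosure S₀ d) => natDegree_le_of_mem_derivClosure hS₀ hq
  have hT := transfer hR hR' hij d (by omega)
  obtain ⟨a, b, a', b', har, hrb, hab', haa, hbb, hnr, hsign⟩ :=
    exists_interval hR hR' hij hT.1 hT.2 (derivClosure S₀ d) hmem
      (fun q hq h0 => derivative_mem_derivClosure hS₀ hq h0)
      (fun q hq => halg q (hmem q hq).1) hc₁ hc₂
      (subset_derivClosure (by simp [S₀]) (X_sub_C_ne_zero _))
      (subset_derivClosure (by simp [S₀]) (X_sub_C_ne_zero _))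
  refine ⟨(a' + b') / 2, fun q hq => ?_⟩
  rcases eq_or_ne q 0 with rfl | h0
  · simp
  · exact hsign _ (by linarith) (by linarith) q (subset_derivClosure (by simp [S₀, hq]) h0)

end Transfer

theorem map_list_prod_mul {ι : Type*} {B : Type*} [NormedRing B] [NormedAlgebra ℝ B]
    {χ : B →L[ℝ] ℝ} {v : ι → B} {x : ι → ℝ}
    (hχ : ∀ i b, χ (v i * b) = x i * χ b) {n : ℕ} (σ : Fin n → ι) :
    χ (List.ofFn fun i => v (σ i)).prod = (∏ i, x (σ i)) * χ 1 := by
  induction n with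
  | zero => simp
  | succ n ih => rw [List.ofFn_succ, List.prod_cons, hχ, ih, Fin.prod_univ_succ, mul_assoc]

theorem mem_eball_of_norm_lt {G : Type*} [SeminormedAddCommGroup G] {v : G} {ρ : NNReal}
    {s : ENNReal} (hs : (ρ : ENNReal) ≤ s) (hv : ‖v‖ < ρ) : v ∈ Metric.eball (0 : G) s := by
  refine Metric.eball_subset_eball hs ?_
  rw [Metric.eball_coe]
  simpa using hv

section BaseChange

variable {ι : Type*} [Fintype ι] [DecidableEq ι]
  (B : Type*) [NormedRing B] [NormedAlgebra ℝ B]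

/-- Evaluation of a real power series in the coordinates `ι` at points with coordinates in a
normed algebra. -/
noncomputable def baseChange (p : FormalMultilinearSeries ℝ (ι → ℝ) ℝ) :
    FormalMultilinearSeries ℝ (ι → B) B := fun n =>
  ∑ σ : Fin n → ι, p n (fun i => Pi.single (σ i) 1) •
    (ContinuousMultilinearMap.mkPiAlgebraFin ℝ n B).compContinuousLinearMap
      (fun i => ContinuousLinearMap.proj (R := ℝ) (σ i))

theorem baseChange_apply (p : FormalMultilinearSeries ℝ (ι → ℝ) ℝ) (n : ℕ) (v : ι → B) :
    baseChange B p n (fun _ => v) = ∑ σ : Fin n → ι, p n (fun i => Pi.single (σ i) 1) •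
      (List.ofFn fun i => v (σ i)).prod := by
  simp [baseChange]

theorem norm_baseChange_le [NormOneClass B] (p : FormalMultilinearSeries ℝ (ι → ℝ) ℝ) (n : ℕ) :
    ‖baseChange B p n‖ ≤ (Fintype.card ι : ℝ) ^ n * ‖p n‖ := by
  refine ContinuousMultilinearMap.opNorm_le_bound (by positivity) fun v => ?_
  have h1 (σ : Fin n → ι) : ‖p n (fun i => Pi.single (σ i) 1)‖ ≤ ‖p n‖ := by
    refine ((p n).le_opNorm _).trans ?_
    refine mul_le_of_le_one_right (norm_nonneg _) (Finset.prod_le_one (by simp) ?_)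
    intro i _
    rw [Pi.norm_single]; simp
  have h2 (σ : Fin n → ι) : ‖(List.ofFn fun i => v i (σ i)).prod‖ ≤ ∏ i, ‖v i‖ := by
    have := (ContinuousMultilinearMap.mkPiAlgebraFin ℝ n B).le_opNorm fun i => v i (σ i)
    rw [ContinuousMultilinearMap.norm_mkPiAlgebraFin, one_mul,
      ContinuousMultilinearMap.mkPiAlgebraFin_apply] at this
    exact this.trans (Finset.prod_le_prod (fun _ _ => norm_nonneg _)
      fun i _ => norm_le_pi_norm (v i) (σ i))
  have h3 : baseChange B p n v = ∑ σ : Fin n → ι, p n (fun i => Pi.single (σ i) 1) •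
      (List.ofFn fun i => v i (σ i)).prod := by
    simp [baseChange]
  rw [h3]
  refine (norm_sum_le_of_le _ fun σ _ => (norm_smul_le _ _).trans
    (mul_le_mul (h1 σ) (h2 σ) (norm_nonneg _) (norm_nonneg _))).trans ?_
  simp [mul_assoc]

theorem baseChange_radius_pos [NormOneClass B] {p : FormalMultilinearSeries ℝ (ι → ℝ) ℝ}
    (hp : 0 < p.radius) : 0 < (baseChange B p).radius := by
  obtain ⟨C, r, hC, hr, h⟩ := p.le_mul_pow_of_radius_pos hp
  set N : ℝ := (Fintype.card ι : ℝ) with hN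
  have hN0 : 0 ≤ N := Nat.cast_nonneg _
  let s : NNReal := ⟨(N * r + 1)⁻¹, by positivity⟩
  have hs : 0 < s := by
    rw [← NNReal.coe_pos]; change 0 < (N * r + 1)⁻¹; positivity
  refine lt_of_lt_of_le (ENNReal.coe_pos.2 hs)
    ((baseChange B p).le_radius_of_bound C fun n => ?_)
  calc _ ≤ (N ^ n * (C * r ^ n)) * (N * r + 1)⁻¹ ^ n := by
        gcongr
        · exact (norm_baseChange_le B p n).trans (by gcongr; exact h n)
        · exact le_rfl
    _ = C * (N * r * (N * r + 1)⁻¹) ^ n := by rw [mul_pow, mul_pow]; ring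
    _ ≤ C * 1 := by
        gcongr
        refine pow_le_one₀ (by positivity) ?_
        rw [← div_eq_mul_inv, div_le_one (by positivity)]
        linarith
    _ = C := mul_one C

theorem map_baseChange_apply (p : FormalMultilinearSeries ℝ (ι → ℝ) ℝ)
    {χ : B →L[ℝ] ℝ} {v : ι → B} {x : ι → ℝ}
    (hχ : ∀ i b, χ (v i * b) = x i * χ b) (n : ℕ) :
    χ (baseChange B p n fun _ => v) = (p n fun _ => x) * χ 1 := by
  have hx : x = ∑ i, x i • (Pi.single i 1 : ι → ℝ) := by
    ext j; simp [Pi.single_apply]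
  have : (p n fun _ => x) =
      ∑ σ : Fin n → ι, (∏ i, x (σ i)) * p n (fun i => Pi.single (σ i) 1) := by
    conv_lhs => rw [hx]
    rw [(p n).map_sum (fun (_ : Fin n) (j : ι) => x j • (Pi.single j 1 : ι → ℝ))]
    exact Finset.sum_congr rfl fun σ _ => by rw [(p n).map_smul_univ]; rfl
  rw [this, baseChange_apply, map_sum, Finset.sum_mul]
  refine Finset.sum_congr rfl fun σ _ => ?_
  rw [map_smul, map_list_prod_mul hχ, smul_eq_mul]
  ring

theorem baseChange_apply_single (p : FormalMultilinearSeries ℝ (ι → ℝ) ℝ) (i₀ : ι)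
    (h : ∀ n, (p n fun _ => Pi.single i₀ 1) = 0) (b : B) (n : ℕ) :
    (baseChange B p n fun _ => Pi.single i₀ b) = 0 := by
  rw [baseChange_apply]
  refine Finset.sum_eq_zero fun σ _ => ?_
  by_cases hσ : ∀ i, σ i = i₀
  · simp only [hσ, h, zero_smul]
  · push Not at hσ
    obtain ⟨i, hi⟩ := hσ
    rw [List.prod_eq_zero, smul_zero]
    rw [List.mem_ofFn]
    exact ⟨i, by simp [hi]⟩

theorem exists_analyticAt_baseChange [NormOneClass B] [CompleteSpace B] {f : (ι → ℝ) → ℝ}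
    (hf : AnalyticAt ℝ f 0) (i₀ : ι) (hf0 : ∀ᶠ t : ℝ in 𝓝 0, f (Pi.single i₀ t) = 0) :
    ∃ F : (ι → B) → B, ∃ ρ > 0, (∀ v, ‖v‖ < ρ → AnalyticAt ℝ F v) ∧
      (∀ v x, ‖v‖ < ρ → ‖x‖ < ρ → ∀ χ : B →L[ℝ] ℝ, (∀ i b, χ (v i * b) = x i * χ b) →
        χ (F v) = f x * χ 1) ∧
      ∀ b, ‖b‖ < ρ → F (Pi.single i₀ b) = 0 := by
  obtain ⟨p, r, hp⟩ := hf
  have hline : ∀ n, (p n fun _ => Pi.single i₀ 1) = 0 := by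
    let L : ℝ →L[ℝ] (ι → ℝ) := ContinuousLinearMap.single ℝ (fun _ : ι => ℝ) i₀
    have hL : HasFPowerSeriesAt (f ∘ L) (p.compContinuousLinearMap L) 0 := by
      apply HasFPowerSeriesAt.compContinuousLinearMap
      rw [map_zero]
      exact hp.hasFPowerSeriesAt
    have h0 : HasFPowerSeriesAt 0 (p.compContinuousLinearMap L) (0 : ℝ) :=
      hL.congr (hf0.mono fun t ht => ht)
    intro n
    have := h0.apply_eq_zero n 1
    rw [FormalMultilinearSeries.compContinuousLinearMap_apply] at this
    exact this
  have hR := baseChange_radius_pos B (hp.r_pos.trans_le hp.r_le)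
  have hF := (baseChange B p).hasFPowerSeriesOnBall hR
  obtain ⟨ρ, hρ0, hρ⟩ := ENNReal.lt_iff_exists_nnreal_btwn.1 (lt_min hR hp.r_pos)
  have h1 : (ρ : ENNReal) ≤ (baseChange B p).radius := hρ.le.trans (min_le_left _ _)
  have h2 : (ρ : ENNReal) ≤ r := hρ.le.trans (min_le_right _ _)
  refine ⟨(baseChange B p).sum, ρ, by exact_mod_cast hρ0, fun v hv => ?_, ?_, ?_⟩
  · exact hF.analyticAt_of_mem (mem_eball_of_norm_lt h1 hv)
  · intro v x hv hx χ hχ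
    have hs := (hF.hasSum (mem_eball_of_norm_lt h1 hv)).mapL χ
    have hs' := (hp.hasSum (mem_eball_of_norm_lt h2 hx)).mul_right (χ 1)
    simp only [zero_add, map_baseChange_apply B p hχ] at hs hs'
    exact hs.unique hs'
  · intro b hb
    have hs := hF.hasSum (mem_eball_of_norm_lt (v := Pi.single i₀ b) h1 (by rwa [Pi.norm_single]))
    simp only [zero_add, baseChange_apply_single B p i₀ hline] at hs
    exact hs.unique hasSum_zero

end BaseChange

/-- The space of bounded sequences carries a shift, a left inverse of the shift, and the projector
on the first coordinate. -/
theorem exists_shift : ∃ (T S : (ℕ →ᵇ ℝ) →L[ℝ] (ℕ →ᵇ ℝ)) (δ : (ℕ →ᵇ ℝ) →L[ℝ] ℝ) (e : ℕ →ᵇ ℝ),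
    (∀ w, S (T w) = w) ∧ (∀ w, δ (T w) = 0) ∧ S e = 0 ∧ δ e = 1 ∧
      ∀ w, T (S w) + δ w • e = w := by
  let T₀ (w : ℕ →ᵇ ℝ) : ℕ →ᵇ ℝ := BoundedContinuousFunction.ofNormedAddCommGroupDiscrete
    (fun n => Nat.casesOn n 0 fun k => w k) ‖w‖ (by
      rintro (_ | n)
      · simp
      · exact w.norm_coe_le_norm n)
  let S₀ (w : ℕ →ᵇ ℝ) : ℕ →ᵇ ℝ := BoundedContinuousFunction.ofNormedAddCommGroupDiscrete
    (fun n => w (n + 1)) ‖w‖ fun n => w.norm_coe_le_norm _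
  let T : (ℕ →ᵇ ℝ) →ₗ[ℝ] (ℕ →ᵇ ℝ) :=
    { toFun := T₀
      map_add' := fun v w => by
        ext (_ | n)
        · exact (add_zero (0 : ℝ)).symm
        · rfl
      map_smul' := fun c w => by
        ext (_ | n)
        · exact (mul_zero c).symm
        · rfl }
  let S : (ℕ →ᵇ ℝ) →ₗ[ℝ] (ℕ →ᵇ ℝ) :=
    { toFun := S₀
      map_add' := fun v w => rfl
      map_smul' := fun c w => rfl }
  let e : ℕ →ᵇ ℝ := BoundedContinuousFunction.ofNormedAddCommGroupDiscrete
    (fun n => Nat.casesOn n 1 fun _ => 0) 1 (by rintro (_ | n) <;> simp)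
  refine ⟨T.mkContinuous 1 fun w => ?_, S.mkContinuous 1 fun w => ?_,
    BoundedContinuousFunction.evalCLM ℝ 0, e, fun w => rfl, fun w => rfl, rfl, rfl, fun w => ?_⟩
  · rw [one_mul]
    refine (BoundedContinuousFunction.norm_le (norm_nonneg _)).2 ?_
    rintro (_ | n)
    · exact norm_zero.trans_le (norm_nonneg w)
    · exact w.norm_coe_le_norm n
  · rw [one_mul]
    exact (BoundedContinuousFunction.norm_le (norm_nonneg _)).2 fun n => w.norm_coe_le_norm _
  · ext (_ | n)
    · change 0 + w 0 * 1 = w 0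
      ring
    · change w (n + 1) + w 0 * 0 = w (n + 1)
      ring

section Division

variable {W : Type*} [NormedAddCommGroup W] [NormedSpace ℝ W]

theorem shift_pow_add_sum {T S : W →L[ℝ] W} {δ : W →L[ℝ] ℝ} {e : W}
    (hTS : ∀ w, T (S w) + δ w • e = w) (d : ℕ) (w : W) :
    (T ^ d) ((S ^ d) w) + ∑ j ∈ Finset.range d, δ ((S ^ j) w) • (T ^ j) e = w := by
  induction d with
  | zero => simp
  | succ d ih =>
    rw [Finset.sum_range_succ, add_comm (Finset.sum _ _), ← add_assoc, pow_succ T, pow_succ' S]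
    simp only [mul_apply_eq_comp]
    rw [← map_smul, ← map_add, hTS, ih]

/-- The functional that sends a sequence `a` to `∑ j, a j * t ^ j`. -/
noncomputable def genFun (S : W →L[ℝ] W) (δ : W →L[ℝ] ℝ) (t : ℝ) : W →L[ℝ] ℝ :=
  δ.comp (Ring.inverse (1 - t • S))

theorem isUnit_one_sub_smul [CompleteSpace W] {S : W →L[ℝ] W} :
    ∀ᶠ t : ℝ in 𝓝 0, IsUnit (1 - t • S) := by
  have hc : Continuous fun t : ℝ => 1 - t • S := by fun_prop
  have := hc.continuousAt (x := 0) (Units.isOpen.mem_nhds (by simp))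
  exact this

theorem genFun_shift {T S : W →L[ℝ] W} {δ : W →L[ℝ] ℝ} (hST : ∀ w, S (T w) = w)
    (hδT : ∀ w, δ (T w) = 0) {t : ℝ} (ht : IsUnit (1 - t • S)) (w : W) :
    genFun S δ t (T w) = t * genFun S δ t w := by
  have h := Ring.inverse_mul_cancel _ ht
  have h2 := congrArg (fun A : W →L[ℝ] W => A (T w)) h
  simp only [mul_sub, mul_one, mul_smul_comm, sub_apply,
    smul_apply, mul_apply_eq_comp, hST,
    one_apply_eq_self] at h2
  have h3 := congrArg δ h2
  rw [map_sub, map_smul, hδT, sub_eq_zero] at h3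
  exact h3

theorem genFun_unit {S : W →L[ℝ] W} {δ : W →L[ℝ] ℝ} {e : W} (hSe : S e = 0) (hδe : δ e = 1)
    {t : ℝ} (ht : IsUnit (1 - t • S)) : genFun S δ t e = 1 := by
  have h := Ring.inverse_mul_cancel _ ht
  have h2 := congrArg (fun A : W →L[ℝ] W => A e) h
  simp only [mul_sub, mul_one, mul_smul_comm, sub_apply,
    smul_apply, mul_apply_eq_comp, hSe, map_zero, smul_zero,
    sub_zero, one_apply_eq_self] at h2
  have h3 := congrArg δ h2
  rw [hδe] at h3
  exact h3

theorem genFun_shift_pow {T S : W →L[ℝ] W} {δ : W →L[ℝ] ℝ} (hST : ∀ w, S (T w) = w)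
    (hδT : ∀ w, δ (T w) = 0) {t : ℝ} (ht : IsUnit (1 - t • S)) (j : ℕ) (w : W) :
    genFun S δ t ((T ^ j) w) = t ^ j * genFun S δ t w := by
  induction j with
  | zero => simp
  | succ j ih =>
    rw [pow_succ', mul_apply_eq_comp, genFun_shift hST hδT ht, ih]
    ring

theorem analyticAt_genFun [CompleteSpace W] (S : W →L[ℝ] W) (δ : W →L[ℝ] ℝ) :
    AnalyticAt ℝ (genFun S δ) 0 := by
  have h1 : AnalyticAt ℝ (fun t : ℝ => 1 - t • S) 0 := by fun_prop
  have h2 : AnalyticAt ℝ (Ring.inverse : (W →L[ℝ] W) → _) ((fun t : ℝ => 1 - t • S) 0) := by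
    simpa using analyticAt_inverse (𝕜 := ℝ) (1 : (W →L[ℝ] W)ˣ)
  have h3 : AnalyticAt ℝ (fun t : ℝ => Ring.inverse (1 - t • S)) 0 :=
    h2.comp (f := fun t : ℝ => 1 - t • S) h1
  exact ((ContinuousLinearMap.compL ℝ W W ℝ δ).analyticAt _).comp h3

end Division

/-- Weierstrass division of a power of the last variable by an analytic function which restricts to
that power on the last coordinate axis, computed in a space which carries a shift. -/
theorem exists_weierstrass_division_of_shift {W : Type*} [NormedAddCommGroup W] [NormedSpace ℝ W]
    [CompleteSpace W] {T S : W →L[ℝ] W} {δ : W →L[ℝ] ℝ} {e : W}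
    (hST : ∀ w, S (T w) = w) (hδT : ∀ w, δ (T w) = 0) (hSe : S e = 0) (hδe : δ e = 1)
    (hTS : ∀ w, T (S w) + δ w • e = w) {k : ℕ} {f : (Fin k → ℝ) × ℝ → ℝ} (hf : AnalyticAt ℝ f 0)
    {d : ℕ} (h0 : ∀ᶠ t : ℝ in 𝓝 0, f (0, t) = t ^ d) :
    ∃ q : (Fin k → ℝ) × ℝ → ℝ, AnalyticAt ℝ q 0 ∧ q 0 ≠ 0 ∧ ∃ a : ℕ → (Fin k → ℝ) → ℝ,
      (∀ j, AnalyticAt ℝ (a j) 0) ∧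
      ∀ᶠ z in 𝓝 0, f z * q z = ∑ j ∈ Finset.range (d + 1), a j z.1 * z.2 ^ j := by
  have : Nontrivial W := ⟨e, 0, by rintro rfl; simp at hδe⟩
  let g : (Option (Fin k) → ℝ) → ℝ := fun y => f (fun i => y (some i), y none) - y none ^ d
  have hg : AnalyticAt ℝ g 0 := by
    have hL : AnalyticAt ℝ (fun y : Option (Fin k) → ℝ => ((fun i => y (some i), y none) :
        (Fin k → ℝ) × ℝ)) 0 := by
      refine AnalyticAt.prod (f := fun (y : Option (Fin k) → ℝ) i => y (some i))
        (g := fun y => y none) (analyticAt_pi_iff.2 fun i => ?_) ?_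
      · exact (ContinuousLinearMap.proj (R := ℝ) (φ := fun _ : Option (Fin k) => ℝ)
          (some i)).analyticAt _
      · exact (ContinuousLinearMap.proj (R := ℝ) (φ := fun _ : Option (Fin k) => ℝ)
          none).analyticAt _
    have h1 : AnalyticAt ℝ (fun y : Option (Fin k) → ℝ => f (fun i => y (some i), y none)) 0 :=
      AnalyticAt.comp (g := f) hf hL
    have h2 : AnalyticAt ℝ (fun y : Option (Fin k) → ℝ => y none ^ d) 0 :=
      ((ContinuousLinearMap.proj (R := ℝ) (φ := fun _ : Option (Fin k) => ℝ) none).analyticAt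
        _).fun_pow d
    exact h1.sub h2
  have hg0 : ∀ᶠ t : ℝ in 𝓝 0, g (Pi.single none t) = 0 := by
    refine h0.mono fun t ht => ?_
    have h1 : (fun i : Fin k => (Pi.single none t : Option (Fin k) → ℝ) (some i)) = 0 := by
      ext i; simp
    simp only [g, h1, Pi.single_eq_same, ht, sub_self]
  obtain ⟨F, ρ, hρ, hFan, hFχ, hF0⟩ := exists_analyticAt_baseChange (W →L[ℝ] W) hg none hg0
  obtain ⟨s, hs, hsT, hsρ⟩ : ∃ s : ℝ, 0 < s ∧ ‖s • T‖ < ρ ∧ s < ρ := by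
    have hc : Continuous fun s : ℝ => ‖s • T‖ := by fun_prop
    have h1 : ∀ᶠ s : ℝ in 𝓝 0, ‖s • T‖ < ρ :=
      hc.continuousAt.eventually_lt continuousAt_const (by simpa using hρ)
    have h2 : ∀ᶠ s : ℝ in 𝓝 0, s < ρ := gt_mem_nhds hρ
    obtain ⟨s, ⟨hs1, hs2⟩, hs0⟩ := (((h1.and h2).filter_mono nhdsWithin_le_nhds).and
      (self_mem_nhdsWithin (s := Set.Ioi (0 : ℝ)))).exists
    exact ⟨s, hs0, hs1, hs2⟩
  let v : (Fin k → ℝ) → Option (Fin k) → W →L[ℝ] W := fun x o => o.elim (s • T) fun i => x i • 1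
  have hv0 : v 0 = Pi.single none (s • T) := by
    ext1 o; cases o <;> simp [v]
  have hvρ : ∀ x, ‖x‖ < ρ → ‖v x‖ < ρ := by
    intro x hx
    rw [pi_norm_lt_iff hρ]
    rintro (_ | i)
    · exact hsT
    · change ‖x i • (1 : W →L[ℝ] W)‖ < ρ
      rw [norm_smul, norm_one, mul_one]
      exact (norm_le_pi_norm x i).trans_lt hx
  have hvan : AnalyticAt ℝ v 0 := by
    rw [analyticAt_pi_iff]
    rintro (_ | i)
    · exact analyticAt_const
    · change AnalyticAt ℝ (fun x : Fin k → ℝ => x i • (1 : W →L[ℝ] W)) 0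
      exact ((ContinuousLinearMap.proj (R := ℝ) (φ := fun _ : Fin k => ℝ) i).analyticAt
        _).smul analyticAt_const
  let Φ : (Fin k → ℝ) → W →L[ℝ] W := fun x => (s • T) ^ d + F (v x)
  have hΦan : AnalyticAt ℝ Φ 0 :=
    analyticAt_const.add ((hFan _ (hvρ 0 (by simpa using hρ))).comp hvan)
  have hΦ0 : Φ 0 = (s • T) ^ d := by
    simp only [Φ, hv0, hF0 _ hsT, add_zero]
  -- the values of the operators `Φ x`
  have hΦ : ∀ x t, ‖x‖ < ρ → |t| < 1 → IsUnit (1 - t • S) → ∀ w,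
      genFun S δ t (Φ x w) = f (x, s * t) * genFun S δ t w := by
    intro x t hx ht hu w
    let y : Option (Fin k) → ℝ := fun o => o.elim (s * t) x
    have hy : ‖y‖ < ρ := by
      rw [pi_norm_lt_iff hρ]
      rintro (_ | i)
      · change |s * t| < ρ
        rw [abs_mul, abs_of_pos hs]
        nlinarith [abs_nonneg t]
      · exact (norm_le_pi_norm x i).trans_lt hx
    let χ : (W →L[ℝ] W) →L[ℝ] ℝ := (genFun S δ t).comp (ContinuousLinearMap.apply ℝ W w)
    have hχ : ∀ o b, χ (v x o * b) = y o * χ b := by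
      rintro (_ | i) b
      · change genFun S δ t ((s • T) (b w)) = s * t * genFun S δ t (b w)
        rw [smul_apply, map_smul, genFun_shift hST hδT hu, smul_eq_mul, mul_assoc]
      · change genFun S δ t ((x i • (1 : W →L[ℝ] W)) (b w)) = x i * genFun S δ t (b w)
        simp
    have h1 := hFχ (v x) y (hvρ x hx) hy χ hχ
    change genFun S δ t (F (v x) w) = (f (x, s * t) - (s * t) ^ d) * genFun S δ t w at h1
    change genFun S δ t (((s • T) ^ d) w + F (v x) w) = _
    rw [map_add, h1, _root_.smul_pow, smul_apply, map_smul, genFun_shift_pow hST hδT hu,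
      smul_eq_mul]
    ring
  let G : (Fin k → ℝ) → W →L[ℝ] W := fun x =>
    Φ x * ((s ^ d)⁻¹ • S ^ d) + ∑ j ∈ Finset.range d, (δ.comp (S ^ j)).smulRight ((T ^ j) e)
  have hsd : s ^ d ≠ 0 := (pow_pos hs d).ne'
  have hGan : AnalyticAt ℝ G 0 := (hΦan.mul analyticAt_const).add analyticAt_const
  have hG0 : G 0 = 1 := by
    ext1 w
    simp only [G, hΦ0, _root_.smul_pow, smul_mul_smul_comm, mul_inv_cancel₀ hsd, one_smul,
      add_apply, sum_apply, mul_apply_eq_comp, one_apply_eq_self]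
    exact shift_pow_add_sum hTS d w
  let w₀ : W := (s ^ d) • (T ^ d) e
  let w : (Fin k → ℝ) → W := fun x => Ring.inverse (G x) w₀
  have hwan : AnalyticAt ℝ w 0 := by
    have h1 : AnalyticAt ℝ (Ring.inverse : (W →L[ℝ] W) → _) (G 0) := by
      simpa [hG0] using analyticAt_inverse (𝕜 := ℝ) (1 : (W →L[ℝ] W)ˣ)
    exact ((ContinuousLinearMap.apply ℝ W w₀).analyticAt _).comp (h1.comp hGan)
  have hw0 : w 0 = w₀ := by simp [w, hG0]
  have hGunit : ∀ᶠ x in 𝓝 0, IsUnit (G x) :=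
    hGan.continuousAt (Units.isOpen.mem_nhds (by simp [hG0]))
  have hSTd : ∀ u, (S ^ d) ((T ^ d) u) = u := by
    intro u
    rw [← mul_apply_eq_comp, pow_mul_pow_eq_one d (ContinuousLinearMap.ext hST),
      one_apply_eq_self]
  let Q : (Fin k → ℝ) × ℝ → ℝ := fun z => (s ^ d)⁻¹ * genFun S δ z.2 ((S ^ d) (w z.1))
  have hQan : AnalyticAt ℝ Q 0 := by
    have h1 : AnalyticAt ℝ (fun z : (Fin k → ℝ) × ℝ => genFun S δ z.2) 0 :=
      AnalyticAt.comp (g := genFun S δ) (analyticAt_genFun S δ)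
        (f := fun z : (Fin k → ℝ) × ℝ => z.2) analyticAt_snd
    have h2 : AnalyticAt ℝ (fun z : (Fin k → ℝ) × ℝ => (S ^ d) (w z.1)) 0 :=
      ((S ^ d).analyticAt _).comp
        (AnalyticAt.comp (g := w) hwan (f := fun z : (Fin k → ℝ) × ℝ => z.1) analyticAt_fst)
    exact analyticAt_const.mul (AnalyticAt.comp₂
      ((ContinuousLinearMap.id ℝ (W →L[ℝ] ℝ)).analyticAt_bilinear _) h1 h2)
  have hQ0 : Q 0 = 1 := by
    change (s ^ d)⁻¹ * genFun S δ 0 ((S ^ d) (w 0)) = 1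
    rw [hw0, map_smul, hSTd, map_smul, genFun_unit hSe hδe (by simp)]
    simp [hsd]
  have hQ : ∀ᶠ z : (Fin k → ℝ) × ℝ in 𝓝 0, f (z.1, s * z.2) * Q z +
      ∑ j ∈ Finset.range d, δ ((S ^ j) (w z.1)) * z.2 ^ j = s ^ d * z.2 ^ d := by
    have c1 : Tendsto (fun z : (Fin k → ℝ) × ℝ => z.1) (𝓝 0) (𝓝 0) :=
      continuous_fst.tendsto' _ _ rfl
    have c2 : Tendsto (fun z : (Fin k → ℝ) × ℝ => z.2) (𝓝 0) (𝓝 0) :=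
      continuous_snd.tendsto' _ _ rfl
    have e1 : ∀ᶠ x : Fin k → ℝ in 𝓝 0, ‖x‖ < ρ := by
      filter_upwards [Metric.ball_mem_nhds (0 : Fin k → ℝ) hρ] with x hx
      simpa using hx
    have e2 : ∀ᶠ t : ℝ in 𝓝 0, |t| < 1 := by
      filter_upwards [Metric.ball_mem_nhds (0 : ℝ) one_pos] with x hx
      simpa using hx
    filter_upwards [c1.eventually e1, c2.eventually e2,
      c2.eventually (isUnit_one_sub_smul (S := S)), c1.eventually hGunit] with z h1 h2 h3 h4
    have h5 : G z.1 (w z.1) = w₀ := by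
      change (G z.1 * Ring.inverse (G z.1)) w₀ = w₀
      rw [Ring.mul_inverse_cancel _ h4, one_apply_eq_self]
    have h6 := congrArg (genFun S δ z.2) h5
    simp only [G, w₀, add_apply, sum_apply, mul_apply_eq_comp, map_add, map_sum, smul_apply,
      hΦ _ _ h1 h2 h3, ContinuousLinearMap.smulRight_apply, ContinuousLinearMap.comp_apply,
      map_smul, smul_eq_mul, genFun_shift_pow hST hδT h3, genFun_unit hSe hδe h3, mul_one] at h6
    rw [← h6, mul_left_comm]
  refine ⟨fun z => Q (z.1, s⁻¹ * z.2), ?_, ?_, fun j x => if j = d then 1 else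
    -(δ ((S ^ j) (w x)) * (s ^ j)⁻¹), fun j => ?_, ?_⟩
  · refine AnalyticAt.comp (g := Q) (f := fun z : (Fin k → ℝ) × ℝ => (z.1, s⁻¹ * z.2))
      (by rwa [Prod.fst_zero, Prod.snd_zero, mul_zero]) ?_
    exact analyticAt_fst.prod (analyticAt_const.mul analyticAt_snd)
  · simp only [Prod.fst_zero, Prod.snd_zero, mul_zero]
    change Q 0 ≠ 0
    rw [hQ0]
    exact one_ne_zero
  · by_cases hj : j = d
    · simp only [hj, if_true]
      exact analyticAt_const
    · simp only [hj, if_false]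
      exact (((δ.analyticAt _).comp (((S ^ j).analyticAt _).comp hwan)).mul analyticAt_const).neg
  · have c3 : Tendsto (fun z : (Fin k → ℝ) × ℝ => (z.1, s⁻¹ * z.2)) (𝓝 0) (𝓝 0) := by
      have : Continuous fun z : (Fin k → ℝ) × ℝ => (z.1, s⁻¹ * z.2) := by fun_prop
      exact this.tendsto' _ _ (by simp)
    filter_upwards [c3.eventually hQ] with z hz
    have e1 : s ^ d * (s⁻¹ * z.2) ^ d = z.2 ^ d := by
      rw [← mul_pow, mul_inv_cancel_left₀ hs.ne']
    rw [mul_inv_cancel_left₀ hs.ne', e1] at hz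
    rw [Finset.sum_range_succ, if_pos rfl, one_mul, ← hz, add_comm, add_assoc, left_eq_add,
      ← Finset.sum_add_distrib]
    refine Finset.sum_eq_zero fun j hj => ?_
    rw [if_neg (Finset.mem_range.1 hj).ne, mul_pow, inv_pow]
    ring

/-- Weierstrass division of a power of the last variable by an analytic function which restricts to
that power on the last coordinate axis. -/
theorem exists_weierstrass_division {k : ℕ} {f : (Fin k → ℝ) × ℝ → ℝ} (hf : AnalyticAt ℝ f 0)
    {d : ℕ} (h0 : ∀ᶠ t : ℝ in 𝓝 0, f (0, t) = t ^ d) :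
    ∃ q : (Fin k → ℝ) × ℝ → ℝ, AnalyticAt ℝ q 0 ∧ q 0 ≠ 0 ∧ ∃ a : ℕ → (Fin k → ℝ) → ℝ,
      (∀ j, AnalyticAt ℝ (a j) 0) ∧
      ∀ᶠ z in 𝓝 0, f z * q z = ∑ j ∈ Finset.range (d + 1), a j z.1 * z.2 ^ j := by
  obtain ⟨T, S, δ, e, hST, hδT, hSe, hδe, hTS⟩ := exists_shift
  exact exists_weierstrass_division_of_shift hST hδT hSe hδe hTS hf h0

/-- An analytic function which is regular in the last variable agrees, up to a factor which does not
vanish, with a polynomial in the last variable. -/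
theorem exists_analytic_preparation {k : ℕ} {f : (Fin k → ℝ) × ℝ → ℝ} (hf : AnalyticAt ℝ f 0)
    (h0 : ¬ ∀ᶠ t : ℝ in 𝓝 0, f (0, t) = 0) :
    ∃ q : (Fin k → ℝ) × ℝ → ℝ, AnalyticAt ℝ q 0 ∧ q 0 ≠ 0 ∧ ∃ (d : ℕ) (a : ℕ → (Fin k → ℝ) → ℝ),
      (∀ j, AnalyticAt ℝ (a j) 0) ∧
      ∀ᶠ z in 𝓝 0, f z = q z * ∑ j ∈ Finset.range (d + 1), a j z.1 * z.2 ^ j := by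
  have hf1 : AnalyticAt ℝ (fun t : ℝ => f (0, t)) 0 :=
    AnalyticAt.comp (g := f) (f := fun t : ℝ => ((0, t) : (Fin k → ℝ) × ℝ)) hf
      (analyticAt_const.prod analyticAt_id)
  obtain ⟨u, hu, hu0, hfu⟩ := hf1.analyticOrderAt_ne_top.1 (mt analyticOrderAt_eq_top.1 h0)
  set d := analyticOrderNatAt (fun t : ℝ => f (0, t)) 0
  have hune : ∀ᶠ t in 𝓝 0, u t ≠ 0 := hu.continuousAt.eventually_ne hu0
  have hu2 : AnalyticAt ℝ (fun z : (Fin k → ℝ) × ℝ => u z.2) 0 :=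
    AnalyticAt.comp (g := u) (f := fun z : (Fin k → ℝ) × ℝ => z.2) hu analyticAt_snd
  obtain ⟨q, hq, hq0, a, ha, h⟩ := exists_weierstrass_division (f := fun z => f z * (u z.2)⁻¹)
    (d := d) (hf.mul (hu2.inv hu0)) (by
      filter_upwards [hfu, hune] with t ht hne
      rw [ht, sub_zero, smul_eq_mul, mul_inv_cancel_right₀ hne])
  refine ⟨fun z => u z.2 * (q z)⁻¹, hu2.mul (hq.inv hq0), mul_ne_zero hu0 (inv_ne_zero hq0),
    d, a, ha, ?_⟩
  have c2 : Tendsto (fun z : (Fin k → ℝ) × ℝ => z.2) (𝓝 0) (𝓝 0) :=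
      continuous_snd.tendsto' _ _ rfl
  filter_upwards [h, c2.eventually hune, hq.continuousAt.eventually_ne hq0] with z h1 h2 h3
  rw [← h1]
  field_simp

section AnalyticRing

variable (E : Type*) [NormedAddCommGroup E] [NormedSpace ℝ E]

/-- The ring of functions which are analytic at the origin. -/
def analyticRing : Subring (E → ℝ) where
  carrier := {f | AnalyticAt ℝ f 0}
  mul_mem' hf hg := AnalyticAt.mul hf hg
  one_mem' := analyticAt_const
  add_mem' hf hg := AnalyticAt.add hf hg
  zero_mem' := analyticAt_const
  neg_mem' hf := AnalyticAt.neg hf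

variable {E}

/-- Evaluation at a point, as a ring homomorphism. -/
def evalAt (x : E) : analyticRing E →+* ℝ :=
  (Pi.evalRingHom (fun _ : E => ℝ) x).comp (analyticRing E).subtype

@[simp]
theorem evalAt_apply (x : E) (f : analyticRing E) : evalAt x f = f.1 x := rfl

/-- Composition with a continuous linear map, as a ring homomorphism. -/
def pullback {F : Type*} [NormedAddCommGroup F] [NormedSpace ℝ F] (L : E →L[ℝ] F) :
    analyticRing F →+* analyticRing E where
  toFun f := ⟨f.1 ∘ L, AnalyticAt.comp (g := f.1) (by
    rw [map_zero]; exact f.2) (L.analyticAt 0)⟩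
  map_one' := rfl
  map_mul' _ _ := rfl
  map_zero' := rfl
  map_add' _ _ := rfl

@[simp]
theorem pullback_apply {F : Type*} [NormedAddCommGroup F] [NormedSpace ℝ F] (L : E →L[ℝ] F)
    (f : analyticRing F) (x : E) : (pullback L f).1 x = f.1 (L x) := rfl

/-- A ring homomorphism factors through germs if it kills the functions which vanish near `0`. -/
def FactorsThroughGerms {R : Type*} [Semiring R] (φ : analyticRing E →+* R) : Prop :=
  ∀ f : analyticRing E, (∀ᶠ x in 𝓝 0, f.1 x = 0) → φ f = 0

section Sign

theorem FactorsThroughGerms.congr {R : Type*} [Ring R] {φ : analyticRing E →+* R}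
    (hφ : FactorsThroughGerms φ) {f g : analyticRing E}
    (h : ∀ᶠ x in 𝓝 0, f.1 x = g.1 x) : φ f = φ g := by
  rw [← sub_eq_zero, ← map_sub]
  exact hφ _ (h.mono fun x hx => sub_eq_zero.2 hx)

variable {R : Type*} [Field R] [LinearOrder R] [IsStrictOrderedRing R]
  {φ : analyticRing E →+* R}

theorem FactorsThroughGerms.pos (hφ : FactorsThroughGerms φ) {f : analyticRing E}
    (hf : 0 < f.1 0) : 0 < φ f := by
  have hpos : ∀ᶠ x in 𝓝 0, 0 < f.1 x := f.2.continuousAt.eventually (lt_mem_nhds hf)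
  let g : analyticRing E :=
    ⟨fun x => Real.exp (Real.log (f.1 x) * (1 / 2)),
      (((analyticAt_log hf).comp f.2).mul analyticAt_const).rexp⟩
  let h : analyticRing E := ⟨fun x => (f.1 x)⁻¹, AnalyticAt.inv f.2 hf.ne'⟩
  have h1 : φ f = φ (g * g) := hφ.congr (hpos.mono fun x hx => by
    change f.1 x = Real.exp (Real.log (f.1 x) * (1 / 2)) * Real.exp (Real.log (f.1 x) * (1 / 2))
    rw [← Real.exp_add, ← mul_add, add_halves, mul_one, Real.exp_log hx])
  have h2 : φ (f * h) = φ 1 := hφ.congr (hpos.mono fun x hx => mul_inv_cancel₀ hx.ne')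
  rw [map_mul, map_one] at h2
  refine lt_of_le_of_ne ?_ fun h0 => ?_
  · rw [h1, map_mul]
    exact mul_self_nonneg _
  · rw [← h0, zero_mul] at h2
    exact zero_ne_one h2

theorem FactorsThroughGerms.sign_eq (hφ : FactorsThroughGerms φ) {f : analyticRing E}
    (hf : f.1 0 ≠ 0) : SignType.sign (φ f) = SignType.sign (f.1 0) := by
  rcases hf.lt_or_gt with h | h
  · have : 0 < φ (-f) := hφ.pos (f := -f) (neg_pos.2 h)
    rw [map_neg, neg_pos] at this
    rw [sign_neg this, sign_neg h]
  · rw [sign_pos (hφ.pos h), sign_pos h]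

end Sign

end AnalyticRing

section Ultraproduct

variable {ι : Type*}

theorem polynomialIVT_real : PolynomialIVT ℝ := by
  intro p a b hab h
  have hc : ContinuousOn (fun x => p.eval x) (Set.Icc a b) := p.continuous.continuousOn
  rcases mul_neg_iff.1 h with ⟨h1, h2⟩ | ⟨h1, h2⟩
  · obtain ⟨c, hc, h0⟩ := intermediate_value_Ioo' hab.le hc ⟨h2, h1⟩
    exact ⟨c, hc.1, hc.2, h0⟩
  · obtain ⟨c, hc, h0⟩ := intermediate_value_Ioo hab.le hc ⟨h1, h2⟩
    exact ⟨c, hc.1, hc.2, h0⟩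

theorem eval_germ {l : Filter ι} {B : Type*} [CommRing B] (g : ι → B →+* ℝ) (t : ι → ℝ) (P : B[X]) :
    (P.map ((Germ.coeRingHom l).comp (RingHom.pi g))).eval (t : l.Germ ℝ) =
      ((fun i => (P.map (g i)).eval (t i) : ι → ℝ) : l.Germ ℝ) := by
  rw [← Polynomial.map_map, eval_map]
  change eval₂ (Germ.coeRingHom l) (Germ.coeRingHom l t) _ = Germ.coeRingHom l _
  rw [eval₂_hom]
  congr 1
  ext i
  change Pi.evalRingHom (fun _ : ι => ℝ) i (eval t (P.map (RingHom.pi g))) = _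
  rw [eval_map, hom_eval₂, eval_map]
  rfl

variable (U : Ultrafilter ι)

theorem sign_germ {s : SignType} {g : ι → ℝ} :
    SignType.sign (g : (U : Filter ι).Germ ℝ) = s ↔ ∀ᶠ i in U, SignType.sign (g i) = s := by
  have h0 : ((0 : ι → ℝ) : (U : Filter ι).Germ ℝ) = 0 := rfl
  cases s with
  | zero =>
    change SignType.sign (g : (U : Filter ι).Germ ℝ) = 0 ↔ ∀ᶠ i in U, SignType.sign (g i) = 0
    simp only [sign_eq_zero_iff]
    rw [← h0, Germ.coe_eq]
    rfl
  | pos =>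
    change SignType.sign (g : (U : Filter ι).Germ ℝ) = 1 ↔ ∀ᶠ i in U, SignType.sign (g i) = 1
    simp only [sign_eq_one_iff]
    rw [← h0, Germ.coe_lt]
    rfl
  | neg =>
    change SignType.sign (g : (U : Filter ι).Germ ℝ) = -1 ↔ ∀ᶠ i in U, SignType.sign (g i) = -1
    simp only [sign_eq_neg_one_iff]
    rw [← h0, Germ.coe_lt]
    rfl

theorem polynomialIVT_germ : PolynomialIVT ((U : Filter ι).Germ ℝ) := by
  intro p a b
  have hsurj : Function.Surjective
      ((Germ.coeRingHom (U : Filter ι)).comp (RingHom.pi (Pi.evalRingHom fun _ : ι => ℝ))) := by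
    intro x
    induction x using Germ.inductionOn with | _ x => exact ⟨x, rfl⟩
  obtain ⟨P, rfl⟩ := Polynomial.map_surjective _ hsurj p
  induction a using Germ.inductionOn with | _ a => ?_
  induction b using Germ.inductionOn with | _ b => ?_
  intro hab h
  rw [eval_germ, eval_germ] at h
  have h0 : ((0 : ι → ℝ) : (U : Filter ι).Germ ℝ) = 0 := rfl
  rw [← Germ.coe_mul, ← h0, Germ.coe_lt] at h
  rw [Germ.coe_lt] at hab
  have key : ∀ i, ∃ c, (a i < b i ∧ (P.map (Pi.evalRingHom _ i)).eval (a i) *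
      (P.map (Pi.evalRingHom _ i)).eval (b i) < 0) → a i < c ∧ c < b i ∧
      (P.map (Pi.evalRingHom (fun _ : ι => ℝ) i)).eval c = 0 := by
    intro i
    by_cases hi : a i < b i ∧ (P.map (Pi.evalRingHom _ i)).eval (a i) *
      (P.map (Pi.evalRingHom _ i)).eval (b i) < 0
    · obtain ⟨c, hc⟩ := polynomialIVT_real _ _ _ hi.1 hi.2
      exact ⟨c, fun _ => hc⟩
    · exact ⟨0, fun h => absurd h hi⟩
  choose c hc using key
  refine ⟨c, ?_, ?_, ?_⟩
  · rw [Germ.coe_lt]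
    filter_upwards [hab, h] with i h1 h2 using (hc i ⟨h1, h2⟩).1
  · rw [Germ.coe_lt]
    filter_upwards [hab, h] with i h1 h2 using (hc i ⟨h1, h2⟩).2.1
  · rw [eval_germ, ← h0, Germ.coe_eq]
    filter_upwards [hab, h] with i h1 h2 using (hc i ⟨h1, h2⟩).2.2

end Ultraproduct

section Generic

variable {E : Type*} [NormedAddCommGroup E] [NormedSpace ℝ E]

theorem exists_ball_analyticOnNhd {f : E → ℝ} (hf : AnalyticAt ℝ f 0) :
    ∃ r > 0, AnalyticOnNhd ℝ f (Metric.ball 0 r) := by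
  obtain ⟨r, hr, h⟩ := Metric.eventually_nhds_iff_ball.1 hf.eventually_analyticAt
  exact ⟨r, hr, h⟩

theorem eventually_eq_zero_or_of_mul {f g : E → ℝ} (hf : AnalyticAt ℝ f 0)
    (hg : AnalyticAt ℝ g 0) (h : ∀ᶠ x in 𝓝 0, f x * g x = 0) :
    (∀ᶠ x in 𝓝 0, f x = 0) ∨ ∀ᶠ x in 𝓝 0, g x = 0 := by
  obtain ⟨r, hr, hball⟩ := Metric.eventually_nhds_iff_ball.1
    ((hf.eventually_analyticAt.and hg.eventually_analyticAt).and h)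
  refine or_iff_not_imp_left.2 fun h1 => ?_
  obtain ⟨a, ha, hfa⟩ : ∃ a ∈ Metric.ball (0 : E) r, f a ≠ 0 := by
    by_contra! hc
    exact h1 (Metric.eventually_nhds_iff_ball.2 ⟨r, hr, hc⟩)
  have hga : ∀ᶠ x in 𝓝 a, g x = 0 := by
    filter_upwards [(hball a ha).1.1.continuousAt.eventually_ne hfa,
      Metric.isOpen_ball.mem_nhds ha] with x hx hxb
    exact (mul_eq_zero.1 (hball x hxb).2).resolve_left hx
  have := AnalyticOnNhd.eqOn_zero_of_preconnected_of_eventuallyEq_zero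
    (fun x hx => (hball x hx).1.2) (convex_ball (0 : E) r).isPreconnected ha hga
  exact Metric.eventually_nhds_iff_ball.2 ⟨r, hr, this⟩

theorem exists_ne_zero_line {f : E → ℝ} (hf : AnalyticAt ℝ f 0) (h0 : ¬ ∀ᶠ x in 𝓝 0, f x = 0) :
    ∃ v : E, f v ≠ 0 ∧ ¬ ∀ᶠ t : ℝ in 𝓝 0, f (t • v) = 0 := by
  obtain ⟨r, hr, hball⟩ := exists_ball_analyticOnNhd hf
  obtain ⟨v, hv, hfv⟩ : ∃ a ∈ Metric.ball (0 : E) r, f a ≠ 0 := by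
    by_contra! hc
    exact h0 (Metric.eventually_nhds_iff_ball.2 ⟨r, hr, hc⟩)
  refine ⟨v, hfv, fun h => hfv ?_⟩
  have hmem : ∀ t ∈ Set.Icc (0 : ℝ) 1, t • v ∈ Metric.ball (0 : E) r := by
    intro t ht
    rw [mem_ball_zero_iff] at hv ⊢
    rw [norm_smul, Real.norm_of_nonneg ht.1]
    exact (mul_le_of_le_one_left (norm_nonneg v) ht.2).trans_lt hv
  have han : AnalyticOnNhd ℝ (fun t : ℝ => f (t • v)) (Set.Icc 0 1) := fun t ht =>
    AnalyticAt.comp (g := f) (f := fun t : ℝ => t • v) (hball _ (hmem t ht))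
      (analyticAt_id.smul analyticAt_const)
  have := han.eqOn_zero_of_preconnected_of_eventuallyEq_zero isPreconnected_Icc
    (Set.left_mem_Icc.2 zero_le_one) h (Set.right_mem_Icc.2 zero_le_one)
  simpa using this

theorem not_eventually_prod_eq_zero {S : Finset (analyticRing E)}
    (hS : ∀ f ∈ S, ¬ ∀ᶠ x in 𝓝 0, f.1 x = 0) : ¬ ∀ᶠ x in 𝓝 0, (∏ f ∈ S, f).1 x = 0 := by
  classical
  induction S using Finset.induction_on with
  | empty =>
    intro h
    obtain ⟨x, hx⟩ := h.exists
    exact one_ne_zero hx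
  | insert f S hf ih =>
    rw [Finset.prod_insert hf]
    intro h
    rcases eventually_eq_zero_or_of_mul f.2 (∏ f ∈ S, f).2 h with h | h
    · exact hS f (Finset.mem_insert_self f S) h
    · exact ih (fun g hg => hS g (Finset.mem_insert_of_mem hg)) h

end Generic

theorem sign_div_eq {F : Type*} [Field F] [LinearOrder F] [IsStrictOrderedRing F] (a b : F) :
    SignType.sign (a / b) = SignType.sign (a * b) := by
  rcases eq_or_ne b 0 with rfl | hb
  · simp
  · have : a / b = a * b * (b⁻¹ * b⁻¹) := by field_simp
    rw [this, sign_mul, sign_pos (mul_self_pos.2 (inv_ne_zero hb)), mul_one]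

/-- Two sign-compatible ring homomorphisms into ordered fields factor through sign-compatible
embeddings of a common field. -/
theorem exists_field_of_sameSigns.{u, v, w} {B : Type u} {R : Type v} {R' : Type w}
    [CommRing B] [Field R] [LinearOrder R] [IsStrictOrderedRing R] [Field R'] [LinearOrder R']
    [IsStrictOrderedRing R'] (φ : B →+* R) (ψ : B →+* R')
    (h : ∀ b, SignType.sign (φ b) = SignType.sign (ψ b)) :
    ∃ (K : Type u) (_ : Field K) (c : B →+* K) (i : K →+* R) (j : K →+* R'),
      i.comp c = φ ∧ j.comp c = ψ ∧ ∀ x, SignType.sign (i x) = SignType.sign (j x) := by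
  have hker : ∀ b, φ b = 0 ↔ ψ b = 0 := fun b => by
    rw [← sign_eq_zero_iff, h, sign_eq_zero_iff]
  have : (RingHom.ker φ).IsPrime := RingHom.ker_isPrime φ
  let Q := B ⧸ RingHom.ker φ
  let i₀ : Q →+* R := Ideal.Quotient.lift _ φ fun a ha => ha
  let j₀ : Q →+* R' := Ideal.Quotient.lift _ ψ fun a ha => (hker a).1 ha
  have hi : Function.Injective i₀ := by
    rw [injective_iff_map_eq_zero]
    intro x
    obtain ⟨b, rfl⟩ := Ideal.Quotient.mk_surjective x
    intro hb
    exact Ideal.Quotient.eq_zero_iff_mem.2 hb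
  have hj : Function.Injective j₀ := by
    rw [injective_iff_map_eq_zero]
    intro x
    obtain ⟨b, rfl⟩ := Ideal.Quotient.mk_surjective x
    intro hb
    exact Ideal.Quotient.eq_zero_iff_mem.2 ((hker b).2 hb)
  refine ⟨FractionRing Q, inferInstance,
    (algebraMap Q (FractionRing Q)).comp (Ideal.Quotient.mk _),
    IsFractionRing.lift hi, IsFractionRing.lift hj, ?_, ?_, ?_⟩
  · ext b
    exact IsFractionRing.lift_algebraMap hi _
  · ext b
    exact IsFractionRing.lift_algebraMap hj _
  · intro x
    obtain ⟨a, b, -, rfl⟩ := IsFractionRing.div_surjective (A := Q) x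
    obtain ⟨a, rfl⟩ := Ideal.Quotient.mk_surjective a
    obtain ⟨b, rfl⟩ := Ideal.Quotient.mk_surjective b
    simp only [map_div₀, IsFractionRing.lift_algebraMap, sign_div_eq, ← map_mul]
    exact h (a * b)

/-- The Artin–Lang property: ring homomorphisms from a ring of functions into ordered fields with
the intermediate value property can be approximated by evaluations at points near `0`. -/
def ArtinLang (E : Type) [NormedAddCommGroup E] [NormedSpace ℝ E] : Prop :=
  ∀ (R : Type) [Field R] [LinearOrder R] [IsStrictOrderedRing R], PolynomialIVT R →
    ∀ φ : analyticRing E →+* R, FactorsThroughGerms φ →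
      ∀ (S : Finset (analyticRing E)), ∀ N ∈ 𝓝 (0 : E),
        ∃ x ∈ N, ∀ f ∈ S, SignType.sign (f.1 x) = SignType.sign (φ f)

section RegularStep

variable {k : ℕ}

/-- The second coordinate as an analytic function. -/
def sndFun : analyticRing ((Fin k → ℝ) × ℝ) := ⟨Prod.snd, analyticAt_snd⟩

theorem exists_preparation {f : analyticRing ((Fin k → ℝ) × ℝ)}
    (h0 : ¬ ∀ᶠ t : ℝ in 𝓝 0, f.1 (0, t) = 0) :
    ∃ q : analyticRing ((Fin k → ℝ) × ℝ), q.1 0 ≠ 0 ∧ ∃ P : (analyticRing (Fin k → ℝ))[X],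
      ∀ᶠ z in 𝓝 0, f.1 z = q.1 z * (P.map (evalAt z.1)).eval z.2 := by
  obtain ⟨q, hq, hq0, d, a, ha, h⟩ := exists_analytic_preparation f.2 h0
  refine ⟨⟨q, hq⟩, hq0, ∑ j ∈ Finset.range (d + 1), C ⟨a j, ha j⟩ * X ^ j, ?_⟩
  filter_upwards [h] with z hz
  rw [hz]
  simp [Polynomial.map_sum, eval_finsetSum]

theorem evalAt_eval (P : (analyticRing (Fin k → ℝ))[X]) (z : (Fin k → ℝ) × ℝ) :
    ((P.map (pullback (ContinuousLinearMap.fst ℝ (Fin k → ℝ) ℝ))).eval sndFun).1 z =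
      (P.map (evalAt z.1)).eval z.2 := by
  rw [← evalAt_apply, eval_map, hom_eval₂, eval_map]
  rfl

theorem map_eval {R : Type*} [CommRing R] (φ : analyticRing ((Fin k → ℝ) × ℝ) →+* R)
    (P : (analyticRing (Fin k → ℝ))[X]) :
    φ ((P.map (pullback (ContinuousLinearMap.fst ℝ (Fin k → ℝ) ℝ))).eval sndFun) =
      (P.map (φ.comp (pullback (ContinuousLinearMap.fst ℝ (Fin k → ℝ) ℝ)))).eval (φ sndFun) := by
  rw [eval_map, hom_eval₂, eval_map]

theorem artinLang_of_regular (ih : ArtinLang (Fin k → ℝ)) {R : Type} [Field R] [LinearOrder R]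
    [IsStrictOrderedRing R] (hR : PolynomialIVT R) {φ : analyticRing ((Fin k → ℝ) × ℝ) →+* R}
    (hφ : FactorsThroughGerms φ) {S : Finset (analyticRing ((Fin k → ℝ) × ℝ))}
    (hS : ∀ f ∈ S, ¬ ∀ᶠ t : ℝ in 𝓝 0, f.1 (0, t) = 0) {N : Set ((Fin k → ℝ) × ℝ)} (hN : N ∈ 𝓝 0) :
    ∃ z ∈ N, ∀ f ∈ S, SignType.sign (f.1 z) = SignType.sign (φ f) := by
  classical
  have prep : ∀ f : S, ∃ q : analyticRing ((Fin k → ℝ) × ℝ), q.1 0 ≠ 0 ∧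
      ∃ P : (analyticRing (Fin k → ℝ))[X],
        ∀ᶠ z in 𝓝 0, f.1.1 z = q.1 z * (P.map (evalAt z.1)).eval z.2 :=
    fun f => exists_preparation (hS f.1 f.2)
  choose q hq0 P hP using prep
  set φ' := φ.comp (pullback (ContinuousLinearMap.fst ℝ (Fin k → ℝ) ℝ)) with hφ'
  have hφ'g : FactorsThroughGerms φ' := by
    intro f hf
    refine hφ _ ?_
    have c1 : Tendsto (fun z : (Fin k → ℝ) × ℝ => z.1) (𝓝 0) (𝓝 0) :=
      continuous_fst.tendsto' _ _ rfl
    exact c1.eventually hf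
  have hsgnq : ∀ f : S, ∀ᶠ z in 𝓝 0, SignType.sign ((q f).1 z) = SignType.sign ((q f).1 0) := by
    intro f
    rcases (hq0 f).lt_or_gt with h | h
    · filter_upwards [(q f).2.continuousAt.eventually (gt_mem_nhds h)] with z hz
      rw [sign_neg hz, sign_neg h]
    · filter_upwards [(q f).2.continuousAt.eventually (lt_mem_nhds h)] with z hz
      rw [sign_pos hz, sign_pos h]
  have hφf : ∀ f : S, SignType.sign (φ f.1) =
      SignType.sign ((q f).1 0) * SignType.sign (((P f).map φ').eval (φ sndFun)) := by
    intro f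
    rw [← hφ.sign_eq (hq0 f), ← sign_mul, ← map_eval, ← map_mul]
    congr 1
    refine hφ.congr ((hP f).mono fun z hz => ?_)
    rw [hz, ← evalAt_eval]
    rfl
  have hN' : ∀ᶠ z in 𝓝 ((0, 0) : (Fin k → ℝ) × ℝ), z ∈ N ∧ ∀ f : S,
      f.1.1 z = (q f).1 z * ((P f).map (evalAt z.1)).eval z.2 ∧
        SignType.sign ((q f).1 z) = SignType.sign ((q f).1 0) :=
    Eventually.and hN (eventually_all.2 fun f => (hP f).and (hsgnq f))
  rw [nhds_prod_eq, eventually_prod_iff] at hN'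
  obtain ⟨p₁, hp₁, p₂, hp₂, hp⟩ := hN'
  obtain ⟨ε, hε, hε2⟩ := Metric.eventually_nhds_iff_ball.1 hp₂
  -- approximating points in the ultraproduct
  have key : ∀ T : Finset (analyticRing (Fin k → ℝ)), ∃ x, p₁ x ∧
      ∀ f ∈ T, SignType.sign (f.1 x) = SignType.sign (φ' f) := fun T => ih R hR φ' hφ'g T _ hp₁
  choose x hx₁ hx using key
  let U : Ultrafilter (Finset (analyticRing (Fin k → ℝ))) := Ultrafilter.of atTop
  let ψ : analyticRing (Fin k → ℝ) →+* (U : Filter (Finset (analyticRing (Fin k → ℝ)))).Germ ℝ :=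
    (Germ.coeRingHom (U : Filter (Finset (analyticRing (Fin k → ℝ))))).comp
      (RingHom.pi fun T => evalAt (x T))
  have hψ : ∀ c, SignType.sign (φ' c) = SignType.sign (ψ c) := by
    intro c
    symm
    refine (sign_germ U (g := fun T => c.1 (x T))).2 ?_
    refine Ultrafilter.of_le _ ?_
    filter_upwards [eventually_ge_atTop {c}] with T hT
    exact hx T c (hT (Finset.mem_singleton_self c))
  obtain ⟨K, _, c, i, j, hic, hjc, hij⟩ := exists_field_of_sameSigns φ' ψ hψ
  let cst (a : ℝ) : analyticRing (Fin k → ℝ) := ⟨fun _ => a, analyticAt_const⟩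
  have hi : ∀ a, i (c a) = φ' a := fun a => RingHom.congr_fun hic a
  have hj : ∀ a, j (c a) = ψ a := fun a => RingHom.congr_fun hjc a
  have hc₁ : i (c (cst (-ε))) < φ sndFun := by
    rw [hi, ← sub_pos]
    change 0 < φ sndFun - φ _
    rw [← map_sub]
    refine hφ.pos ?_
    change 0 < 0 - (-ε)
    simpa using hε
  have hc₂ : φ sndFun < i (c (cst ε)) := by
    rw [hi, ← sub_pos]
    change 0 < φ _ - φ sndFun
    rw [← map_sub]
    refine hφ.pos ?_
    change 0 < ε - 0
    simpa using hε
  obtain ⟨r', hr'⟩ := exists_sameSigns_of_bounded hR (polynomialIVT_germ U) hij hc₁ hc₂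
    (S.attach.image (fun f => (P f).map c) ∪ {X - C (c (cst (-ε))), C (c (cst ε)) - X})
  induction r' using Germ.inductionOn with | _ t => ?_
  have e₁ : ∀ᶠ T in (U : Filter (Finset (analyticRing (Fin k → ℝ)))), -ε < t T := by
    have := hr' (X - C (c (cst (-ε))))
      (Finset.mem_union_right _ (Finset.mem_insert_self _ _))
    simp only [Polynomial.map_sub, map_X, map_C, eval_sub, eval_X, eval_C] at this
    rw [sign_pos (sub_pos.2 hc₁), eq_comm, sign_eq_one_iff, sub_pos, hj] at this
    exact Germ.coe_lt.1 this
  have e₂ : ∀ᶠ T in (U : Filter (Finset (analyticRing (Fin k → ℝ)))), t T < ε := by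
    have := hr' (C (c (cst ε)) - X)
      (Finset.mem_union_right _ (Finset.mem_insert_of_mem (Finset.mem_singleton_self _)))
    simp only [Polynomial.map_sub, map_X, map_C, eval_sub, eval_X, eval_C] at this
    rw [sign_pos (sub_pos.2 hc₂), eq_comm, sign_eq_one_iff, sub_pos, hj] at this
    exact Germ.coe_lt.1 this
  have e₃ : ∀ᶠ T in (U : Filter (Finset (analyticRing (Fin k → ℝ)))), ∀ f : S,
      SignType.sign (((P f).map (evalAt (x T))).eval (t T)) =
        SignType.sign (((P f).map φ').eval (φ sndFun)) := by
    refine eventually_all.2 fun f => ?_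
    have := hr' ((P f).map c) (Finset.mem_union_left _ (Finset.mem_image_of_mem _ (S.mem_attach f)))
    rw [Polynomial.map_map, Polynomial.map_map, hic, hjc, eval_germ] at this
    exact (sign_germ U).1 this.symm
  obtain ⟨T, h₁, h₂, h₃⟩ := (e₁.and (e₂.and e₃)).exists
  have hz := hp (hx₁ T) (hε2 (t T) (by
    rw [mem_ball_zero_iff, Real.norm_eq_abs, abs_lt]
    exact ⟨h₁, h₂⟩))
  refine ⟨(x T, t T), hz.1, fun f hf => ?_⟩
  obtain ⟨h4, h5⟩ := hz.2 ⟨f, hf⟩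
  rw [h4, sign_mul, h5, h₃ ⟨f, hf⟩, ← hφf ⟨f, hf⟩]

end RegularStep

theorem artinLang_zero : ArtinLang (Fin 0 → ℝ) := by
  intro R _ _ _ _ φ hφ S N hN
  refine ⟨0, mem_of_mem_nhds hN, fun f _ => ?_⟩
  by_cases h : f.1 0 = 0
  · have : φ f = 0 := hφ f (Eventually.of_forall fun x => by rw [Subsingleton.elim x 0, h])
    rw [h, this, sign_zero, sign_zero]
  · exact (hφ.sign_eq h).symm

theorem artinLang_succ {k : ℕ} (ih : ArtinLang (Fin k → ℝ)) : ArtinLang (Fin (k + 1) → ℝ) := by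
  classical
  intro R _ _ _ hR φ hφ S N hN
  let S₁ := S.filter fun f => ¬ ∀ᶠ x in 𝓝 0, f.1 x = 0
  let π₀ : analyticRing (Fin (k + 1) → ℝ) := ⟨fun x => x 0,
    (ContinuousLinearMap.proj (R := ℝ) (φ := fun _ : Fin (k + 1) => ℝ) 0).analyticAt 0⟩
  have hπ₀ : ¬ ∀ᶠ x in 𝓝 0, π₀.1 x = 0 := by
    intro h
    have c : Tendsto (fun t : ℝ => (fun _ => t : (Fin (k + 1) → ℝ))) (𝓝 0) (𝓝 0) := by
      have : Continuous fun t : ℝ => (fun _ => t : (Fin (k + 1) → ℝ)) := by fun_prop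
      exact this.tendsto' _ _ rfl
    obtain ⟨t, ht, ht0⟩ := (((c.eventually h).filter_mono nhdsWithin_le_nhds).and
      (self_mem_nhdsWithin (s := ({0}ᶜ : Set ℝ)))).exists
    exact ht0 ht
  have hprod := not_eventually_prod_eq_zero (S := insert π₀ S₁) (by
    intro f hf
    rcases Finset.mem_insert.1 hf with rfl | hf
    · exact hπ₀
    · exact (Finset.mem_filter.1 hf).2)
  obtain ⟨v, hv, hline⟩ := exists_ne_zero_line (∏ f ∈ insert π₀ S₁, f).2 hprod
  have hfac : ∀ f ∈ insert π₀ S₁, ∀ x, f.1 x = 0 → (∏ f ∈ insert π₀ S₁, f).1 x = 0 := by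
    intro f hf x hx
    rw [← evalAt_apply, map_prod]
    exact Finset.prod_eq_zero hf hx
  have hv0 : v 0 ≠ 0 := fun h => hv (hfac π₀ (Finset.mem_insert_self _ _) v h)
  have hreg : ∀ f ∈ S₁, ¬ ∀ᶠ t : ℝ in 𝓝 0, f.1 (t • v) = 0 := fun f hf h =>
    hline (h.mono fun t ht => hfac f (Finset.mem_insert_of_mem hf) _ ht)
  -- linear coordinates in which `v` is the last basis vector
  let L : (Fin k → ℝ) × ℝ →L[ℝ] (Fin (k + 1) → ℝ) := LinearMap.toContinuousLinearMap
    { toFun := fun z i => Fin.cons (α := fun _ => ℝ) 0 z.1 i + z.2 * v i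
      map_add' := fun a b => by
        ext i; refine Fin.cases ?_ (fun i => ?_) i <;> simp <;> ring
      map_smul' := fun r a => by
        ext i; refine Fin.cases ?_ (fun i => ?_) i <;> simp <;> ring }
  let M : (Fin (k + 1) → ℝ) →L[ℝ] (Fin k → ℝ) × ℝ := LinearMap.toContinuousLinearMap
    { toFun := fun y => (fun i => y i.succ - y 0 / v 0 * v i.succ, y 0 / v 0)
      map_add' := fun a b => by
        ext <;> simp <;> ring
      map_smul' := fun r a => by
        ext <;> simp <;> ring }
  have hLM : ∀ y, L (M y) = y := by
    intro y
    ext i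
    refine Fin.cases ?_ (fun i => ?_) i
    · change 0 + y 0 / v 0 * v 0 = y 0
      field_simp
      ring_nf
    · change y i.succ - y 0 / v 0 * v i.succ + y 0 / v 0 * v i.succ = y i.succ
      ring
  have hL0 : ∀ t : ℝ, L (0, t) = t • v := by
    intro t
    ext i
    refine Fin.cases ?_ (fun i => ?_) i
    · change 0 + t * v 0 = t * v 0
      ring
    · change 0 + t * v i.succ = t * v i.succ
      ring
  have hLt : Tendsto L (𝓝 0) (𝓝 0) := L.continuous.tendsto' _ _ (map_zero L)
  have hMt : Tendsto M (𝓝 0) (𝓝 0) := M.continuous.tendsto' _ _ (map_zero M)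
  have hN₁ : ∀ᶠ x in 𝓝 (0 : (Fin (k + 1) → ℝ)), x ∈ N ∧ ∀ f ∈ S \ S₁, f.1 x = 0 := by
    refine Eventually.and hN ((Finset.eventually_all _).2 fun f hf => ?_)
    rw [Finset.mem_sdiff, Finset.mem_filter, not_and, not_not] at hf
    exact hf.2 hf.1
  obtain ⟨z, hz, hzS⟩ := artinLang_of_regular ih hR (φ := φ.comp (pullback M))
    (fun f hf => hφ _ (hMt.eventually hf)) (S := S₁.image (pullback L)) (by
      intro f hf
      obtain ⟨f, hfS, rfl⟩ := Finset.mem_image.1 hf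
      simp only [pullback_apply, hL0]
      exact hreg f hfS) (hLt.eventually hN₁)
  refine ⟨L z, hz.1, fun f hf => ?_⟩
  by_cases hf₁ : f ∈ S₁
  · have h1 := hzS (pullback L f) (Finset.mem_image_of_mem _ hf₁)
    have h2 : pullback M (pullback L f) = f := by
      ext y
      change f.1 (L (M y)) = f.1 y
      rw [hLM]
    rwa [RingHom.comp_apply, h2] at h1
  · have h1 := hz.2 f (Finset.mem_sdiff.2 ⟨hf, hf₁⟩)
    rw [Finset.mem_filter, not_and, not_not] at hf₁
    rw [h1, hφ f (hf₁ hf), sign_zero, sign_zero]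

theorem artinLang (m : ℕ) : ArtinLang (Fin m → ℝ) := by
  induction m with
  | zero => exact artinLang_zero
  | succ k ih => exact artinLang_succ ih

section Certificates

variable {A : Type*} [CommRing A]

/-- Some even power of `f` plus a sum of squares lies in `I`, i.e. `f` is in the real radical. -/
def MemRealRadical (f : A) (I : Ideal A) : Prop :=
  ∃ k : ℕ, 1 ≤ k ∧ ∃ s, IsSumSq s ∧ f ^ (2 * k) + s ∈ I

theorem exists_maximal_not_memRealRadical {f : A} {I : Ideal A} (h : ¬ MemRealRadical f I) :
    ∃ P : Ideal A, I ≤ P ∧ Maximal (fun J => ¬ MemRealRadical f J) P := by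
  refine zorn_le_nonempty₀ {J : Ideal A | ¬ MemRealRadical f J} ?_ I h
  intro c hc hchain J hJ
  refine ⟨sSup c, ?_, fun z hz => le_sSup hz⟩
  rintro ⟨k, hk, s, hs, hmem⟩
  obtain ⟨J', hJ', hmem'⟩ :=
    (Submodule.mem_sSup_of_directed ⟨J, hJ⟩ hchain.directedOn).1 hmem
  exact hc hJ' ⟨k, hk, s, hs, hmem'⟩

variable {f : A} {P : Ideal A}

theorem exists_of_maximal (hP : Maximal (fun J => ¬ MemRealRadical f J) P) {a : A} (ha : a ∉ P) :
    ∃ k : ℕ, 1 ≤ k ∧ ∃ s, IsSumSq s ∧ ∃ c, ∃ p ∈ P, c * a + p = f ^ (2 * k) + s := by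
  have hlt : ¬ Ideal.span {a} ⊔ P ≤ P := fun hle =>
    ha (hle (Ideal.mem_sup_left (Ideal.mem_span_singleton_self a)))
  have : MemRealRadical f (Ideal.span {a} ⊔ P) := by
    by_contra hc
    exact hlt (hP.2 hc le_sup_right)
  obtain ⟨k, hk, s, hs, hmem⟩ := this
  exact ⟨k, hk, s, hs, Ideal.mem_span_singleton_sup.1 hmem⟩

theorem exists_sq_mul_sq {k l : ℕ} {s t : A} (hs : IsSumSq s) (ht : IsSumSq t) :
    ∃ u, IsSumSq u ∧ (f ^ (2 * k) + s) * (f ^ (2 * l) + t) = f ^ (2 * (k + l)) + u := by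
  have h : ∀ j, IsSumSq (f ^ (2 * j)) := fun j => by
    rw [two_mul, pow_add]
    exact IsSumSq.mul_self _
  refine ⟨f ^ (2 * k) * t + s * f ^ (2 * l) + s * t,
    (((h k).mul ht).add (hs.mul (h l))).add (hs.mul ht), by ring⟩

theorem isPrime_of_maximal (hP : Maximal (fun J => ¬ MemRealRadical f J) P) : P.IsPrime := by
  refine Ideal.isPrime_iff.2 ⟨?_, ?_⟩
  · rintro rfl
    exact hP.1 ⟨1, le_rfl, 0, .zero, Submodule.mem_top⟩
  · intro a b hab
    by_contra! hc
    obtain ⟨k, hk, s, hs, c, p, hp, h1⟩ := exists_of_maximal hP hc.1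
    obtain ⟨l, -, t, ht, d, q, hq, h2⟩ := exists_of_maximal hP hc.2
    obtain ⟨u, hu, h3⟩ := exists_sq_mul_sq (f := f) (k := k) (l := l) hs ht
    refine hP.1 ⟨k + l, by lia, u, hu, ?_⟩
    rw [← h3, ← h1, ← h2]
    have : (c * a + p) * (d * b + q) = c * d * (a * b) + (c * a) * q + (d * b + q) * p := by ring
    rw [this]
    exact P.add_mem (P.add_mem (P.mul_mem_left _ hab) (P.mul_mem_left _ hq)) (P.mul_mem_left _ hp)

theorem mem_of_mul_self_add_mem (hP : Maximal (fun J => ¬ MemRealRadical f J) P) {y t : A}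
    (ht : IsSumSq t) (h : y * y + t ∈ P) : y ∈ P := by
  by_contra hy
  obtain ⟨k, hk, s, hs, c, p, hp, h1⟩ := exists_of_maximal hP hy
  obtain ⟨u, hu, h3⟩ := exists_sq_mul_sq (f := f) (k := k) (l := k) hs hs
  refine hP.1 ⟨k + k, by lia, u + c * c * t, hu.add ((IsSumSq.mul_self c).mul ht), ?_⟩
  rw [← add_assoc, ← h3, ← h1]
  have : (c * y + p) * (c * y + p) + c * c * t = c * c * (y * y + t) + (2 * c * y + p) * p := by
    ring
  rw [this]
  exact P.add_mem (P.mul_mem_left _ h) (P.mul_mem_left _ hp)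

theorem exists_clear_denominators {Q K : Type*} [CommRing Q] [IsDomain Q] [Field K] [Algebra Q K]
    [IsFractionRing Q K] {s : K} (hs : IsSumSq s) :
    ∃ y : Q, y ≠ 0 ∧ ∃ t : Q, IsSumSq t ∧
      algebraMap Q K t = s * (algebraMap Q K y * algebraMap Q K y) := by
  induction hs with
  | zero => exact ⟨1, one_ne_zero, 0, .zero, by simp⟩
  | sq_add a hs ih =>
    obtain ⟨y, hy, t, ht, h⟩ := ih
    obtain ⟨u, v, hv, rfl⟩ := IsFractionRing.div_surjective (A := Q) a
    have hv0 : v ≠ 0 := nonZeroDivisors.ne_zero hv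
    have hv1 : algebraMap Q K v ≠ 0 := by simpa using hv0
    refine ⟨v * y, mul_ne_zero hv0 hy, u * y * (u * y) + v * v * t,
      (IsSumSq.mul_self _).add ((IsSumSq.mul_self v).mul ht), ?_⟩
    simp only [map_add, map_mul, h]
    field_simp

theorem not_isSumSq_neg_one_of_maximal (hP : Maximal (fun J => ¬ MemRealRadical f J) P)
    [P.IsPrime] : ¬ IsSumSq (-1 : FractionRing (A ⧸ P)) := by
  intro h
  obtain ⟨y, hy, t, ht, hyt⟩ := exists_clear_denominators (Q := A ⧸ P) h
  obtain ⟨y, rfl⟩ := Ideal.Quotient.mk_surjective y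
  obtain ⟨t, hts, rfl⟩ := exists_isSumSq_map_eq (Ideal.Quotient.mk P)
    Ideal.Quotient.mk_surjective ht
  refine hy (Ideal.Quotient.eq_zero_iff_mem.2 (mem_of_mul_self_add_mem hP hts ?_))
  rw [← Ideal.Quotient.eq_zero_iff_mem]
  apply IsFractionRing.injective (A ⧸ P) (FractionRing (A ⧸ P))
  simp only [map_add, map_mul, map_zero] at hyt ⊢
  rw [hyt]
  ring

end Certificates

/-- The abstract real Nullstellensatz. -/
theorem exists_ringHom_of_not_memRealRadical {A : Type} [CommRing A] {f : A} {I : Ideal A}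
    (h : ¬ MemRealRadical f I) :
    ∃ (R : Type) (_ : Field R) (_ : LinearOrder R) (_ : IsStrictOrderedRing R) (φ : A →+* R),
      PolynomialIVT R ∧ (∀ a ∈ I, φ a = 0) ∧ φ f ≠ 0 := by
  obtain ⟨P, hIP, hP⟩ := exists_maximal_not_memRealRadical h
  have := isPrime_of_maximal hP
  obtain ⟨R, _, _, _, i, hR⟩ :=
    exists_real_closure (FractionRing (A ⧸ P)) (not_isSumSq_neg_one_of_maximal hP)
  have hj : Function.Injective (i.comp (algebraMap (A ⧸ P) (FractionRing (A ⧸ P)))) :=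
    i.injective.comp (IsFractionRing.injective _ _)
  refine ⟨R, inferInstance, inferInstance, inferInstance,
    (i.comp (algebraMap (A ⧸ P) (FractionRing (A ⧸ P)))).comp (Ideal.Quotient.mk P), hR,
    fun a ha => ?_, fun h0 => ?_⟩
  · rw [RingHom.comp_apply, Ideal.Quotient.eq_zero_iff_mem.2 (hIP ha), map_zero]
  · have := Ideal.Quotient.eq_zero_iff_mem.1 ((injective_iff_map_eq_zero _).1 hj _ h0)
    refine hP.1 ⟨1, le_rfl, 0, .zero, ?_⟩
    rw [add_zero, mul_one, pow_two]
    exact P.mul_mem_left _ this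

/-- The ideal of functions which vanish near the origin. -/
def locallyZero (E : Type*) [NormedAddCommGroup E] [NormedSpace ℝ E] :
    Ideal (analyticRing E) where
  carrier := {f | ∀ᶠ x in 𝓝 0, f.1 x = 0}
  add_mem' {f g} hf hg := by
    filter_upwards [hf, hg] with x h1 h2
    change f.1 x + g.1 x = 0
    rw [h1, h2, add_zero]
  zero_mem' := Eventually.of_forall fun _ => rfl
  smul_mem' c f hf := by
    filter_upwards [hf] with x h1
    change c.1 x * f.1 x = 0
    rw [h1, mul_zero]

theorem exists_sum_sq_of_isSumSq {A : Type*} [CommRing A] {s : A} (hs : IsSumSq s) :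
    ∃ (l : ℕ) (b : Fin l → A), s = ∑ i, b i ^ 2 := by
  induction hs with
  | zero => exact ⟨0, Fin.elim0, by simp⟩
  | sq_add a hs ih =>
    obtain ⟨l, b, rfl⟩ := ih
    exact ⟨l + 1, Fin.cons a b, by simp [Fin.sum_univ_succ, pow_two]⟩

end Risler

/-- **Risler's Nullstellensatz for germs of real analytic functions.**
Let `U` be an open neighborhood of `0` in `ℝ^m` and `f, g₁, …, gₙ : U → ℝ` real analytic
functions such that for all `a ∈ U`, `g₁(a) = ⋯ = gₙ(a) = 0` implies `f(a) = 0`. Then there are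
an open neighborhood `V ⊆ U` of `0`, real analytic functions `b₁, …, b_l, h₁, …, hₙ : V → ℝ`,
and `k ≥ 1` such that `f^{2k} + b₁² + ⋯ + b_l² = g₁h₁ + ⋯ + gₙhₙ` on `V`. -/
theorem stmt_9 {m n : ℕ} {U : Set (Fin m → ℝ)} (hU : IsOpen U) (hU0 : (0 : Fin m → ℝ) ∈ U)
    (f : (Fin m → ℝ) → ℝ) (g : Fin n → (Fin m → ℝ) → ℝ)
    (hf : ∀ x ∈ U, AnalyticAt ℝ f x) (hg : ∀ j, ∀ x ∈ U, AnalyticAt ℝ (g j) x)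
    (H : ∀ a ∈ U, (∀ j, g j a = 0) → f a = 0) :
    ∃ V : Set (Fin m → ℝ), IsOpen V ∧ (0 : Fin m → ℝ) ∈ V ∧ V ⊆ U ∧
      ∃ (l : ℕ) (b : Fin l → (Fin m → ℝ) → ℝ) (h : Fin n → (Fin m → ℝ) → ℝ) (k : ℕ), 1 ≤ k ∧
        (∀ i, ∀ x ∈ V, AnalyticAt ℝ (b i) x) ∧ (∀ j, ∀ x ∈ V, AnalyticAt ℝ (h j) x) ∧
        ∀ a ∈ V, f a ^ (2 * k) + ∑ i, (b i a) ^ 2 = ∑ j, g j a * h j a := by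
  classical
  let F : Risler.analyticRing (Fin m → ℝ) := ⟨f, hf 0 hU0⟩
  let G : Fin n → Risler.analyticRing (Fin m → ℝ) := fun j => ⟨g j, hg j 0 hU0⟩
  have key : Risler.MemRealRadical F
      (Ideal.span (Set.range G) ⊔ Risler.locallyZero (Fin m → ℝ)) := by
    by_contra hc
    obtain ⟨R, _, _, _, φ, hR, hφ, hφF⟩ := Risler.exists_ringHom_of_not_memRealRadical hc
    obtain ⟨x, hxU, hx⟩ := Risler.artinLang m R hR φ
      (fun z hz => hφ z (Ideal.mem_sup_right hz)) (insert F (Finset.univ.image G)) U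
      (hU.mem_nhds hU0)
    have hF := hx F (Finset.mem_insert_self _ _)
    refine hφF ?_
    rw [← sign_eq_zero_iff, ← hF, sign_eq_zero_iff]
    refine H x hxU fun j => ?_
    have hG := hx (G j)
      (Finset.mem_insert_of_mem (Finset.mem_image_of_mem G (Finset.mem_univ j)))
    rwa [hφ (G j) (Ideal.mem_sup_left (Ideal.subset_span ⟨j, rfl⟩)), sign_zero,
      sign_eq_zero_iff] at hG
  obtain ⟨k, hk, s, hs, hmem⟩ := key
  obtain ⟨l, b, rfl⟩ := Risler.exists_sum_sq_of_isSumSq hs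
  obtain ⟨y, hy, z, hz, hyz⟩ := Submodule.mem_sup.1 hmem
  obtain ⟨c, rfl⟩ := Ideal.mem_span_range_iff_exists_fun.1 hy
  have hev : ∀ᶠ x in nhds (0 : Fin m → ℝ), x ∈ U ∧ (∀ i, AnalyticAt ℝ (b i).1 x) ∧
      (∀ j, AnalyticAt ℝ (c j).1 x) ∧ z.1 x = 0 :=
    Filter.Eventually.and (hU.mem_nhds hU0)
      ((Filter.eventually_all.2 fun i => AnalyticAt.eventually_analyticAt (b i).2).and
        ((Filter.eventually_all.2 fun j => AnalyticAt.eventually_analyticAt (c j).2).and hz))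
  obtain ⟨V, hV, hVo, hV0⟩ := eventually_nhds_iff.1 hev
  refine ⟨V, hVo, hV0, fun x hx => (hV x hx).1, l, fun i => (b i).1, fun j => (c j).1, k, hk,
    fun i x hx => (hV x hx).2.1 i, fun j x hx => (hV x hx).2.2.1 j, fun a ha => ?_⟩
  have := congrArg (Risler.evalAt a) hyz
  simp only [map_add, map_sum, map_mul, map_pow, Risler.evalAt_apply, (hV a ha).2.2.2,
    add_zero] at this
  rw [← this]
  exact Finset.sum_congr rfl fun j _ => mul_comm _ _
end

section
/- Let A ⊆ B be an extension of commutative rings with A Noetherian, and let I be an ideal of A such that I = { a ∈ A : a^k ∈ I·B for some k ≥ 1 }, where I·B is the ideal of B generated by I. Then every minimal prime ideal P of A containing I satisfies P = { a ∈ A : a^k ∈ P·B for some k ≥ 1 }. -/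
/-- In a Noetherian ring, a minimal prime `P` over a radical ideal `I` admits a multiplier
outside `P` carrying `P` into `I`. -/
theorem exists_notMem_forall_mul_mem_of_mem_minimalPrimes {A : Type*} [CommRing A]
    [IsNoetherianRing A] {I P : Ideal A} (hI : I.IsRadical) (hP : P ∈ I.minimalPrimes) :
    ∃ c ∉ P, ∀ p ∈ P, c * p ∈ I := by
  have hfin : (I.minimalPrimes \ {P}).Finite :=
    (Ideal.finite_minimalPrimes_of_isNoetherianRing A I).sdiff
  have hPp : P.IsPrime := hP.1.1
  have hnot : ¬ hfin.toFinset.inf id ≤ P := by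
    rw [hPp.inf_le']
    rintro ⟨Q, hQ, hQP⟩
    obtain ⟨hQ, hne⟩ := hfin.mem_toFinset.1 hQ
    exact hne (le_antisymm hQP (hP.2 hQ.1 hQP))
  obtain ⟨c, hc, hcP⟩ := SetLike.not_le_iff_exists.1 hnot
  refine ⟨c, hcP, fun p hp => ?_⟩
  rw [← hI.radical, ← Ideal.sInf_minimalPrimes, Ideal.mem_sInf]
  intro Q hQ
  by_cases h : Q = P
  · exact h ▸ P.mul_mem_left c hp
  · exact Q.mul_mem_right p
      ((Finset.inf_le (f := id) (hfin.mem_toFinset.2 ⟨hQ, h⟩) : _ ≤ Q) hc)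

/-- If `c` multiplies `P` into `I`, then its image multiplies the extension of `P` into the
extension of `I`. -/
theorem Ideal.map_mul_mem_map_of_forall_mul_mem {A B : Type*} [CommRing A] [CommRing B]
    (f : A →+* B) {I P : Ideal A} {c : A} (hc : ∀ p ∈ P, c * p ∈ I) {x : B}
    (hx : x ∈ P.map f) : f c * x ∈ I.map f := by
  have hle : Ideal.span {c} * P ≤ I := by
    rw [Ideal.span_singleton_mul_le_iff]
    exact hc
  apply Ideal.map_mono hle
  rw [Ideal.map_mul]
  exact Ideal.mul_mem_mul (Ideal.mem_map_of_mem f (Ideal.mem_span_singleton_self c)) hx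

/-- Let `A ⊆ B` be an extension of commutative rings with `A` Noetherian,
and let `I` be an ideal of `A` such that `I = {a ∈ A : a^k ∈ I·B for some k ≥ 1}`.
Then every minimal prime `P` of `A` over `I` satisfies
`P = {a ∈ A : a^k ∈ P·B for some k ≥ 1}`. -/
theorem stmt_17 {A B : Type*} [CommRing A] [CommRing B] [IsNoetherianRing A]
    [Algebra A B] (hAB : Function.Injective (algebraMap A B))
    (I : Ideal A)
    (hI : ∀ a : A, a ∈ I ↔ ∃ k : ℕ, 1 ≤ k ∧
      (algebraMap A B a) ^ k ∈ Ideal.map (algebraMap A B) I)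
    (P : Ideal A) (hP : P ∈ I.minimalPrimes) :
    ∀ a : A, a ∈ P ↔ ∃ k : ℕ, 1 ≤ k ∧
      (algebraMap A B a) ^ k ∈ Ideal.map (algebraMap A B) P := by
  have hrad : I.IsRadical := by
    rintro a ⟨n, hn⟩
    refine (hI a).2 ⟨n + 1, n.succ_pos, ?_⟩
    rw [← map_pow, pow_succ]
    exact Ideal.mem_map_of_mem _ (I.mul_mem_right a hn)
  obtain ⟨c, hcP, hc⟩ := exists_notMem_forall_mul_mem_of_mem_minimalPrimes hrad hP
  have hPp : P.IsPrime := hP.1.1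
  refine fun a => ⟨fun ha => ⟨1, le_rfl, ?_⟩, ?_⟩
  · rw [pow_one]
    exact Ideal.mem_map_of_mem _ ha
  · rintro ⟨k, hk, hak⟩
    have hca : c * a ∈ I := by
      refine (hI _).2 ⟨k, hk, ?_⟩
      obtain ⟨m, rfl⟩ := Nat.exists_eq_add_of_le' hk
      rw [map_mul, mul_pow, pow_succ (algebraMap A B c), mul_assoc]
      exact Ideal.mul_mem_left _ _ (Ideal.map_mul_mem_map_of_forall_mul_mem _ hc hak)
    exact (hPp.mem_or_mem (hP.1.2 hca)).resolve_left hcP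
end
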